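/- arXiv:1211.2184 — 5 statements merged into one kernel-verified Lean document; each statement's English description precedes it below -/
import Mathlib

section
/- Let L ∈ C^∞(S^1 × Tℝ^n) satisfy conditions (L1) and (L2). Then the Lagrangian action satisfies the Palais–Smale condition: if (γ_k)_k is a sequence of loops γ_k : S^1 → ℝ^n, each absolutely continuous with square-integrable derivative, such that (𝒮_L(γ_k))_k is bounded and sup{ |d𝒮_L(γ_k)(ξ)| : ξ ∈ C^∞(S^1,ℝ^n), ∫_0^1 |ξ|² + |ξ̇|² dt ≤ 1 } → 0 as k → ∞, then (γ_k)_k has a subsequence converging in W^{1,2}: there exist a subsequence (γ_{k_j}) and a loop γ_∞, absolutely continuous with square-integrable derivative, such that ∫_0^1 |γ_{k_j}(t) − γ_∞(t)|² + |γ̇_{k_j}(t) − γ̇_∞(t)|² dt → 0 as j → ∞. -/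
/-!
Statement 3 (Corollary 3.4): the Palais–Smale condition for the Lagrangian action of a
Lagrangian satisfying (L1) and (L2).
-/

open scoped RealInnerProductSpace
open MeasureTheory Filter

noncomputable section

abbrev E (n : ℕ) : Type := EuclideanSpace ℝ (Fin n)

/-- A `W^{1,2}`-loop: `γ` is 1-periodic, absolutely continuous with square-integrable
derivative `g`. -/
structure W12Loop (n : ℕ) (γ g : ℝ → E n) : Prop where
  periodic : ∀ t, γ (t + 1) = γ t
  gper : ∀ t, g (t + 1) = g t
  meas : Measurable g
  locint : ∀ a b : ℝ, IntervalIntegrable g volume a b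
  sq : IntervalIntegrable (fun t => ‖g t‖ ^ 2) volume 0 1
  repr : ∀ t, γ t = γ 0 + ∫ u in (0 : ℝ)..t, g u

/-- Condition (L1). -/
def CondL1 {n : ℕ} (L : ℝ → E n → E n → ℝ) : Prop :=
  ∃ a : ℝ, 0 < a ∧ (∀ k : ℤ, a ≠ (k : ℝ) * Real.pi) ∧
    ∃ C : ℝ, ∀ (t : ℝ) (z : E n × E n), ∀ i : ℕ, i ≤ 2 →
      ‖iteratedFDeriv ℝ i
        (fun w : E n × E n => L t w.1 w.2 - (‖w.2‖ ^ 2 / (4 * a) - a * ‖w.1‖ ^ 2)) z‖ ≤ C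

/-- Condition (L2): uniform fiberwise convexity,
`∂_v² L(t,q,v)(w,w) ≥ c|w|²` for some `c > 0`. -/
def CondL2 {n : ℕ} (L : ℝ → E n → E n → ℝ) : Prop :=
  ∃ c : ℝ, 0 < c ∧ ∀ (t : ℝ) (q v w : E n),
    c * ‖w‖ ^ 2 ≤ (iteratedFDeriv ℝ 2 (fun v' => L t q v') v) ![w, w]

/-- The Lagrangian action `𝒮_L(γ) = ∫₀¹ L(t, γ(t), γ̇(t)) dt`. -/
def SL {n : ℕ} (L : ℝ → E n → E n → ℝ) (γ g : ℝ → E n) : ℝ :=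
  ∫ t in (0 : ℝ)..1, L t (γ t) (g t)

/-- The differential of the Lagrangian action. -/
def dSL {n : ℕ} (L : ℝ → E n → E n → ℝ) (γ g ξ : ℝ → E n) : ℝ :=
  ∫ t in (0 : ℝ)..1,
    ⟪gradient (fun q => L t q (g t)) (γ t), ξ t⟫ +
    ⟪gradient (fun v => L t (γ t) v) (g t), deriv ξ t⟫

/-- Lebesgue measure on the fundamental domain `(0, 1]`. -/
abbrev unitMeasure : Measure ℝ := volume.restrict (Set.Ioc (0 : ℝ) 1)

section SquareIntegrable

variable {F : Type*} [NormedAddCommGroup F] [InnerProductSpace ℝ F] {f h : ℝ → F}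

lemma intervalIntegrable_unit_iff {X : Type*} [NormedAddCommGroup X] {u : ℝ → X} :
    IntervalIntegrable u volume 0 1 ↔ Integrable u unitMeasure :=
  intervalIntegrable_iff_integrableOn_Ioc_of_le zero_le_one

lemma MeasureTheory.MemLp.norm_sq_intervalIntegrable {X : Type*} [NormedAddCommGroup X] {u : ℝ → X}
    (hf : MemLp u 2 unitMeasure) :
    IntervalIntegrable (fun t => ‖u t‖ ^ 2) volume 0 1 :=
  intervalIntegrable_unit_iff.2 hf.norm.integrable_sq

lemma MeasureTheory.MemLp.intervalIntegrable_unit {X : Type*} [NormedAddCommGroup X] {u : ℝ → X}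
    (hf : MemLp u 2 unitMeasure) :
    IntervalIntegrable u volume 0 1 :=
  intervalIntegrable_unit_iff.2 (hf.integrable one_le_two)

lemma MeasureTheory.MemLp.inner_intervalIntegrable
    (hf : MemLp f 2 unitMeasure) (hh : MemLp h 2 unitMeasure) :
    IntervalIntegrable (fun t => ⟪f t, h t⟫) volume 0 1 := by
  refine intervalIntegrable_unit_iff.2 ?_
  refine (hf.norm.integrable_mul hh.norm).mono'
    (hf.aestronglyMeasurable.inner hh.aestronglyMeasurable) (.of_forall fun t => ?_)
  exact norm_inner_le_norm _ _

lemma Continuous.memLp_unitMeasure {X : Type*} [NormedAddCommGroup X] {u : ℝ → X}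
    (hu : Continuous u) : MemLp u 2 unitMeasure := by
  obtain ⟨C, hC⟩ := (isCompact_Icc (a := (0 : ℝ)) (b := 1)).exists_bound_of_continuousOn
    hu.continuousOn
  refine MemLp.of_bound (hu.aestronglyMeasurable) C ?_
  filter_upwards [ae_restrict_mem measurableSet_Ioc] with t ht
  exact hC t ⟨ht.1.le, ht.2⟩

lemma sq_integral_norm_le {X : Type*} [NormedAddCommGroup X] {f : ℝ → X}
    (hf : MemLp f 2 unitMeasure) :
    (∫ t in (0 : ℝ)..1, ‖f t‖) ^ 2 ≤ ∫ t in (0 : ℝ)..1, ‖f t‖ ^ 2 := by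
  set x := ∫ t in (0 : ℝ)..1, ‖f t‖ with hx
  have h1 := hf.norm_sq_intervalIntegrable
  have h2 := hf.intervalIntegrable_unit.norm
  have h0 : 0 ≤ ∫ t in (0 : ℝ)..1, (‖f t‖ - x) ^ 2 :=
    intervalIntegral.integral_nonneg zero_le_one fun t _ => sq_nonneg _
  have h3 : ∫ t in (0 : ℝ)..1, (‖f t‖ - x) ^ 2
      = (∫ t in (0 : ℝ)..1, ‖f t‖ ^ 2) - 2 * x * x + x ^ 2 := by
    have : ∀ t, (‖f t‖ - x) ^ 2 = ‖f t‖ ^ 2 - 2 * x * ‖f t‖ + x ^ 2 := fun t => by ring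
    simp_rw [this]
    rw [intervalIntegral.integral_add (h1.sub (h2.const_mul _)) intervalIntegrable_const,
      intervalIntegral.integral_sub h1 (h2.const_mul _), intervalIntegral.integral_const_mul]
    simp [← hx]
  nlinarith

lemma norm_integral_initial_sq_le (hf : MemLp f 2 unitMeasure) {t : ℝ}
    (ht : t ∈ Set.Icc (0 : ℝ) 1) :
    ‖∫ u in (0 : ℝ)..t, f u‖ ^ 2 ≤ ∫ t in (0 : ℝ)..1, ‖f t‖ ^ 2 := by
  refine le_trans ?_ (sq_integral_norm_le hf)
  gcongr
  refine (intervalIntegral.norm_integral_le_integral_norm ht.1).trans ?_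
  exact intervalIntegral.integral_mono_interval le_rfl ht.1 ht.2
    (.of_forall fun _ => norm_nonneg _) hf.intervalIntegrable_unit.norm

end SquareIntegrable

namespace W12Loop

variable {n : ℕ} {γ g γ₁ g₁ : ℝ → E n}

lemma memLp (h : W12Loop n γ g) : MemLp g 2 unitMeasure :=
  (memLp_two_iff_integrable_sq_norm h.meas.aestronglyMeasurable).2
    (intervalIntegrable_unit_iff.1 h.sq)

lemma continuous (h : W12Loop n γ g) : Continuous γ := by
  rw [funext h.repr]
  exact continuous_const.add (intervalIntegral.continuous_primitive h.locint 0)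

lemma memLp_self (h : W12Loop n γ g) : MemLp γ 2 unitMeasure :=
  h.continuous.memLp_unitMeasure

lemma of_memLp (hp : ∀ t, γ (t + 1) = γ t) (hg : ∀ t, g (t + 1) = g t) (hm : Measurable g)
    (hL : MemLp g 2 unitMeasure) (hr : ∀ t, γ t = γ 0 + ∫ u in (0 : ℝ)..t, g u) :
    W12Loop n γ g where
  periodic := hp
  gper := hg
  meas := hm
  locint := Function.Periodic.intervalIntegrable₀ (T := 1) hg one_ne_zero hL.intervalIntegrable_unit
  sq := hL.norm_sq_intervalIntegrable
  repr := hr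

lemma sub (h : W12Loop n γ g) (h₁ : W12Loop n γ₁ g₁) :
    W12Loop n (fun t => γ t - γ₁ t) (fun t => g t - g₁ t) := by
  refine of_memLp (fun t => by rw [h.periodic, h₁.periodic]) (fun t => by rw [h.gper, h₁.gper])
    (h.meas.sub h₁.meas) (h.memLp.sub h₁.memLp) fun t => ?_
  rw [intervalIntegral.integral_sub (h.locint _ _) (h₁.locint _ _), h.repr t, h₁.repr t]
  abel

lemma integral_eq_zero (h : W12Loop n γ g) : ∫ t in (0 : ℝ)..1, g t = 0 := by
  have h1 := h.repr 1
  have h2 := h.periodic 0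
  rw [zero_add] at h2
  rw [h2] at h1
  simpa using h1

end W12Loop

/-- The primitive of a mean-zero periodic square-integrable function is a loop. -/
lemma W12Loop.of_primitive {n : ℕ} {g : ℝ → E n} (x : E n) (hg : ∀ t, g (t + 1) = g t)
    (hm : Measurable g) (hL : MemLp g 2 unitMeasure) (h0 : ∫ t in (0 : ℝ)..1, g t = 0) :
    W12Loop n (fun t => x + ∫ u in (0 : ℝ)..t, g u) g := by
  have hi := Function.Periodic.intervalIntegrable₀ (T := 1) hg one_ne_zero
    hL.intervalIntegrable_unit
  refine .of_memLp (fun t => ?_) hg hm hL fun t => by simp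
  have h1 := Function.Periodic.intervalIntegral_add_eq (T := 1) hg t 0
  rw [zero_add, h0] at h1
  rw [← intervalIntegral.integral_add_adjacent_intervals (hi 0 t) (hi t (t + 1)), h1, add_zero]

section SmoothApproximation

/-- The periodic extension of a smooth function supported in `(0, 1)` is smooth. -/
lemma ContDiff.comp_fract_of_support {F : Type*} [NormedAddCommGroup F] [NormedSpace ℝ F]
    {h : ℝ → F} (hh : ContDiff ℝ (⊤ : ℕ∞) h) (h0 : ∀ t ∉ Set.Ioo (0 : ℝ) 1, h t = 0) :
    ContDiff ℝ (⊤ : ℕ∞) (fun t => h (Int.fract t)) := by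
  rw [contDiff_iff_contDiffAt]
  intro t
  set m : ℤ := ⌊t⌋
  have hs : ContDiffAt ℝ (⊤ : ℕ∞) (fun s : ℝ => h (s - m) + h (s - m + 1)) t := by
    apply ContDiff.contDiffAt
    fun_prop
  refine hs.congr_of_eventuallyEq ?_
  have hmem : Set.Ioo ((m : ℝ) - 1) (m + 1) ∈ nhds t :=
    Ioo_mem_nhds (by linarith [Int.floor_le t]) (Int.lt_floor_add_one t)
  filter_upwards [hmem] with s hs
  rcases le_or_gt (m : ℝ) s with hms | hms
  · have : ⌊s⌋ = m := Int.floor_eq_iff.2 ⟨hms, hs.2⟩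
    rw [Int.fract, this, h0 (s - m + 1) (fun hc => by linarith [hc.2]), add_zero]
  · have : ⌊s⌋ = m - 1 := Int.floor_eq_iff.2 ⟨by push_cast; linarith [hs.1], by push_cast; linarith⟩
    rw [Int.fract, this, h0 (s - m) (fun hc => by linarith [hc.1]), zero_add]
    congr 1
    push_cast
    ring

variable {n : ℕ}

lemma norm_sub_sq_le_two_mul {F : Type*} [NormedAddCommGroup F] (x y z : F) :
    ‖x - z‖ ^ 2 ≤ 2 * ‖x - y‖ ^ 2 + 2 * ‖y - z‖ ^ 2 := by
  have h := norm_sub_le_norm_sub_add_norm_sub x y z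
  nlinarith [norm_nonneg (x - z), sq_nonneg (‖x - y‖ - ‖y - z‖), norm_nonneg (x - y),
    norm_nonneg (y - z)]

lemma integral_norm_sub_sq_le_two_mul {f g h : ℝ → E n} (hf : MemLp f 2 unitMeasure)
    (hg : MemLp g 2 unitMeasure) (hh : MemLp h 2 unitMeasure) :
    (∫ t in (0 : ℝ)..1, ‖f t - h t‖ ^ 2)
      ≤ 2 * (∫ t in (0 : ℝ)..1, ‖f t - g t‖ ^ 2) + 2 * ∫ t in (0 : ℝ)..1, ‖g t - h t‖ ^ 2 := by
  have h1 := (hf.sub hg).norm_sq_intervalIntegrable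
  have h2 := (hg.sub hh).norm_sq_intervalIntegrable
  have h3 := (hf.sub hh).norm_sq_intervalIntegrable
  simp only [Pi.sub_apply] at h1 h2 h3
  rw [← intervalIntegral.integral_const_mul, ← intervalIntegral.integral_const_mul,
    ← intervalIntegral.integral_add (h1.const_mul _) (h2.const_mul _)]
  exact intervalIntegral.integral_mono_on zero_le_one h3 ((h1.const_mul _).add (h2.const_mul _))
    fun t _ => norm_sub_sq_le_two_mul _ _ _

lemma integral_norm_sq_eq_eLpNorm {f : ℝ → E n} (hf : MemLp f 2 unitMeasure) :
    (∫ t in (0 : ℝ)..1, ‖f t‖ ^ 2) = (eLpNorm f 2 unitMeasure).toReal ^ 2 := by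
  rw [intervalIntegral.integral_of_le zero_le_one,
    hf.eLpNorm_eq_integral_rpow_norm (by simp) (by simp), ENNReal.toReal_ofReal (by positivity),
    ← Real.rpow_natCast, ← Real.rpow_mul (by positivity)]
  simp

lemma exists_contDiff_integral_norm_sub_sq_le {f : ℝ → E n} (hf : MemLp f 2 unitMeasure)
    {ε : ℝ} (hε : 0 < ε) :
    ∃ h : ℝ → E n, ContDiff ℝ (⊤ : ℕ∞) h ∧ (∫ t in (0 : ℝ)..1, ‖f t - h t‖ ^ 2) ≤ ε := by
  obtain ⟨h, -, hh, hle⟩ := hf.exist_eLpNorm_sub_le (by simp) one_le_two (Real.sqrt_pos.2 hε)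
  refine ⟨h, hh, ?_⟩
  have := integral_norm_sq_eq_eLpNorm (hf.sub hh.continuous.memLp_unitMeasure)
  simp only [Pi.sub_apply] at this
  rw [this, ← Real.sq_sqrt hε.le]
  gcongr
  exact ENNReal.toReal_le_of_le_ofReal (Real.sqrt_nonneg _) hle

lemma exists_contDiff_support_integral_norm_sub_sq_le {f : ℝ → E n} (hf : MemLp f 2 unitMeasure)
    {ε : ℝ} (hε : 0 < ε) :
    ∃ h : ℝ → E n, ContDiff ℝ (⊤ : ℕ∞) h ∧ (∀ t ∉ Set.Ioo (0 : ℝ) 1, h t = 0) ∧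
      (∫ t in (0 : ℝ)..1, ‖f t - h t‖ ^ 2) ≤ ε := by
  obtain ⟨h, hh, hle⟩ := exists_contDiff_integral_norm_sub_sq_le hf (ε := ε / 4) (by positivity)
  have hd : ∀ m : ℕ, (1 : ℝ) / (m + 5) ≤ 1 / 5 := fun m =>
    one_div_le_one_div_of_le (by norm_num) (by linarith [m.cast_nonneg (α := ℝ)])
  have hd0 : ∀ m : ℕ, (0 : ℝ) < 1 / (m + 5) := fun m => by positivity
  let χ : ∀ m : ℕ, ContDiffBump (1 / 2 : ℝ) := fun m =>
    ⟨1 / 2 - 2 * (1 / (m + 5)), 1 / 2 - 1 / (m + 5), by linarith [hd m], by linarith [hd0 m]⟩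
  have hlim : Tendsto (fun m : ℕ => ∫ t in (0 : ℝ)..1, ‖h t - χ m t • h t‖ ^ 2) atTop
      (nhds (∫ t in (0 : ℝ)..1, (0 : ℝ))) := by
    refine intervalIntegral.tendsto_integral_filter_of_dominated_convergence
      (fun t => ‖h t‖ ^ 2) (.of_forall fun m => ?_) (.of_forall fun m => ?_) ?_ ?_
    · have := hh.continuous
      have := (χ m).continuous
      exact (by fun_prop : Continuous fun t => ‖h t - χ m t • h t‖ ^ 2).aestronglyMeasurable
    · refine .of_forall fun t _ => ?_
      have : h t - χ m t • h t = (1 - χ m t) • h t := by rw [sub_smul, one_smul]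
      rw [this, norm_smul, Real.norm_of_nonneg (by positivity)]
      gcongr
      rw [Real.norm_of_nonneg (by linarith [(χ m).le_one (x := t)])]
      exact mul_le_of_le_one_left (norm_nonneg _) (by linarith [(χ m).nonneg (x := t)])
    · exact (hh.continuous.norm.pow 2).intervalIntegrable _ _
    · have h1 : ∀ᵐ t : ℝ, t ≠ 1 := by simp [ae_iff, measure_singleton]
      filter_upwards [h1] with t ht1 ht
      rw [Set.uIoc_of_le zero_le_one] at ht
      refine tendsto_const_nhds.congr' ?_
      have hz : Tendsto (fun m : ℕ => (1 : ℝ) / (m + 5)) atTop (nhds 0) := by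
        have := (tendsto_const_div_atTop_nhds_zero_nat (1 : ℝ)).comp (tendsto_add_atTop_nat 5)
        refine this.congr fun m => ?_
        simp
      have hpos : 0 < min t (1 - t) / 2 := by
        have := lt_of_le_of_ne ht.2 ht1
        have := ht.1
        have : 0 < min t (1 - t) := lt_min this (by linarith)
        positivity
      filter_upwards [hz.eventually (gt_mem_nhds hpos)] with m hm
      have : χ m t = 1 := (χ m).one_of_mem_closedBall <| by
        rw [Real.closedBall_eq_Icc]
        have h2 := min_le_left t (1 - t)
        have h3 := min_le_right t (1 - t)
        constructor
        · change (1 / 2 : ℝ) - (1 / 2 - 2 * (1 / (m + 5))) ≤ t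
          linarith
        · change t ≤ (1 / 2 : ℝ) + (1 / 2 - 2 * (1 / (m + 5)))
          linarith
      simp [this]
  rw [intervalIntegral.integral_zero] at hlim
  obtain ⟨m, hm⟩ := (hlim.eventually (gt_mem_nhds (by positivity : 0 < ε / 4))).exists
  have hc : ContDiff ℝ (⊤ : ℕ∞) fun t => χ m t • h t := (χ m).contDiff.smul hh
  refine ⟨fun t => χ m t • h t, hc, fun t ht => ?_, ?_⟩
  · have : χ m t = 0 := by
      by_contra hne
      have hmem : t ∈ Function.support (χ m) := hne
      rw [(χ m).support_eq, Real.ball_eq_Ioo] at hmem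
      have h1 : (1 / 2 : ℝ) - (1 / 2 - 1 / (m + 5)) < t := hmem.1
      have h2 : t < (1 / 2 : ℝ) + (1 / 2 - 1 / (m + 5)) := hmem.2
      exact ht ⟨by linarith [hd0 m], by linarith [hd0 m]⟩
    simp [this]
  · have := integral_norm_sub_sq_le_two_mul hf hh.continuous.memLp_unitMeasure
      hc.continuous.memLp_unitMeasure
    linarith

/-- A smooth function supported in `(0, 1)` with integral `1`. -/
lemma exists_contDiff_support_integral_eq_one :
    ∃ ρ : ℝ → ℝ, ContDiff ℝ (⊤ : ℕ∞) ρ ∧ (∀ t ∉ Set.Ioo (0 : ℝ) 1, ρ t = 0) ∧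
      ∫ t in (0 : ℝ)..1, ρ t = 1 := by
  let χ : ContDiffBump (1 / 2 : ℝ) := ⟨1 / 8, 1 / 4, by norm_num, by norm_num⟩
  have hz : ∀ t ∉ Set.Ioo (0 : ℝ) 1, χ.normed volume t = 0 := fun t ht => by
    by_contra hne
    have hmem : t ∈ Function.support (χ.normed volume) := hne
    rw [χ.support_normed_eq, Real.ball_eq_Ioo] at hmem
    have h1 : (1 / 2 : ℝ) - 1 / 4 < t := hmem.1
    have h2 : t < (1 / 2 : ℝ) + 1 / 4 := hmem.2
    exact ht ⟨by linarith, by linarith⟩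
  refine ⟨χ.normed volume, χ.contDiff_normed, hz, ?_⟩
  rw [intervalIntegral.integral_of_le zero_le_one, setIntegral_eq_integral_of_forall_compl_eq_zero]
  · exact χ.integral_normed
  · exact fun t ht => hz t fun h => ht ⟨h.1, h.2.le⟩

/-- Smooth loops are dense in `W^{1,2}`. -/
lemma W12Loop.exists_contDiff_approx {ξ η : ℝ → E n} (hξ : W12Loop n ξ η) {ε : ℝ} (hε : 0 < ε) :
    ∃ ζ : ℝ → E n, ContDiff ℝ (⊤ : ℕ∞) ζ ∧ W12Loop n ζ (deriv ζ) ∧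
      (∫ t in (0 : ℝ)..1, ‖ξ t - ζ t‖ ^ 2 + ‖η t - deriv ζ t‖ ^ 2) ≤ ε := by
  obtain ⟨ρ, hρ, hρ0, hρ1⟩ := exists_contDiff_support_integral_eq_one
  set c := ∫ t in (0 : ℝ)..1, ‖ρ t‖ ^ 2 with hc
  have hc0 : 0 ≤ c := intervalIntegral.integral_nonneg zero_le_one fun _ _ => by positivity
  obtain ⟨h, hh, hh0, hle⟩ := exists_contDiff_support_integral_norm_sub_sq_le hξ.memLp
    (ε := ε / (4 * (1 + c))) (by positivity)
  set δ := ε / (4 * (1 + c)) with hδ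
  have hhL := hh.continuous.memLp_unitMeasure
  set m := ∫ t in (0 : ℝ)..1, h t with hm
  have hm2 : ‖m‖ ^ 2 ≤ δ := by
    have h1 := norm_integral_initial_sq_le (hξ.memLp.sub hhL) (t := 1) (by simp)
    simp only [Pi.sub_apply] at h1
    rw [intervalIntegral.integral_sub hξ.memLp.intervalIntegrable_unit
      hhL.intervalIntegrable_unit, hξ.integral_eq_zero, zero_sub, norm_neg] at h1
    exact h1.trans hle
  let k : ℝ → E n := fun t => h t - ρ t • m
  have hk : ContDiff ℝ (⊤ : ℕ∞) k := hh.sub (hρ.smul contDiff_const)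
  have hk0 : ∀ t ∉ Set.Ioo (0 : ℝ) 1, k t = 0 := fun t ht => by simp [k, hh0 t ht, hρ0 t ht]
  let p : ℝ → E n := fun t => k (Int.fract t)
  have hp : ContDiff ℝ (⊤ : ℕ∞) p := hk.comp_fract_of_support hk0
  have hpk : ∀ t ∈ Set.Icc (0 : ℝ) 1, p t = k t := fun t ht => by
    rcases ht.2.eq_or_lt with rfl | h1
    · simp [p, hk0]
    · simp [p, Int.fract_eq_self.2 ⟨ht.1, h1⟩]
  have hpi : ∫ t in (0 : ℝ)..1, p t = 0 := by
    rw [intervalIntegral.integral_congr (g := k) fun t ht => hpk t (by simpa using ht)]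
    have hρm : Continuous fun t => ρ t • m := hρ.continuous.smul continuous_const
    simp only [k]
    rw [intervalIntegral.integral_sub (hh.continuous.intervalIntegrable _ _)
      (hρm.intervalIntegrable _ _), intervalIntegral.integral_smul_const, hρ1, one_smul, sub_self]
  have hpL := hp.continuous.memLp_unitMeasure
  have hζ := W12Loop.of_primitive (ξ 0) (g := p) (fun t => by simp [p]) hp.continuous.measurable
    hpL hpi
  set ζ : ℝ → E n := fun t => ξ 0 + ∫ u in (0 : ℝ)..t, p u with hζdef
  have hζd : ∀ t, HasDerivAt ζ (p t) t := fun t =>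
    (intervalIntegral.integral_hasDerivAt_right (hp.continuous.intervalIntegrable _ _)
      (hp.continuous.stronglyMeasurableAtFilter _ _) hp.continuous.continuousAt).const_add _
  have hderiv : deriv ζ = p := funext fun t => (hζd t).deriv
  have hηp : (∫ t in (0 : ℝ)..1, ‖η t - p t‖ ^ 2) ≤ ε / 2 := by
    have h1 := integral_norm_sub_sq_le_two_mul hξ.memLp hhL hpL
    have h2 : (∫ t in (0 : ℝ)..1, ‖h t - p t‖ ^ 2) = c * ‖m‖ ^ 2 := by
      rw [hc, ← intervalIntegral.integral_mul_const]
      refine intervalIntegral.integral_congr fun t ht => ?_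
      rw [Set.uIcc_of_le zero_le_one] at ht
      simp only [hpk t ht, k, sub_sub_cancel, norm_smul, mul_pow]
    have h3 : c * ‖m‖ ^ 2 ≤ c * δ := by gcongr
    have h4 : ε = 4 * (δ + c * δ) := by rw [hδ]; field_simp
    linarith
  refine ⟨ζ, ?_, hderiv ▸ hζ, ?_⟩
  · rw [contDiff_infty_iff_deriv, hderiv]
    exact ⟨fun t => (hζd t).differentiableAt, hp⟩
  · rw [hderiv]
    have hs := (hξ.sub hζ)
    have hs0 : ∀ t ∈ Set.Icc (0 : ℝ) 1, ‖ξ t - ζ t‖ ^ 2 ≤ ε / 2 := fun t ht => by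
      have h1 := hs.repr t
      simp only [hζdef, intervalIntegral.integral_same, add_zero, sub_self, zero_add] at h1
      have h2 := norm_integral_initial_sq_le hs.memLp ht
      rw [← h1] at h2
      exact h2.trans hηp
    have hi1 := hs.memLp_self.norm_sq_intervalIntegrable
    have hi2 := hs.memLp.norm_sq_intervalIntegrable
    rw [intervalIntegral.integral_add hi1 hi2]
    have h5 : (∫ t in (0 : ℝ)..1, ‖ξ t - ζ t‖ ^ 2) ≤ ∫ t in (0 : ℝ)..1, ε / 2 :=
      intervalIntegral.integral_mono_on zero_le_one hi1 intervalIntegrable_const hs0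
    simp only [intervalIntegral.integral_const, sub_zero, one_smul] at h5
    linarith

end SmoothApproximation

section Pairing

variable {n : ℕ}

lemma abs_inner_le_young {F : Type*} [NormedAddCommGroup F] [InnerProductSpace ℝ F] (x y : F)
    {l : ℝ} (hl : 0 < l) : |⟪x, y⟫| ≤ l / 2 * ‖x‖ ^ 2 + 1 / (2 * l) * ‖y‖ ^ 2 := by
  refine (abs_real_inner_le_norm x y).trans ?_
  have h : l / 2 * ‖x‖ ^ 2 + 1 / (2 * l) * ‖y‖ ^ 2 - ‖x‖ * ‖y‖
      = 1 / (2 * l) * (l * ‖x‖ - ‖y‖) ^ 2 := by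
    field_simp
    ring
  have : 0 ≤ 1 / (2 * l) * (l * ‖x‖ - ‖y‖) ^ 2 := by positivity
  linarith

lemma abs_integral_inner_add_inner_le {f p x y : ℝ → E n} (hf : MemLp f 2 unitMeasure)
    (hp : MemLp p 2 unitMeasure) (hx : MemLp x 2 unitMeasure) (hy : MemLp y 2 unitMeasure)
    {l : ℝ} (hl : 0 < l) :
    |∫ t in (0 : ℝ)..1, ⟪f t, x t⟫ + ⟪p t, y t⟫|
      ≤ l / 2 * (∫ t in (0 : ℝ)..1, ‖f t‖ ^ 2 + ‖p t‖ ^ 2)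
        + 1 / (2 * l) * ∫ t in (0 : ℝ)..1, ‖x t‖ ^ 2 + ‖y t‖ ^ 2 := by
  have h1 := hf.norm_sq_intervalIntegrable.add hp.norm_sq_intervalIntegrable
  have h2 := hx.norm_sq_intervalIntegrable.add hy.norm_sq_intervalIntegrable
  rw [← intervalIntegral.integral_const_mul, ← intervalIntegral.integral_const_mul,
    ← intervalIntegral.integral_add (h1.const_mul _) (h2.const_mul _)]
  refine (intervalIntegral.abs_integral_le_integral_abs zero_le_one).trans ?_
  refine intervalIntegral.integral_mono_on zero_le_one
    ((hf.inner_intervalIntegrable hx).add (hp.inner_intervalIntegrable hy)).abs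
    ((h1.const_mul _).add (h2.const_mul _)) fun t _ => ?_
  have h3 := abs_inner_le_young (f t) (x t) hl
  have h4 := abs_inner_le_young (p t) (y t) hl
  have h5 := abs_add_le ⟪f t, x t⟫ ⟪p t, y t⟫
  linarith

/-- A bound on smooth test loops extends, up to a factor `2`, to all `W^{1,2}` test loops. -/
lemma abs_integral_le_of_forall_contDiff {f p : ℝ → E n} (hf : MemLp f 2 unitMeasure)
    (hp : MemLp p 2 unitMeasure) {B : ℝ}
    (hB : ∀ ξ : ℝ → E n, ContDiff ℝ (⊤ : ℕ∞) ξ → (∀ t, ξ (t + 1) = ξ t) →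
      (∫ t in (0 : ℝ)..1, ‖ξ t‖ ^ 2 + ‖deriv ξ t‖ ^ 2) ≤ 1 →
      |∫ t in (0 : ℝ)..1, ⟪f t, ξ t⟫ + ⟪p t, deriv ξ t⟫| ≤ B)
    {ξ η : ℝ → E n} (hξ : W12Loop n ξ η) {N : ℝ} (hN : 0 < N)
    (hξN : (∫ t in (0 : ℝ)..1, ‖ξ t‖ ^ 2 + ‖η t‖ ^ 2) ≤ N ^ 2) :
    |∫ t in (0 : ℝ)..1, ⟪f t, ξ t⟫ + ⟪p t, η t⟫| ≤ 2 * B * N := by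
  refine le_of_forall_pos_le_add fun s hs => ?_
  set M := ∫ t in (0 : ℝ)..1, ‖f t‖ ^ 2 + ‖p t‖ ^ 2
  have hM : 0 ≤ M := intervalIntegral.integral_nonneg zero_le_one fun _ _ => by positivity
  set l := s / (M + 1) with hl
  have hl0 : 0 < l := by positivity
  obtain ⟨ζ, hζs, hζ, hle⟩ := hξ.exists_contDiff_approx (ε := min (N ^ 2) (l * s)) (by positivity)
  have hd := hξ.sub hζ
  have hsplit : (∫ t in (0 : ℝ)..1, ⟪f t, ξ t⟫ + ⟪p t, η t⟫)
      = (∫ t in (0 : ℝ)..1, ⟪f t, ζ t⟫ + ⟪p t, deriv ζ t⟫)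
        + ∫ t in (0 : ℝ)..1, ⟪f t, ξ t - ζ t⟫ + ⟪p t, η t - deriv ζ t⟫ := by
    rw [← intervalIntegral.integral_add
      ((hf.inner_intervalIntegrable hζ.memLp_self).add (hp.inner_intervalIntegrable hζ.memLp))
      ((hf.inner_intervalIntegrable hd.memLp_self).add (hp.inner_intervalIntegrable hd.memLp))]
    refine intervalIntegral.integral_congr fun t _ => ?_
    simp only [inner_sub_right]
    ring
  have hrest := abs_integral_inner_add_inner_le hf hp hd.memLp_self hd.memLp hl0
  have hrest' : l / 2 * M
      + 1 / (2 * l) * (∫ t in (0 : ℝ)..1, ‖ξ t - ζ t‖ ^ 2 + ‖η t - deriv ζ t‖ ^ 2) ≤ s := by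
    have h1 : l / 2 * M ≤ s / 2 := by
      have : l * (M + 1) = s := by rw [hl]; field_simp
      nlinarith
    have h2 : 1 / (2 * l) * (∫ t in (0 : ℝ)..1, ‖ξ t - ζ t‖ ^ 2 + ‖η t - deriv ζ t‖ ^ 2)
        ≤ 1 / (2 * l) * (l * s) := by
      gcongr
      exact hle.trans (min_le_right _ _)
    have h3 : 1 / (2 * l) * (l * s) = s / 2 := by field_simp
    linarith
  have hmain : |∫ t in (0 : ℝ)..1, ⟪f t, ζ t⟫ + ⟪p t, deriv ζ t⟫| ≤ 2 * B * N := by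
    have hζd : Differentiable ℝ ζ := hζs.differentiable (by simp)
    have hζn : (∫ t in (0 : ℝ)..1, ‖ζ t‖ ^ 2 + ‖deriv ζ t‖ ^ 2) ≤ (2 * N) ^ 2 := by
      have h0 := hζ.memLp_self.norm_sq_intervalIntegrable.add hζ.memLp.norm_sq_intervalIntegrable
      have h1 := hξ.memLp_self.norm_sq_intervalIntegrable.add hξ.memLp.norm_sq_intervalIntegrable
      have h2 := hd.memLp_self.norm_sq_intervalIntegrable.add hd.memLp.norm_sq_intervalIntegrable
      have h3 : (∫ t in (0 : ℝ)..1, ‖ζ t‖ ^ 2 + ‖deriv ζ t‖ ^ 2)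
          ≤ ∫ t in (0 : ℝ)..1, 2 * (‖ξ t‖ ^ 2 + ‖η t‖ ^ 2)
            + 2 * (‖ξ t - ζ t‖ ^ 2 + ‖η t - deriv ζ t‖ ^ 2) := by
        refine intervalIntegral.integral_mono_on zero_le_one h0
          ((h1.const_mul _).add (h2.const_mul _)) fun t _ => ?_
        have h4 := norm_sub_sq_le_two_mul 0 (ξ t) (ζ t)
        have h5 := norm_sub_sq_le_two_mul 0 (η t) (deriv ζ t)
        simp only [zero_sub, norm_neg] at h4 h5
        linarith
      rw [intervalIntegral.integral_add (h1.const_mul _) (h2.const_mul _),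
        intervalIntegral.integral_const_mul, intervalIntegral.integral_const_mul] at h3
      have h6 := hle.trans (min_le_left _ _)
      nlinarith
    have hsc := hB (fun t => (2 * N)⁻¹ • ζ t) (by fun_prop)
      (fun t => by simp only [hζ.periodic]) (by
        have : ∀ t, ‖(2 * N)⁻¹ • ζ t‖ ^ 2 + ‖deriv (fun t => (2 * N)⁻¹ • ζ t) t‖ ^ 2
            = ((2 * N) ^ 2)⁻¹ * (‖ζ t‖ ^ 2 + ‖deriv ζ t‖ ^ 2) := fun t => by
          rw [deriv_fun_const_smul _ (hζd t), norm_smul, norm_smul,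
            Real.norm_of_nonneg (by positivity)]
          ring
        simp_rw [this]
        rw [intervalIntegral.integral_const_mul, inv_mul_le_iff₀ (by positivity), mul_one]
        exact hζn)
    have : ∀ t, ⟪f t, (2 * N)⁻¹ • ζ t⟫ + ⟪p t, deriv (fun t => (2 * N)⁻¹ • ζ t) t⟫
        = (2 * N)⁻¹ * (⟪f t, ζ t⟫ + ⟪p t, deriv ζ t⟫) := fun t => by
      rw [deriv_fun_const_smul _ (hζd t), inner_smul_right, inner_smul_right]
      ring
    simp_rw [this] at hsc
    rw [intervalIntegral.integral_const_mul, abs_mul, abs_of_pos (by positivity),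
      inv_mul_le_iff₀ (by positivity)] at hsc
    linarith
  rw [hsplit]
  refine (abs_add_le _ _).trans ?_
  linarith

end Pairing

section Green

variable {n : ℕ}

/-- Integration by parts of a loop against a smooth scalar function. -/
lemma W12Loop.integral_inner_mul_deriv {γ g : ℝ → E n} (hγ : W12Loop n γ g) (e : E n)
    {φ φ' : ℝ → ℝ} (hφ : ∀ t, HasDerivAt φ (φ' t) t) (hφ' : Continuous φ') (a b : ℝ) :
    ∫ t in a..b, ⟪g t, e⟫ * φ t + ⟪γ t, e⟫ * φ' t = ⟪γ b, e⟫ * φ b - ⟪γ a, e⟫ * φ a := by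
  have hint : ∀ c d, IntervalIntegrable (fun t => ⟪g t, e⟫) volume c d := fun c d =>
    ⟨(hγ.locint c d).1.inner_const e, (hγ.locint c d).2.inner_const e⟩
  have hrepr : (fun t => ⟪γ t, e⟫) = fun t => ⟪γ a, e⟫ + ∫ u in a..t, ⟪g u, e⟫ := by
    funext t
    have h1 : ∫ u in a..t, ⟪g u, e⟫ = ⟪∫ u in a..t, g u, e⟫ := by
      have := ((innerSL ℝ) e).intervalIntegral_comp_comm (hγ.locint a t)
      simpa only [innerSL_apply_apply, real_inner_comm] using this
    rw [h1, ← inner_add_left, hγ.repr t, hγ.repr a, add_assoc,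
      intervalIntegral.integral_add_adjacent_intervals (hγ.locint _ _) (hγ.locint _ _)]
  have hac : AbsolutelyContinuousOnInterval (fun t => ⟪γ t, e⟫) a b := by
    rw [hrepr]
    exact (contDiffOn_const.absolutelyContinuousOnInterval).add
      ((hint a b).absolutelyContinuousOnInterval_intervalIntegral (c := a) (by simp))
  have hφc : ContDiff ℝ 1 φ := by
    rw [contDiff_one_iff_deriv, funext fun t => (hφ t).deriv]
    exact ⟨fun t => (hφ t).differentiableAt, hφ'⟩
  have hφac : AbsolutelyContinuousOnInterval φ a b :=
    hφc.contDiffOn.absolutelyContinuousOnInterval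
  rw [← hac.integral_deriv_mul_eq_sub hφac]
  refine intervalIntegral.integral_congr_ae ?_
  filter_upwards [(hint a b).ae_hasDerivAt_integral] with t ht htm
  have h1 := (ht (Set.uIoc_subset_uIcc htm) a (by simp)).const_add ⟪γ a, e⟫
  rw [(hφ t).deriv, hrepr, h1.deriv]

lemma hasDerivAt_cos_comp_affine (a c t : ℝ) :
    HasDerivAt (fun s => Real.cos (2 * a * (s - c))) (-(2 * a * Real.sin (2 * a * (t - c)))) t := by
  have h1 : HasDerivAt (fun s => 2 * a * (s - c)) (2 * a) t := by
    simpa using ((hasDerivAt_id t).sub_const c).const_mul (2 * a)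
  convert h1.cos using 1
  ring

lemma hasDerivAt_sin_comp_affine (a c t : ℝ) :
    HasDerivAt (fun s => Real.sin (2 * a * (s - c))) (2 * a * Real.cos (2 * a * (t - c))) t := by
  have h1 : HasDerivAt (fun s => 2 * a * (s - c)) (2 * a) t := by
    simpa using ((hasDerivAt_id t).sub_const c).const_mul (2 * a)
  convert h1.sin using 1
  ring

/-- The periodic kernel `cos (2 * a * (s - t₀ - 1 / 2))` on `[t₀, t₀ + 1]`, a multiple of the Green
function at `t₀` of the quadratic part of the action, is a loop. -/
lemma w12Loop_green (a t₀ : ℝ) (e : E n) :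
    W12Loop n (fun s => Real.cos (2 * a * (Int.fract (s - t₀) - 1 / 2)) • e)
      (fun s => -(2 * a * Real.sin (2 * a * (Int.fract (s - t₀) - 1 / 2))) • e) := by
  have hfr : ∀ t, Int.fract (t + 1 - t₀) = Int.fract (t - t₀) := fun t => by
    rw [add_sub_right_comm, Int.fract_add_one]
  have hcont : Continuous fun s => Real.cos (2 * a * (Int.fract (s - t₀) - 1 / 2)) • e := by
    have hc : ContinuousOn (fun x : ℝ => Real.cos (2 * a * (x - 1 / 2))) (Set.Icc 0 1) := by
      fun_prop
    have h1 := hc.comp_fract'' (by rw [← Real.cos_neg]; congr 1; ring)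
    exact (h1.comp (continuous_sub_right t₀)).smul continuous_const
  have hm : Measurable fun s => -(2 * a * Real.sin (2 * a * (Int.fract (s - t₀) - 1 / 2))) • e := by
    have : Measurable fun s : ℝ => Int.fract (s - t₀) := (measurable_id.sub_const t₀).fract
    fun_prop
  have hL : MemLp (fun s => -(2 * a * Real.sin (2 * a * (Int.fract (s - t₀) - 1 / 2))) • e) 2
      unitMeasure := by
    refine MemLp.of_bound hm.aestronglyMeasurable (|2 * a| * ‖e‖) (.of_forall fun s => ?_)
    rw [norm_smul, norm_neg, norm_mul, Real.norm_eq_abs, Real.norm_eq_abs]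
    gcongr
    exact mul_le_of_le_one_right (abs_nonneg _) (Real.abs_sin_le_one _)
  have hper : Function.Periodic
      (fun s => -(2 * a * Real.sin (2 * a * (Int.fract (s - t₀) - 1 / 2))) • e) 1 :=
    fun t => by simp only [hfr]
  refine .of_memLp (fun t => by simp only [hfr]) hper hm hL fun t => ?_
  rw [integral_eq_of_hasDerivAt_off_countable
    (fun s => Real.cos (2 * a * (Int.fract (s - t₀) - 1 / 2)) • e) _
    (s := Set.range fun k : ℤ => (k : ℝ) + t₀) (Set.countable_range _) hcont.continuousOn ?_
    (hper.intervalIntegrable₀ one_ne_zero hL.intervalIntegrable_unit 0 t)]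
  · abel
  · rintro x ⟨-, hx⟩
    have hx' : ∀ᶠ s in nhds x, ⌊s - t₀⌋ = ⌊x - t₀⌋ := by
      have hne : (⌊x - t₀⌋ : ℝ) < x - t₀ := lt_of_le_of_ne (Int.floor_le _) fun h =>
        hx ⟨⌊x - t₀⌋, by simp [h]⟩
      have hlt := Int.lt_floor_add_one (x - t₀)
      filter_upwards [Ioo_mem_nhds (a := ⌊x - t₀⌋ + t₀) (b := ⌊x - t₀⌋ + 1 + t₀) (by linarith)
        (by linarith)] with s hs
      exact Int.floor_eq_iff.2 ⟨by linarith [hs.1], by linarith [hs.2]⟩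
    have h1 := (hasDerivAt_cos_comp_affine a (t₀ + ⌊x - t₀⌋ + 1 / 2) x).smul_const e
    have hre : ∀ s : ℝ, s - (t₀ + ⌊x - t₀⌋ + 1 / 2) = s - t₀ - ⌊x - t₀⌋ - 1 / 2 := fun s => by ring
    rw [hre] at h1
    refine h1.congr_of_eventuallyEq ?_
    filter_upwards [hx'] with s hs
    simp only [Int.fract, hs, hre]

/-- Testing the quadratic part of the differential against the Green kernel recovers the value of
the loop. -/
lemma W12Loop.integral_green {γ g : ℝ → E n} (hγ : W12Loop n γ g) {a : ℝ} (ha : a ≠ 0) (t₀ : ℝ)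
    (e : E n) :
    (∫ s in (0 : ℝ)..1,
      ⟪-(2 * a) • γ s, Real.cos (2 * a * (Int.fract (s - t₀) - 1 / 2)) • e⟫
      + ⟪(2 * a)⁻¹ • g s, -(2 * a * Real.sin (2 * a * (Int.fract (s - t₀) - 1 / 2))) • e⟫)
      = -(2 * Real.sin a) * ⟪γ t₀, e⟫ := by
  have hper : Function.Periodic (fun s =>
      ⟪-(2 * a) • γ s, Real.cos (2 * a * (Int.fract (s - t₀) - 1 / 2)) • e⟫
      + ⟪(2 * a)⁻¹ • g s, -(2 * a * Real.sin (2 * a * (Int.fract (s - t₀) - 1 / 2))) • e⟫) 1 :=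
    fun t => by
      simp only [hγ.periodic, hγ.gper, add_sub_right_comm t 1 t₀, Int.fract_add_one]
  have hshift := hper.intervalIntegral_add_eq 0 t₀
  rw [zero_add] at hshift
  have hparts := hγ.integral_inner_mul_deriv e (hasDerivAt_sin_comp_affine a (t₀ + 1 / 2))
    (by fun_prop) t₀ (t₀ + 1)
  rw [hγ.periodic, show 2 * a * (t₀ + 1 - (t₀ + 1 / 2)) = a by ring,
    show 2 * a * (t₀ - (t₀ + 1 / 2)) = -a by ring, Real.sin_neg] at hparts
  rw [hshift, show -(2 * Real.sin a) * ⟪γ t₀, e⟫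
    = -(⟪γ t₀, e⟫ * Real.sin a - ⟪γ t₀, e⟫ * -Real.sin a) by ring, ← hparts,
    ← intervalIntegral.integral_neg]
  have h1 : ∀ᵐ s : ℝ, s ≠ t₀ + 1 := by simp [ae_iff, measure_singleton]
  refine intervalIntegral.integral_congr_ae ?_
  filter_upwards [h1] with s hs hsm
  rw [Set.uIoc_of_le (by linarith)] at hsm
  have hlt := lt_of_le_of_ne hsm.2 hs
  have hf : Int.fract (s - t₀) = s - t₀ :=
    Int.fract_eq_self.2 ⟨by linarith [hsm.1], by linarith⟩
  rw [hf, show s - t₀ - 1 / 2 = s - (t₀ + 1 / 2) by ring]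
  simp only [inner_smul_left, inner_smul_right, conj_trivial]
  field_simp
  ring

end Green

section Gradients

variable {n : ℕ}

/-- The properties of the partial gradients `Q = ∂_q L` and `P = ∂_v L` that follow from (L1) and
(L2). -/
structure IsTameField (a C c : ℝ) (Q P : ℝ → E n → E n → E n) : Prop where
  continuous_fst : Continuous fun z : ℝ × E n × E n => Q z.1 z.2.1 z.2.2
  continuous_snd : Continuous fun z : ℝ × E n × E n => P z.1 z.2.1 z.2.2
  norm_fst_sub_le : ∀ t q v, ‖Q t q v - (-(2 * a)) • q‖ ≤ C
  norm_snd_sub_le : ∀ t q v, ‖P t q v - (2 * a)⁻¹ • v‖ ≤ C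
  lipschitz : ∀ t q q' v, ‖P t q v - P t q' v‖ ≤ C * ‖q - q'‖
  monotone : ∀ t q v w, c * ‖v - w‖ ^ 2 ≤ ⟪P t q v - P t q w, v - w⟫

lemma inner_gradient {F : Type*} [NormedAddCommGroup F] [InnerProductSpace ℝ F] [CompleteSpace F]
    (f : F → ℝ) (x y : F) : ⟪gradient f x, y⟫ = fderiv ℝ f x y := by
  rw [gradient, InnerProductSpace.toDual_symm_apply]

lemma norm_le_of_forall_inner_le {F : Type*} [NormedAddCommGroup F] [InnerProductSpace ℝ F]
    {y : F} {C : ℝ} (hC : 0 ≤ C) (h : ∀ x, ⟪y, x⟫ ≤ C * ‖x‖) : ‖y‖ ≤ C := by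
  rcases eq_or_ne y 0 with rfl | hy
  · simpa using hC
  · have h1 := h y
    rw [real_inner_self_eq_norm_sq] at h1
    have := norm_pos_iff.2 hy
    nlinarith

lemma inner_gradient_left_slot {f : E n × E n → ℝ} (hf : Differentiable ℝ f) (q v x : E n) :
    ⟪gradient (fun q => f (q, v)) q, x⟫ = fderiv ℝ f (q, v) (x, 0) := by
  rw [inner_gradient]
  have h1 : HasFDerivAt (fun q => f (q, v)) _ q :=
    (hf (q, v)).hasFDerivAt.comp q (hasFDerivAt_prodMk_left q v)
  rw [h1.fderiv]
  simp

lemma inner_gradient_right_slot {f : E n × E n → ℝ} (hf : Differentiable ℝ f) (q v x : E n) :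
    ⟪gradient (fun v => f (q, v)) v, x⟫ = fderiv ℝ f (q, v) (0, x) := by
  rw [inner_gradient]
  have h1 : HasFDerivAt (fun v => f (q, v)) _ v :=
    (hf (q, v)).hasFDerivAt.comp v (hasFDerivAt_prodMk_right q v)
  rw [h1.fderiv]
  simp

lemma hasFDerivAt_quadratic (a : ℝ) (z : E n × E n) :
    HasFDerivAt (fun w : E n × E n => ‖w.2‖ ^ 2 / (4 * a) - a * ‖w.1‖ ^ 2)
      ((4 * a)⁻¹ • ((2 : ℕ) • (innerSL ℝ z.2).comp (ContinuousLinearMap.snd ℝ (E n) (E n)))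
        - a • ((2 : ℕ) • (innerSL ℝ z.1).comp (ContinuousLinearMap.fst ℝ (E n) (E n)))) z := by
  simp_rw [div_eq_inv_mul]
  exact ((hasFDerivAt_snd (p := z)).norm_sq.const_mul (4 * a)⁻¹).sub
    ((hasFDerivAt_fst (p := z)).norm_sq.const_mul a)

lemma monotone_gradient_of_hessian {f : E n → ℝ} (hf : ContDiff ℝ 2 f) {c : ℝ}
    (hc : ∀ v w, c * ‖w‖ ^ 2 ≤ iteratedFDeriv ℝ 2 f v ![w, w]) (v w : E n) :
    c * ‖v - w‖ ^ 2 ≤ ⟪gradient f v - gradient f w, v - w⟫ := by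
  set u := v - w with hu
  have hd : Differentiable ℝ (fderiv ℝ f) :=
    (hf.fderiv_right (m := 1) (by norm_num)).differentiable one_ne_zero
  have hφ : ∀ s : ℝ, HasDerivAt (fun s : ℝ => fderiv ℝ f (w + s • u) u)
      (fderiv ℝ (fderiv ℝ f) (w + s • u) u u) s := fun s => by
    have h1 : HasDerivAt (fun s : ℝ => w + s • u) u s := by
      simpa using ((hasDerivAt_id s).smul_const u).const_add w
    have h2 := (hd (w + s • u)).hasFDerivAt.comp_hasDerivAt s h1
    simpa using h2.clm_apply (hasDerivAt_const s u)
  have hle := mul_sub_le_image_sub_of_le_deriv (C := c * ‖u‖ ^ 2)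
    (fun s => (hφ s).differentiableAt) (fun s => by
      rw [(hφ s).deriv]
      have := hc (w + s • u) u
      rwa [iteratedFDeriv_two_apply] at this) (zero_le_one (α := ℝ))
  rw [inner_sub_left, inner_gradient, inner_gradient]
  simpa [hu] using hle

lemma exists_isTameField {L : ℝ → E n → E n → ℝ}
    (hL : ContDiff ℝ (⊤ : ℕ∞) (fun z : ℝ × E n × E n => L z.1 z.2.1 z.2.2))
    (hL1 : CondL1 L) (hL2 : CondL2 L) :
    ∃ a C c : ℝ, 0 < a ∧ (∀ k : ℤ, a ≠ k * Real.pi) ∧ 0 ≤ C ∧ 0 < c ∧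
      IsTameField a C c (fun t q v => gradient (fun q => L t q v) q)
        (fun t q v => gradient (fun v => L t q v) v) := by
  obtain ⟨a, ha, hapi, C, hC⟩ := hL1
  obtain ⟨c, hc, hcc⟩ := hL2
  have hC0 : 0 ≤ C := (norm_nonneg _).trans (hC 0 0 0 (by norm_num))
  have hLt : ∀ t, ContDiff ℝ (⊤ : ℕ∞) fun w : E n × E n => L t w.1 w.2 := fun t =>
    hL.comp (contDiff_const.prodMk contDiff_id)
  have hLd : ∀ t, Differentiable ℝ fun w : E n × E n => L t w.1 w.2 := fun t =>
    (hLt t).differentiable (by simp)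
  have hQ : ∀ t q v x, ⟪gradient (fun q => L t q v) q, x⟫
      = fderiv ℝ (fun w : E n × E n => L t w.1 w.2) (q, v) (x, 0) := fun t q v x =>
    inner_gradient_left_slot (hLd t) q v x
  have hP : ∀ t q v x, ⟪gradient (fun v => L t q v) v, x⟫
      = fderiv ℝ (fun w : E n × E n => L t w.1 w.2) (q, v) (0, x) := fun t q v x =>
    inner_gradient_right_slot (hLd t) q v x
  let R : ℝ → E n × E n → ℝ := fun t w =>
    L t w.1 w.2 - (‖w.2‖ ^ 2 / (4 * a) - a * ‖w.1‖ ^ 2)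
  have hR : ∀ t, ContDiff ℝ (⊤ : ℕ∞) (R t) := fun t =>
    (hLt t).sub (((contDiff_snd.norm_sq ℝ).div_const _).sub
      (contDiff_const.mul (contDiff_fst.norm_sq ℝ)))
  have hRd : ∀ t z, fderiv ℝ (R t) z = fderiv ℝ (fun w : E n × E n => L t w.1 w.2) z
      - fderiv ℝ (fun w : E n × E n => ‖w.2‖ ^ 2 / (4 * a) - a * ‖w.1‖ ^ 2) z := fun t z =>
    fderiv_fun_sub (hLd t z) (hasFDerivAt_quadratic a z).differentiableAt
  have hR1 : ∀ t z, ‖fderiv ℝ (R t) z‖ ≤ C := fun t z => by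
    rw [← norm_iteratedFDeriv_one]
    exact hC t z 1 (by norm_num)
  have hR2 : ∀ t z z', ‖fderiv ℝ (R t) z - fderiv ℝ (R t) z'‖ ≤ C * ‖z - z'‖ := fun t z z' => by
    refine Convex.norm_image_sub_le_of_norm_fderiv_le (𝕜 := ℝ) (s := Set.univ) (fun x _ => ?_)
      (fun x _ => ?_) convex_univ (Set.mem_univ z') (Set.mem_univ z)
    · exact ((hR t).fderiv_right (m := 1) (by norm_cast)).differentiable one_ne_zero x
    · rw [← norm_iteratedFDeriv_one, norm_iteratedFDeriv_fderiv]
      exact hC t x 2 le_rfl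
  have hcont : Continuous (fderiv ℝ fun z : ℝ × E n × E n => L z.1 z.2.1 z.2.2) :=
    hL.continuous_fderiv (by simp)
  have hslot : ∀ t z, fderiv ℝ (fun w : E n × E n => L t w.1 w.2) z
      = (fderiv ℝ (fun z : ℝ × E n × E n => L z.1 z.2.1 z.2.2) (t, z)).comp
        (ContinuousLinearMap.inr ℝ ℝ (E n × E n)) := fun t z =>
    HasFDerivAt.fderiv <|
      ((hL.differentiable (by simp)) (t, z)).hasFDerivAt.comp z (hasFDerivAt_prodMk_right t z)
  refine ⟨a, C, c, ha, hapi, hC0, hc, ⟨?_, ?_, fun t q v => ?_, fun t q v => ?_,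
    fun t q q' v => ?_, fun t q v w => ?_⟩⟩
  · have heq : (fun z : ℝ × E n × E n => gradient (fun q => L z.1 q z.2.2) z.2.1) = fun z =>
        (InnerProductSpace.toDual ℝ (E n)).symm
          (((fderiv ℝ (fun z : ℝ × E n × E n => L z.1 z.2.1 z.2.2) z).comp
            (ContinuousLinearMap.inr ℝ ℝ (E n × E n))).comp
              (ContinuousLinearMap.inl ℝ (E n) (E n))) := by
      funext z
      refine ext_inner_right ℝ fun x => ?_
      rw [hQ, InnerProductSpace.toDual_symm_apply, hslot]
      rfl
    rw [heq]
    fun_prop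
  · have heq : (fun z : ℝ × E n × E n => gradient (fun v => L z.1 z.2.1 v) z.2.2) = fun z =>
        (InnerProductSpace.toDual ℝ (E n)).symm
          (((fderiv ℝ (fun z : ℝ × E n × E n => L z.1 z.2.1 z.2.2) z).comp
            (ContinuousLinearMap.inr ℝ ℝ (E n × E n))).comp
              (ContinuousLinearMap.inr ℝ (E n) (E n))) := by
      funext z
      refine ext_inner_right ℝ fun x => ?_
      rw [hP, InnerProductSpace.toDual_symm_apply, hslot]
      rfl
    rw [heq]
    fun_prop
  · refine norm_le_of_forall_inner_le hC0 fun x => ?_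
    have h1 : ⟪gradient (fun q => L t q v) q - (-(2 * a)) • q, x⟫
        = fderiv ℝ (R t) (q, v) (x, 0) := by
      rw [hRd, (hasFDerivAt_quadratic a (q, v)).fderiv, inner_sub_left, hQ, inner_smul_left]
      simp
      ring
    rw [h1]
    refine (Real.le_norm_self _).trans
      (((fderiv ℝ (R t) (q, v)).le_of_opNorm_le (hR1 t _) _).trans ?_)
    simp
  · refine norm_le_of_forall_inner_le hC0 fun x => ?_
    have h1 : ⟪gradient (fun v => L t q v) v - (2 * a)⁻¹ • v, x⟫
        = fderiv ℝ (R t) (q, v) (0, x) := by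
      rw [hRd, (hasFDerivAt_quadratic a (q, v)).fderiv, inner_sub_left, hP, inner_smul_left]
      simp
      field_simp
      ring
    rw [h1]
    refine (Real.le_norm_self _).trans
      (((fderiv ℝ (R t) (q, v)).le_of_opNorm_le (hR1 t _) _).trans ?_)
    simp
  · refine norm_le_of_forall_inner_le (by positivity) fun x => ?_
    have h1 : ⟪gradient (fun v => L t q v) v - gradient (fun v => L t q' v) v, x⟫
        = (fderiv ℝ (R t) (q, v) - fderiv ℝ (R t) (q', v)) (0, x) := by
      rw [hRd, hRd, (hasFDerivAt_quadratic a (q, v)).fderiv,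
        (hasFDerivAt_quadratic a (q', v)).fderiv, inner_sub_left, hP, hP]
      simp
    rw [h1]
    refine (Real.le_norm_self _).trans
      ((ContinuousLinearMap.le_of_opNorm_le _ (hR2 t _ _) _).trans ?_)
    simp
  · exact monotone_gradient_of_hessian (f := fun v => L t q v)
      (((hLt t).comp (contDiff_const.prodMk contDiff_id)).of_le (by norm_cast))
      (fun v w => hcc t q v w) v w

end Gradients

section AprioriBounds

variable {n : ℕ} {a C c B : ℝ} {Q P : ℝ → E n → E n → E n} {γ g : ℝ → E n}

/-- The functional `(ξ, η) ↦ ∫ ⟪f, ξ⟫ + ⟪p, η⟫` has norm at most `B` on `W^{1,2}` loops. -/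
def HasDualBound (f p : ℝ → E n) (B : ℝ) : Prop :=
  ∀ ξ η : ℝ → E n, W12Loop n ξ η → ∀ N : ℝ, 0 < N →
    (∫ t in (0 : ℝ)..1, ‖ξ t‖ ^ 2 + ‖η t‖ ^ 2) ≤ N ^ 2 →
      |∫ t in (0 : ℝ)..1, ⟪f t, ξ t⟫ + ⟪p t, η t⟫| ≤ B * N

lemma memLp_of_norm_sub_le {f h : ℝ → E n} {C : ℝ} (hf : Measurable f) (hm : Measurable h)
    (hh : MemLp h 2 unitMeasure) (hC : ∀ t, ‖f t - h t‖ ≤ C) : MemLp f 2 unitMeasure := by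
  have h1 : MemLp (f - h) 2 unitMeasure :=
    MemLp.of_bound (hf.sub hm).aestronglyMeasurable C (.of_forall hC)
  have h2 := h1.add hh
  rwa [sub_add_cancel] at h2

lemma IsTameField.memLp_fst (h : IsTameField a C c Q P) (hγ : W12Loop n γ g) :
    MemLp (fun t => Q t (γ t) (g t)) 2 unitMeasure :=
  memLp_of_norm_sub_le (h := fun t => (-(2 * a)) • γ t)
    (h.continuous_fst.measurable.comp
      (measurable_id.prodMk (hγ.continuous.measurable.prodMk hγ.meas)))
    (hγ.continuous.measurable.const_smul (-(2 * a)))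
    (hγ.memLp_self.const_smul (-(2 * a))) fun t => h.norm_fst_sub_le t (γ t) (g t)

lemma IsTameField.memLp_snd (h : IsTameField a C c Q P) (hγ : W12Loop n γ g) :
    MemLp (fun t => P t (γ t) (g t)) 2 unitMeasure :=
  memLp_of_norm_sub_le (h := fun t => (2 * a)⁻¹ • g t)
    (h.continuous_snd.measurable.comp
      (measurable_id.prodMk (hγ.continuous.measurable.prodMk hγ.meas)))
    (hγ.meas.const_smul (2 * a)⁻¹)
    (hγ.memLp.const_smul (2 * a)⁻¹) fun t => h.norm_snd_sub_le t (γ t) (g t)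

/-- The nonresonance condition bounds the supremum of a loop by the norm of the differential. -/
lemma IsTameField.norm_le_of_hasDualBound (h : IsTameField a C c Q P) (ha : 0 < a) (hC : 0 ≤ C)
    (hsin : Real.sin a ≠ 0) (hγ : W12Loop n γ g) (hB0 : 0 ≤ B)
    (hB : HasDualBound (fun t => Q t (γ t) (g t)) (fun t => P t (γ t) (g t)) B) (t₀ : ℝ) :
    ‖γ t₀‖ ≤ (B + C) * (1 + 2 * a) / |2 * Real.sin a| := by
  have hs : 0 < |2 * Real.sin a| := by positivity
  refine norm_le_of_forall_inner_le (by positivity) fun x => ?_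
  rcases eq_or_ne x 0 with rfl | hx
  · simp
  have hx0 : 0 < ‖x‖ := norm_pos_iff.2 hx
  have hξ := w12Loop_green a t₀ x
  have hgr := hγ.integral_green ha.ne' t₀ x
  set ξ := fun s => Real.cos (2 * a * (Int.fract (s - t₀) - 1 / 2)) • x
  set η := fun s => -(2 * a * Real.sin (2 * a * (Int.fract (s - t₀) - 1 / 2))) • x
  have hξn : ∀ s, ‖ξ s‖ ≤ ‖x‖ := fun s => by
    rw [norm_smul]
    exact mul_le_of_le_one_left hx0.le (Real.abs_cos_le_one _)
  have hηn : ∀ s, ‖η s‖ ≤ 2 * a * ‖x‖ := fun s => by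
    rw [norm_smul, norm_neg, norm_mul, Real.norm_of_nonneg (by positivity : 0 ≤ 2 * a)]
    exact mul_le_mul_of_nonneg_right
      (mul_le_of_le_one_right (by positivity) (Real.abs_sin_le_one _)) hx0.le
  have hN : (∫ s in (0 : ℝ)..1, ‖ξ s‖ ^ 2 + ‖η s‖ ^ 2) ≤ ((1 + 2 * a) * ‖x‖) ^ 2 := by
    have h1 := intervalIntegral.integral_mono_on (μ := volume) zero_le_one
      (hξ.memLp_self.norm_sq_intervalIntegrable.add hξ.memLp.norm_sq_intervalIntegrable)
      (intervalIntegrable_const (c := ((1 + 2 * a) * ‖x‖) ^ 2)) fun s _ => by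
        have h2 := pow_le_pow_left₀ (norm_nonneg _) (hξn s) 2
        have h3 := pow_le_pow_left₀ (norm_nonneg _) (hηn s) 2
        have h4 : 0 ≤ a * ‖x‖ * ‖x‖ := by positivity
        nlinarith
    simpa using h1
  have hD := hB ξ η hξ _ (by positivity) hN
  have hf := h.memLp_fst hγ
  have hp := h.memLp_snd hγ
  have hf' : MemLp (fun t => -(2 * a) • γ t) 2 unitMeasure :=
    hγ.memLp_self.const_smul (-(2 * a))
  have hp' : MemLp (fun t => (2 * a)⁻¹ • g t) 2 unitMeasure :=
    hγ.memLp.const_smul (2 * a)⁻¹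
  have hrest : |∫ s in (0 : ℝ)..1, (⟪Q s (γ s) (g s), ξ s⟫ + ⟪P s (γ s) (g s), η s⟫)
      - (⟪-(2 * a) • γ s, ξ s⟫ + ⟪(2 * a)⁻¹ • g s, η s⟫)| ≤ C * ((1 + 2 * a) * ‖x‖) := by
    have := intervalIntegral.norm_integral_le_of_norm_le_const (a := (0 : ℝ)) (b := 1)
      (f := fun s => (⟪Q s (γ s) (g s), ξ s⟫ + ⟪P s (γ s) (g s), η s⟫)
      - (⟪-(2 * a) • γ s, ξ s⟫ + ⟪(2 * a)⁻¹ • g s, η s⟫)) (C := C * ((1 + 2 * a) * ‖x‖))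
      fun s _ => by
        rw [show (⟪Q s (γ s) (g s), ξ s⟫ + ⟪P s (γ s) (g s), η s⟫)
          - (⟪-(2 * a) • γ s, ξ s⟫ + ⟪(2 * a)⁻¹ • g s, η s⟫)
          = ⟪Q s (γ s) (g s) - -(2 * a) • γ s, ξ s⟫
            + ⟪P s (γ s) (g s) - (2 * a)⁻¹ • g s, η s⟫ by
              simp only [inner_sub_left]; ring]
        refine (norm_add_le _ _).trans ?_
        have h1 := (norm_inner_le_norm (𝕜 := ℝ) (Q s (γ s) (g s) - -(2 * a) • γ s) (ξ s)).trans
          (mul_le_mul (h.norm_fst_sub_le s (γ s) (g s)) (hξn s) (norm_nonneg _) hC)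
        have h2 := (norm_inner_le_norm (𝕜 := ℝ) (P s (γ s) (g s) - (2 * a)⁻¹ • g s) (η s)).trans
          (mul_le_mul (h.norm_snd_sub_le s (γ s) (g s)) (hηn s) (norm_nonneg _) hC)
        linarith
    simpa using this
  rw [intervalIntegral.integral_sub
    ((hf.inner_intervalIntegrable hξ.memLp_self).add (hp.inner_intervalIntegrable hξ.memLp))
    ((hf'.inner_intervalIntegrable hξ.memLp_self).add (hp'.inner_intervalIntegrable hξ.memLp)),
    hgr] at hrest
  have hfin : |2 * Real.sin a| * ⟪γ t₀, x⟫ ≤ (B + C) * (1 + 2 * a) * ‖x‖ := by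
    have h1 : |2 * Real.sin a| * |⟪γ t₀, x⟫| ≤ (B + C) * (1 + 2 * a) * ‖x‖ := by
      rw [← abs_mul, ← abs_neg, ← neg_mul]
      have h2 := abs_sub_abs_le_abs_sub (-(2 * Real.sin a) * ⟪γ t₀, x⟫)
        (∫ s in (0 : ℝ)..1, ⟪Q s (γ s) (g s), ξ s⟫ + ⟪P s (γ s) (g s), η s⟫)
      rw [abs_sub_comm] at h2
      linarith
    exact (mul_le_mul_of_nonneg_left (le_abs_self _) hs.le).trans h1
  rw [div_mul_eq_mul_div, le_div_iff₀ hs]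
  linarith

/-- A supremum bound and a bound on the differential control the kinetic energy. -/
lemma IsTameField.integral_norm_sq_le (h : IsTameField a C c Q P) (ha : 0 < a)
    (hγ : W12Loop n γ g)
    (hB : HasDualBound (fun t => Q t (γ t) (g t)) (fun t => P t (γ t) (g t)) B) {K : ℝ}
    (hK : ∀ t, ‖γ t‖ ≤ K) :
    (∫ t in (0 : ℝ)..1, ‖g t‖ ^ 2)
      ≤ 8 * a * (2 * a * K ^ 2 + C * K + a * C ^ 2 + 2 * a * B ^ 2) + (K ^ 2 + 1) := by
  have hK0 : 0 ≤ K := (norm_nonneg _).trans (hK 0)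
  set G := ∫ t in (0 : ℝ)..1, ‖g t‖ ^ 2 with hG
  have hG0 : 0 ≤ G := intervalIntegral.integral_nonneg zero_le_one fun _ _ => by positivity
  have hN : (∫ s in (0 : ℝ)..1, ‖γ s‖ ^ 2 + ‖g s‖ ^ 2) ≤ (Real.sqrt (K ^ 2 + G + 1)) ^ 2 := by
    rw [Real.sq_sqrt (by positivity), intervalIntegral.integral_add
      hγ.memLp_self.norm_sq_intervalIntegrable hγ.memLp.norm_sq_intervalIntegrable]
    have h1 := intervalIntegral.integral_mono_on (μ := volume) zero_le_one
      hγ.memLp_self.norm_sq_intervalIntegrable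
      (intervalIntegrable_const (c := K ^ 2)) fun s _ =>
        pow_le_pow_left₀ (norm_nonneg _) (hK s) 2
    simp only [intervalIntegral.integral_const, sub_zero, one_smul] at h1
    linarith
  have hD := (le_abs_self _).trans (hB γ g hγ _ (by positivity) hN)
  have hlow : (4 * a)⁻¹ * G - (2 * a * K ^ 2 + C * K + a * C ^ 2)
      ≤ ∫ t in (0 : ℝ)..1, ⟪Q t (γ t) (g t), γ t⟫ + ⟪P t (γ t) (g t), g t⟫ := by
    have hi := hγ.memLp.norm_sq_intervalIntegrable
    have h1 := intervalIntegral.integral_mono_on (μ := volume) zero_le_one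
      ((hi.const_mul (4 * a)⁻¹).sub
        (intervalIntegrable_const (c := 2 * a * K ^ 2 + C * K + a * C ^ 2)))
      (((h.memLp_fst hγ).inner_intervalIntegrable hγ.memLp_self).add
        ((h.memLp_snd hγ).inner_intervalIntegrable hγ.memLp)) fun t _ => by
        have hC : 0 ≤ C := (norm_nonneg _).trans (h.norm_fst_sub_le 0 0 0)
        have h2 : -(C * ‖γ t‖) ≤ ⟪Q t (γ t) (g t) - (-(2 * a)) • γ t, γ t⟫ :=
          (neg_le_neg (mul_le_mul_of_nonneg_right (h.norm_fst_sub_le _ _ _) (norm_nonneg _))).trans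
            (neg_le_of_abs_le (abs_real_inner_le_norm _ _))
        have h3 : -(C * ‖g t‖) ≤ ⟪P t (γ t) (g t) - (2 * a)⁻¹ • g t, g t⟫ :=
          (neg_le_neg (mul_le_mul_of_nonneg_right (h.norm_snd_sub_le _ _ _) (norm_nonneg _))).trans
            (neg_le_of_abs_le (abs_real_inner_le_norm _ _))
        rw [inner_sub_left, inner_smul_left, real_inner_self_eq_norm_sq, conj_trivial] at h2 h3
        have h4 : C * ‖g t‖ ≤ (4 * a)⁻¹ * ‖g t‖ ^ 2 + a * C ^ 2 := by
          have : (4 * a)⁻¹ * ‖g t‖ ^ 2 + a * C ^ 2 - C * ‖g t‖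
              = (4 * a)⁻¹ * (‖g t‖ - 2 * a * C) ^ 2 := by field_simp; ring
          have : 0 ≤ (4 * a)⁻¹ * (‖g t‖ - 2 * a * C) ^ 2 := by positivity
          linarith
        have h5 : (2 * a)⁻¹ * ‖g t‖ ^ 2 = 2 * ((4 * a)⁻¹ * ‖g t‖ ^ 2) := by field_simp; ring
        have h6 := pow_le_pow_left₀ (norm_nonneg _) (hK t) 2
        have h7 : C * ‖γ t‖ ≤ C * K := by gcongr; exact hK t
        have h8 : 2 * a * ‖γ t‖ ^ 2 ≤ 2 * a * K ^ 2 := by gcongr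
        linarith
    rw [intervalIntegral.integral_sub (hi.const_mul _) intervalIntegrable_const,
      intervalIntegral.integral_const_mul] at h1
    simpa using h1
  have hBN : B * Real.sqrt (K ^ 2 + G + 1) ≤ (8 * a)⁻¹ * (K ^ 2 + G + 1) + 2 * a * B ^ 2 := by
    nth_rewrite 2 [← Real.sq_sqrt (by positivity : 0 ≤ K ^ 2 + G + 1)]
    set N := Real.sqrt (K ^ 2 + G + 1)
    have : (8 * a)⁻¹ * N ^ 2 + 2 * a * B ^ 2 - B * N = (8 * a)⁻¹ * (N - 4 * a * B) ^ 2 := by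
      field_simp; ring
    have : 0 ≤ (8 * a)⁻¹ * (N - 4 * a * B) ^ 2 := by positivity
    linarith
  have h1 : (4 * a)⁻¹ * G = 2 * ((8 * a)⁻¹ * G) := by field_simp; ring
  have h2 : (8 * a)⁻¹ * (K ^ 2 + G + 1) = (8 * a)⁻¹ * (K ^ 2 + 1) + (8 * a)⁻¹ * G := by ring
  have h3 : (8 * a)⁻¹ * (G - (K ^ 2 + 1)) ≤ 2 * a * K ^ 2 + C * K + a * C ^ 2 + 2 * a * B ^ 2 := by
    linarith
  rw [inv_mul_le_iff₀ (by positivity)] at h3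
  linarith

/-- Fiberwise monotonicity turns uniform closeness of two almost critical loops into closeness of
their derivatives. -/
lemma IsTameField.mul_integral_norm_sub_sq_le (h : IsTameField a C c Q P) (ha : 0 < a)
    {γ₁ g₁ : ℝ → E n} {B₁ K G σ : ℝ} (hγ : W12Loop n γ g) (hγ₁ : W12Loop n γ₁ g₁)
    (hB : HasDualBound (fun t => Q t (γ t) (g t)) (fun t => P t (γ t) (g t)) B)
    (hB₁ : HasDualBound (fun t => Q t (γ₁ t) (g₁ t)) (fun t => P t (γ₁ t) (g₁ t)) B₁)
    (hK : ∀ t, ‖γ t‖ ≤ K) (hK₁ : ∀ t, ‖γ₁ t‖ ≤ K)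
    (hG : (∫ t in (0 : ℝ)..1, ‖g t‖ ^ 2) ≤ G) (hG₁ : (∫ t in (0 : ℝ)..1, ‖g₁ t‖ ^ 2) ≤ G)
    (hσ : ∀ t ∈ Set.Icc (0 : ℝ) 1, ‖γ t - γ₁ t‖ ≤ σ) :
    c * (∫ t in (0 : ℝ)..1, ‖g t - g₁ t‖ ^ 2)
      ≤ (2 * (2 * a * K + C) + C * (1 + 4 * G)) * σ + (B + B₁) * (2 * K + 2 * G + 2) := by
  have hC : 0 ≤ C := (norm_nonneg _).trans (h.norm_fst_sub_le 0 0 0)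
  have hσ0 : 0 ≤ σ := (norm_nonneg _).trans (hσ 0 (by simp))
  have hK0 : 0 ≤ K := (norm_nonneg _).trans (hK 0)
  have hG0 : 0 ≤ G :=
    (intervalIntegral.integral_nonneg zero_le_one fun _ _ => by positivity).trans hG
  have hd := hγ.sub hγ₁
  have hi := hd.memLp.norm_sq_intervalIntegrable
  have hi' := hd.memLp_self.norm_sq_intervalIntegrable
  have hη : (∫ t in (0 : ℝ)..1, ‖g t - g₁ t‖ ^ 2) ≤ 4 * G := by
    have h1 := integral_norm_sub_sq_le_two_mul hγ.memLp
      (MemLp.zero' : MemLp (fun _ : ℝ => (0 : E n)) 2 unitMeasure) hγ₁.memLp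
    simp only [sub_zero, zero_sub, norm_neg] at h1
    linarith
  have hN : (∫ t in (0 : ℝ)..1, ‖γ t - γ₁ t‖ ^ 2 + ‖g t - g₁ t‖ ^ 2)
      ≤ (2 * K + 2 * G + 2) ^ 2 := by
    rw [intervalIntegral.integral_add hi' hi]
    have h1 := intervalIntegral.integral_mono_on (μ := volume) zero_le_one hi'
      (intervalIntegrable_const (c := (2 * K) ^ 2)) fun s _ =>
        pow_le_pow_left₀ (norm_nonneg _)
          ((norm_sub_le _ _).trans (by linarith [hK s, hK₁ s] : ‖γ s‖ + ‖γ₁ s‖ ≤ 2 * K)) 2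
    simp only [intervalIntegral.integral_const, sub_zero, one_smul] at h1
    nlinarith [mul_nonneg hK0 hG0]
  have hD := (le_abs_self _).trans (hB _ _ hd _ (by positivity) hN)
  have hD₁ := (neg_le_abs _).trans (hB₁ _ _ hd _ (by positivity) hN)
  have hf := (h.memLp_fst hγ).inner_intervalIntegrable hd.memLp_self
  have hp := (h.memLp_snd hγ).inner_intervalIntegrable hd.memLp
  have hf₁ := (h.memLp_fst hγ₁).inner_intervalIntegrable hd.memLp_self
  have hp₁ := (h.memLp_snd hγ₁).inner_intervalIntegrable hd.memLp
  have hlow := intervalIntegral.integral_mono_on (μ := volume) zero_le_one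
    (((hi.const_mul c).sub (intervalIntegrable_const (c := (2 * (2 * a * K + C) + C) * σ))).sub
      (hi.const_mul (C * σ))) ((hf.add hp).sub (hf₁.add hp₁)) fun t ht => by
    have hQb : ∀ q v, ‖q‖ ≤ K → ‖Q t q v‖ ≤ 2 * a * K + C := fun q v hq => by
      have h1 := norm_le_norm_add_norm_sub' (Q t q v) ((-(2 * a)) • q)
      have h2 := h.norm_fst_sub_le t q v
      rw [norm_smul, norm_neg, Real.norm_of_nonneg (by positivity : 0 ≤ 2 * a)] at h1
      have h3 : 2 * a * ‖q‖ ≤ 2 * a * K := by gcongr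
      linarith
    have h1 : ‖Q t (γ t) (g t) - Q t (γ₁ t) (g₁ t)‖ ≤ 2 * (2 * a * K + C) :=
      (norm_sub_le _ _).trans (by linarith [hQb _ (g t) (hK t), hQb _ (g₁ t) (hK₁ t)])
    have h2 : -(2 * (2 * a * K + C) * σ)
        ≤ ⟪Q t (γ t) (g t) - Q t (γ₁ t) (g₁ t), γ t - γ₁ t⟫ :=
      (neg_le_neg (mul_le_mul h1 (hσ t ht) (norm_nonneg _) (by positivity))).trans
        (neg_le_of_abs_le (abs_real_inner_le_norm _ _))
    have h3 := h.monotone t (γ t) (g t) (g₁ t)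
    have h4 : -(C * σ * ‖g t - g₁ t‖)
        ≤ ⟪P t (γ t) (g₁ t) - P t (γ₁ t) (g₁ t), g t - g₁ t⟫ :=
      (neg_le_neg (mul_le_mul_of_nonneg_right ((h.lipschitz _ _ _ _).trans
        (mul_le_mul_of_nonneg_left (hσ t ht) hC)) (norm_nonneg _))).trans
        (neg_le_of_abs_le (abs_real_inner_le_norm _ _))
    have h5 : ‖g t - g₁ t‖ ≤ 1 + ‖g t - g₁ t‖ ^ 2 := by nlinarith [sq_nonneg (‖g t - g₁ t‖ - 1)]
    have h6 : C * σ * ‖g t - g₁ t‖ ≤ C * σ * (1 + ‖g t - g₁ t‖ ^ 2) := by gcongr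
    rw [inner_sub_left] at h2 h3 h4
    linarith
  rw [intervalIntegral.integral_sub (hf.add hp) (hf₁.add hp₁),
    intervalIntegral.integral_sub ((hi.const_mul c).sub intervalIntegrable_const)
      (hi.const_mul _), intervalIntegral.integral_sub (hi.const_mul c) intervalIntegrable_const]
    at hlow
  simp only [intervalIntegral.integral_const_mul, intervalIntegral.integral_const, sub_zero,
    one_smul] at hlow
  beta_reduce at hD hD₁
  have h7 : C * σ * (∫ t in (0 : ℝ)..1, ‖g t - g₁ t‖ ^ 2) ≤ C * σ * (4 * G) := by gcongr
  linarith

end AprioriBounds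

section Compactness

variable {n : ℕ}

lemma W12Loop.norm_sub_le {γ g : ℝ → E n} (hγ : W12Loop n γ g) {G : ℝ}
    (hG : (∫ t in (0 : ℝ)..1, ‖g t‖ ^ 2) ≤ G) {l : ℝ} (hl : 0 < l) {s t : ℝ}
    (hs : s ∈ Set.Icc (0 : ℝ) 1) (ht : t ∈ Set.Icc (0 : ℝ) 1) :
    ‖γ t - γ s‖ ≤ l * G + |t - s| / l := by
  wlog hst : s ≤ t generalizing s t
  · rw [norm_sub_rev, abs_sub_comm]
    exact this ht hs (le_of_not_ge hst)
  have hi := hγ.memLp.norm_sq_intervalIntegrable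
  have hsub : Set.uIcc s t ⊆ Set.uIcc 0 1 := by
    rw [Set.uIcc_of_le hst, Set.uIcc_of_le zero_le_one]
    exact Set.Icc_subset_Icc hs.1 ht.2
  have h1 : γ t - γ s = ∫ u in s..t, g u := by
    rw [hγ.repr t, hγ.repr s, add_sub_add_left_eq_sub,
      intervalIntegral.integral_interval_sub_left (hγ.locint _ _) (hγ.locint _ _)]
  have h2 : (∫ u in s..t, ‖g u‖) ≤ ∫ u in s..t, (l * ‖g u‖ ^ 2 + 1 / l) := by
    refine intervalIntegral.integral_mono_on hst (hγ.locint s t).norm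
      (((hi.mono_set hsub).const_mul l).add intervalIntegrable_const) fun u _ => ?_
    have h3 : l * ‖g u‖ ^ 2 + 1 / l - ‖g u‖
        = 1 / l * ((l * ‖g u‖ - 1 / 2) ^ 2 + 3 / 4) := by
      field_simp
      ring
    have : 0 ≤ 1 / l * ((l * ‖g u‖ - 1 / 2) ^ 2 + 3 / 4) := by positivity
    linarith
  rw [intervalIntegral.integral_add ((hi.mono_set hsub).const_mul l) intervalIntegrable_const,
    intervalIntegral.integral_const_mul, intervalIntegral.integral_const, smul_eq_mul,
    mul_one_div] at h2
  have h4 : (∫ u in s..t, ‖g u‖ ^ 2) ≤ ∫ u in (0 : ℝ)..1, ‖g u‖ ^ 2 :=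
    intervalIntegral.integral_mono_interval hs.1 hst ht.2
      (.of_forall fun _ => by positivity) hi
  have h5 : l * (∫ u in s..t, ‖g u‖ ^ 2) ≤ l * G := by gcongr; exact h4.trans hG
  rw [h1, abs_of_nonneg (sub_nonneg.2 hst)]
  have h6 := intervalIntegral.norm_integral_le_integral_norm (f := g) (μ := volume) hst
  linarith

/-- Bounded sequences of loops have uniformly Cauchy subsequences. -/
lemma exists_strictMono_uniform_cauchy {γ g : ℕ → ℝ → E n} (hγ : ∀ k, W12Loop n (γ k) (g k))
    {K G : ℝ} (hK : ∀ k t, ‖γ k t‖ ≤ K) (hG : ∀ k, (∫ t in (0 : ℝ)..1, ‖g k t‖ ^ 2) ≤ G) :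
    ∃ φ : ℕ → ℕ, StrictMono φ ∧ ∀ ε > 0, ∃ N, ∀ i ≥ N, ∀ j ≥ N, ∀ t ∈ Set.Icc (0 : ℝ) 1,
      ‖γ (φ i) t - γ (φ j) t‖ ≤ ε := by
  let u : ℕ → BoundedContinuousFunction (Set.Icc (0 : ℝ) 1) (E n) := fun k =>
    BoundedContinuousFunction.mkOfCompact
      ⟨fun t => γ k t, (hγ k).continuous.comp continuous_subtype_val⟩
  have hG0 : 0 ≤ G :=
    (intervalIntegral.integral_nonneg zero_le_one fun _ _ => by positivity).trans (hG 0)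
  have hcomp : IsCompact (closure (Set.range u)) := by
    refine BoundedContinuousFunction.arzela_ascoli _ (isCompact_closedBall (0 : E n) K) _ ?_ ?_
    · rintro _ t ⟨k, rfl⟩
      exact mem_closedBall_zero_iff.2 (hK k t)
    · refine Metric.equicontinuous_of_continuity_modulus
        (fun r => Real.sqrt r * (G + 1)) ?_ _ ?_
      · have : Tendsto (fun r : ℝ => Real.sqrt r * (G + 1)) (nhds 0)
            (nhds (Real.sqrt 0 * (G + 1))) :=
          (Real.continuous_sqrt.mul continuous_const).tendsto 0
        simpa using this
      · rintro s t ⟨_, k, rfl⟩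
        rcases eq_or_ne s t with rfl | hst
        · simp
        have hd : 0 < dist s t := dist_pos.2 hst
        have h1 := (hγ k).norm_sub_le (hG k) (Real.sqrt_pos.2 hd) t.2 s.2
        rw [← Real.dist_eq, ← Subtype.dist_eq, Real.div_sqrt] at h1
        rw [dist_eq_norm]
        refine h1.trans (le_of_eq ?_)
        ring
  obtain ⟨v, -, φ, hφ, hlim⟩ := hcomp.tendsto_subseq
    (fun k => subset_closure (Set.mem_range_self (f := u) k))
  refine ⟨φ, hφ, fun ε hε => ?_⟩
  obtain ⟨N, hN⟩ := Metric.cauchySeq_iff.1 hlim.cauchySeq ε hε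
  refine ⟨N, fun i hi j hj t ht => ?_⟩
  rw [← dist_eq_norm]
  exact (BoundedContinuousFunction.dist_coe_le_dist (f := u (φ i)) (g := u (φ j)) ⟨t, ht⟩).trans
    (hN i hi j hj).le

/-- Completeness of `L²`, with periodic measurable representatives. -/
lemma exists_periodic_tendsto_of_cauchy {g : ℕ → ℝ → E n} (hg : ∀ k, MemLp (g k) 2 unitMeasure)
    (hc : ∀ ε > 0, ∃ N, ∀ i ≥ N, ∀ j ≥ N, (∫ t in (0 : ℝ)..1, ‖g i t - g j t‖ ^ 2) ≤ ε) :
    ∃ g' : ℝ → E n, (∀ t, g' (t + 1) = g' t) ∧ Measurable g' ∧ MemLp g' 2 unitMeasure ∧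
      Tendsto (fun k => ∫ t in (0 : ℝ)..1, ‖g k t - g' t‖ ^ 2) atTop (nhds 0) := by
  let u : ℕ → Lp (E n) 2 unitMeasure := fun k => (hg k).toLp
  have hu : CauchySeq u := by
    refine Metric.cauchySeq_iff.2 fun ε hε => ?_
    obtain ⟨N, hN⟩ := hc ((ε / 2) ^ 2) (by positivity)
    refine ⟨N, fun i hi j hj => ?_⟩
    have h1 := hN i hi j hj
    have h2 := integral_norm_sq_eq_eLpNorm ((hg i).sub (hg j))
    simp only [Pi.sub_apply] at h2
    rw [h2] at h1
    have h3 := (pow_le_pow_iff_left₀ ENNReal.toReal_nonneg (by positivity) two_ne_zero).1 h1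
    rw [dist_eq_norm, ← MemLp.toLp_sub, Lp.norm_toLp]
    linarith
  obtain ⟨w, hw⟩ := cauchySeq_tendsto_of_complete hu
  obtain ⟨g₀, hg₀, hae⟩ := Lp.aestronglyMeasurable w
  have hfr : (fun t => g₀ (Int.fract t)) =ᵐ[unitMeasure] w := by
    have h1 : ∀ᵐ t ∂unitMeasure, t ≠ 1 :=
      ae_restrict_of_ae (Measure.ae_ne volume 1)
    filter_upwards [hae, h1, ae_restrict_mem measurableSet_Ioc] with t h2 h3 h4
    rw [Int.fract_eq_self.2 ⟨h4.1.le, lt_of_le_of_ne h4.2 h3⟩, h2]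
  have hL : MemLp (fun t => g₀ (Int.fract t)) 2 unitMeasure := (memLp_congr_ae hfr).2 (Lp.memLp w)
  refine ⟨fun t => g₀ (Int.fract t), fun t => by simp,
    hg₀.measurable.comp measurable_fract, hL, ?_⟩
  have hLw : hL.toLp = w := Lp.ext (hL.coeFn_toLp.trans hfr)
  have h1 : ∀ k, (∫ t in (0 : ℝ)..1, ‖g k t - g₀ (Int.fract t)‖ ^ 2) = dist (u k) w ^ 2 := by
    intro k
    have h2 := integral_norm_sq_eq_eLpNorm ((hg k).sub hL)
    simp only [Pi.sub_apply] at h2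
    rw [h2, dist_eq_norm, ← Lp.norm_toLp _ ((hg k).sub hL), MemLp.toLp_sub (hg k) hL, hLw]
  simp_rw [h1]
  simpa using (tendsto_iff_dist_tendsto_zero.1 hw).pow 2

/-- Loops that converge at `0` and whose derivatives are Cauchy in `L²` converge in `W^{1,2}`. -/
lemma exists_w12Loop_tendsto {γ g : ℕ → ℝ → E n} (hγ : ∀ k, W12Loop n (γ k) (g k))
    (h0 : ∀ ε > 0, ∃ N, ∀ i ≥ N, ∀ j ≥ N, ‖γ i 0 - γ j 0‖ ≤ ε)
    (hc : ∀ ε > 0, ∃ N, ∀ i ≥ N, ∀ j ≥ N, (∫ t in (0 : ℝ)..1, ‖g i t - g j t‖ ^ 2) ≤ ε) :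
    ∃ γ' g' : ℝ → E n, W12Loop n γ' g' ∧
      Tendsto (fun k => ∫ t in (0 : ℝ)..1, ‖γ k t - γ' t‖ ^ 2 + ‖g k t - g' t‖ ^ 2)
        atTop (nhds 0) := by
  obtain ⟨g', hper, hmeas, hL, hlim⟩ :=
    exists_periodic_tendsto_of_cauchy (fun k => (hγ k).memLp) hc
  have hcs : CauchySeq fun k => γ k 0 := by
    refine Metric.cauchySeq_iff.2 fun ε hε => ?_
    obtain ⟨N, hN⟩ := h0 (ε / 2) (by positivity)
    refine ⟨N, fun i hi j hj => ?_⟩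
    rw [dist_eq_norm]
    linarith [hN i hi j hj]
  obtain ⟨x, hx⟩ := cauchySeq_tendsto_of_complete hcs
  have hmean : ∫ t in (0 : ℝ)..1, g' t = 0 := by
    have h1 : ∀ k, ‖∫ t in (0 : ℝ)..1, g' t‖ ^ 2 ≤ ∫ t in (0 : ℝ)..1, ‖g k t - g' t‖ ^ 2 := by
      intro k
      have h2 := norm_integral_initial_sq_le ((hγ k).memLp.sub hL) (t := 1) (by simp)
      simp only [Pi.sub_apply] at h2
      rwa [intervalIntegral.integral_sub (hγ k).memLp.intervalIntegrable_unit
        hL.intervalIntegrable_unit, (hγ k).integral_eq_zero, zero_sub, norm_neg] at h2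
    have h3 := ge_of_tendsto' hlim h1
    exact norm_eq_zero.1 (pow_eq_zero_iff two_ne_zero |>.1 (le_antisymm h3 (by positivity)))
  have hloop := W12Loop.of_primitive x hper hmeas hL hmean
  refine ⟨_, g', hloop, ?_⟩
  have hx2 : Tendsto (fun k => ‖γ k 0 - x‖ ^ 2) atTop (nhds 0) := by
    simpa using (tendsto_iff_norm_sub_tendsto_zero.1 hx).pow 2
  refine squeeze_zero (g := fun k => 2 * ‖γ k 0 - x‖ ^ 2
    + 3 * ∫ t in (0 : ℝ)..1, ‖g k t - g' t‖ ^ 2)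
    (fun k => intervalIntegral.integral_nonneg zero_le_one fun _ _ => by positivity)
    (fun k => ?_) (by simpa using (hx2.const_mul 2).add (hlim.const_mul 3))
  have hd := (hγ k).sub hloop
  have hi := hd.memLp.norm_sq_intervalIntegrable
  have hi' := hd.memLp_self.norm_sq_intervalIntegrable
  rw [intervalIntegral.integral_add hi' hi]
  have h1 := intervalIntegral.integral_mono_on (μ := volume) zero_le_one hi'
    (intervalIntegrable_const (c := 2 * ‖γ k 0 - x‖ ^ 2
      + 2 * ∫ t in (0 : ℝ)..1, ‖g k t - g' t‖ ^ 2)) fun t ht => by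
    have h2 := norm_integral_initial_sq_le hd.memLp ht
    have h3 : γ k t - (x + ∫ u in (0 : ℝ)..t, g' u)
        = (γ k 0 - x) - -∫ u in (0 : ℝ)..t, (g k u - g' u) := by
      rw [intervalIntegral.integral_sub ((hγ k).locint _ _) (hloop.locint _ _), (hγ k).repr t]
      abel
    have h4 := norm_sub_sq_le_two_mul (γ k 0 - x) 0 (-∫ u in (0 : ℝ)..t, (g k u - g' u))
    rw [sub_zero, zero_sub, neg_neg, ← h3] at h4
    linarith
  simp only [intervalIntegral.integral_const, sub_zero, one_smul] at h1
  linarith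

end Compactness
/-- Corollary 3.4: if `L` satisfies (L1) and (L2), then any
Palais–Smale sequence for `𝒮_L` (bounded action, dual norm of the differential
tending to `0`) has a subsequence converging in `W^{1,2}`. -/
theorem stmt3 (n : ℕ) (L : ℝ → E n → E n → ℝ)
    (hLsmooth : ContDiff ℝ (⊤ : ℕ∞) (fun z : ℝ × E n × E n => L z.1 z.2.1 z.2.2))
    (hLper : ∀ t q v, L (t + 1) q v = L t q v)
    (hL1 : CondL1 L) (hL2 : CondL2 L)
    (γ g : ℕ → ℝ → E n) (hloop : ∀ k, W12Loop n (γ k) (g k))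
    (hS : ∃ A : ℝ, ∀ k, |SL L (γ k) (g k)| ≤ A)
    (hdS : ∃ B : ℕ → ℝ, Tendsto B atTop (nhds 0) ∧
      ∀ k, ∀ ξ : ℝ → E n, ContDiff ℝ (⊤ : ℕ∞) ξ →
        (∀ t, ξ (t + 1) = ξ t) →
        (∫ t in (0 : ℝ)..1, ‖ξ t‖ ^ 2 + ‖deriv ξ t‖ ^ 2) ≤ 1 →
        |dSL L (γ k) (g k) ξ| ≤ B k) :
    ∃ φ : ℕ → ℕ, StrictMono φ ∧
      ∃ γ' g' : ℝ → E n, W12Loop n γ' g' ∧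
        Tendsto (fun j => ∫ t in (0 : ℝ)..1,
            ‖γ (φ j) t - γ' t‖ ^ 2 + ‖g (φ j) t - g' t‖ ^ 2)
          atTop (nhds 0) := by
  obtain ⟨a, C, c, ha, hak, hC, hc, hT⟩ := exists_isTameField hLsmooth hL1 hL2
  obtain ⟨B, hB, hdS⟩ := hdS
  have hsin : Real.sin a ≠ 0 := fun h => by
    obtain ⟨k, hk⟩ := Real.sin_eq_zero_iff.1 h
    exact hak k hk.symm
  have hB0 : ∀ k, 0 ≤ B k := fun k =>
    (abs_nonneg _).trans (hdS k 0 contDiff_const (fun _ => rfl) (by simp [Pi.zero_def]))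
  have hdual : ∀ k, HasDualBound (fun t => gradient (fun q => L t q (g k t)) (γ k t))
      (fun t => gradient (fun v => L t (γ k t) v) (g k t)) (2 * B k) :=
    fun k _ _ hξ _ hN hle => abs_integral_le_of_forall_contDiff (hT.memLp_fst (hloop k))
      (hT.memLp_snd (hloop k)) (hdS k) hξ hN hle
  obtain ⟨M, hM⟩ := hB.bddAbove_range
  have hBM : ∀ k, B k ≤ M := fun k => hM (Set.mem_range_self k)
  have hK : ∀ k t, ‖γ k t‖ ≤ (2 * M + C) * (1 + 2 * a) / |2 * Real.sin a| := fun k t => by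
    refine (hT.norm_le_of_hasDualBound ha hC hsin (hloop k) (by linarith [hB0 k]) (hdual k) t).trans
      ?_
    have := hBM k
    gcongr
  set K := (2 * M + C) * (1 + 2 * a) / |2 * Real.sin a|
  have hG : ∀ k, (∫ t in (0 : ℝ)..1, ‖g k t‖ ^ 2)
      ≤ 8 * a * (2 * a * K ^ 2 + C * K + a * C ^ 2 + 2 * a * (2 * M) ^ 2) + (K ^ 2 + 1) :=
      fun k => by
    refine (hT.integral_norm_sq_le ha (hloop k) (hdual k) (hK k)).trans ?_
    have := hBM k
    have := hB0 k
    gcongr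
  set G := 8 * a * (2 * a * K ^ 2 + C * K + a * C ^ 2 + 2 * a * (2 * M) ^ 2) + (K ^ 2 + 1)
  have hK0 : 0 ≤ K := (norm_nonneg _).trans (hK 0 0)
  have hG0 : 0 ≤ G :=
    (intervalIntegral.integral_nonneg zero_le_one fun _ _ => by positivity).trans (hG 0)
  obtain ⟨φ, hφ, hcau⟩ := exists_strictMono_uniform_cauchy hloop hK hG
  refine ⟨φ, hφ, exists_w12Loop_tendsto (fun k => hloop (φ k)) (fun ε hε => ?_) fun ε hε => ?_⟩
  · obtain ⟨N, hN⟩ := hcau ε hε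
    exact ⟨N, fun i hi j hj => hN i hi j hj 0 (by simp)⟩
  · set R := 2 * (2 * a * K + C) + C * (1 + 4 * G)
    set S := 2 * K + 2 * G + 2
    have hR : 0 ≤ R := by positivity
    have hS : 0 < S := by positivity
    obtain ⟨N₁, hN₁⟩ := hcau (c * ε / (2 * (R + 1))) (by positivity)
    obtain ⟨N₂, hN₂⟩ := eventually_atTop.1
      ((hB.comp hφ.tendsto_atTop).eventually_le_const
        (show 0 < c * ε / (8 * S) by positivity))
    refine ⟨max N₁ N₂, fun i hi j hj => ?_⟩
    have h1 := hT.mul_integral_norm_sub_sq_le ha (hloop (φ i)) (hloop (φ j)) (hdual _) (hdual _)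
      (hK _) (hK _) (hG _) (hG _)
      (hN₁ i (le_of_max_le_left hi) j (le_of_max_le_left hj))
    have h2 := hN₂ i (le_of_max_le_right hi)
    have h3 := hN₂ j (le_of_max_le_right hj)
    simp only [Function.comp_apply] at h2 h3
    have h4 : (2 * B (φ i) + 2 * B (φ j)) * S ≤ (4 * (c * ε / (8 * S))) * S := by
      gcongr
      linarith
    have h5 : (4 * (c * ε / (8 * S))) * S = c * ε / 2 := by
      field_simp
      ring
    have h6 : R * (c * ε / (2 * (R + 1))) ≤ c * ε / 2 := by
      rw [mul_div_assoc', div_le_div_iff₀ (by positivity) two_pos]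
      have : 0 < c * ε := by positivity
      nlinarith
    refine le_of_mul_le_mul_left (h1.trans ?_) hc
    linarith

end
end

section
/- Let H ∈ C^∞(ℝ × S^1 × T*ℝ^n) satisfy conditions (HH2) and (HH3), and let I ⊂ ℝ be a closed interval of length at most 3. Then there exists a constant c_1 > 0, depending only on H and I, such that for every smooth loop x : S^1 → T*ℝ^n and every s ∈ I: ∫_0^1 |x(t)|² + |∂_t x(t)|² dt ≤ c_1 ( 1 + ∫_0^1 |∂_t x(t) − X_{H_{s,t}}(x(t))|² + ∂_s H_{s,t}(x(t)) dt ). -/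
/-!
Statement 4 (Lemma 5.2): an a-priori `L²`-estimate for loops, for a family of
Hamiltonians satisfying (HH2) and (HH3).
-/

open scoped RealInnerProductSpace
open Filter

noncomputable section

abbrev P (n : ℕ) : Type := E n × E n

/-- The Hamiltonian vector field `X_K(q,p) = (∂_p K, −∂_q K)`. -/
def XH {n : ℕ} (K : P n → ℝ) (z : P n) : P n :=
  (gradient (fun p => K (z.1, p)) z.2, -gradient (fun q => K (q, z.2)) z.1)

/-- `Q^a(q,p) = a(|q|² + |p|²)`. -/
def Qa {n : ℕ} (a : ℝ) (z : P n) : ℝ := a * (‖z.1‖ ^ 2 + ‖z.2‖ ^ 2)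

/-- A smooth family `H ∈ C^∞(ℝ × S¹ × T*ℝⁿ)` satisfying (HH2) and (HH3). -/
structure HamFamily {n : ℕ} (H : ℝ → ℝ → P n → ℝ) : Prop where
  smooth : ContDiff ℝ (⊤ : ℕ∞) (fun z : ℝ × ℝ × P n => H z.1 z.2.1 z.2.2)
  periodic : ∀ s t z, H s (t + 1) z = H s t z
  /-- (HH2): `∂_s H ≥ 0`. -/
  hh2 : ∀ s t z, 0 ≤ deriv (fun s' => H s' t z) s
  /-- (HH3). -/
  hh3 : ∃ a : ℝ → ℝ, ContDiff ℝ (⊤ : ℕ∞) a ∧ (∀ s, 0 ≤ deriv a s) ∧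
      (∀ s, (∃ k : ℤ, a s = (k : ℝ) * Real.pi) → 0 < deriv a s) ∧
      ∃ C : ℝ, ∀ s t z,
        |H s t z - Qa (a s) z| ≤ C ∧
        ‖fderiv ℝ (fun w => H s t w - Qa (a s) w) z‖ ≤ C ∧
        |deriv (fun s' => H s' t z - Qa (a s') z) s| ≤ C

/-- The linear map `(q, p) ↦ (p, -q)`. -/
def rotJ (n : ℕ) : P n →L[ℝ] P n :=
  (ContinuousLinearMap.snd ℝ (E n) (E n)).prod (-ContinuousLinearMap.fst ℝ (E n) (E n))

lemma rotJ_apply {n : ℕ} (z : P n) : rotJ n z = (z.2, -z.1) := rfl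

lemma rotJ_rotJ {n : ℕ} (z : P n) : rotJ n (rotJ n z) = -z := by
  simp [rotJ_apply, Prod.ext_iff]

lemma norm_rotJ_le {n : ℕ} (z : P n) : ‖rotJ n z‖ ≤ ‖z‖ := by
  simp [rotJ_apply, Prod.norm_def, le_total]

/-- Twisting a loop by the flow of `-θ J` turns `x' - θ J x` into an honest derivative. -/
lemma norm_loop_zero_le {V : Type*} [NormedAddCommGroup V] [NormedSpace ℝ V] [CompleteSpace V]
    (J : V →L[ℝ] V) (hJJ : ∀ v, J (J v) = -v) (hJ : ∀ v, ‖J v‖ ≤ ‖v‖) (a : ℝ)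
    {x x' : ℝ → V} (hx : ∀ t, HasDerivAt x (x' t) t) (hx' : Continuous x') (hper : x 1 = x 0) :
    4 * Real.sin a ^ 2 * ‖x 0‖ ≤ 6 * ∫ t in (0 : ℝ)..1, ‖x' t - (2 * a) • J (x t)‖ := by
  have hxc : Continuous x := continuous_iff_continuousAt.2 fun t => (hx t).continuousAt
  set g : ℝ → V := fun t => x' t - (2 * a) • J (x t) with hg
  have hgc : Continuous g := by fun_prop
  set y : ℝ → V := fun t => Real.cos (2 * a * t) • x t - Real.sin (2 * a * t) • J (x t) with hy
  set y' : ℝ → V := fun t => Real.cos (2 * a * t) • g t - Real.sin (2 * a * t) • J (g t) with hy'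
  have hyd : ∀ t, HasDerivAt y (y' t) t := by
    intro t
    have hl : HasDerivAt (fun t : ℝ => 2 * a * t) (2 * a) t := by
      simpa using (hasDerivAt_id t).const_mul (2 * a)
    have hJx : HasDerivAt (fun t => J (x t)) (J (x' t)) t := J.hasFDerivAt.comp_hasDerivAt t (hx t)
    refine ((hl.cos.smul (hx t)).sub (hl.sin.smul hJx)).congr_deriv ?_
    simp only [hy', hg, map_sub, map_smul, hJJ]
    module
  have hy'c : Continuous y' := by fun_prop
  have hint : ∫ t in (0 : ℝ)..1, y' t = y 1 - y 0 :=
    intervalIntegral.integral_eq_sub_of_hasDerivAt (fun t _ => hyd t)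
      (hy'c.intervalIntegrable _ _)
  have hrot : ∀ (c s : ℝ) (v : V), |c| ≤ 1 → |s| ≤ 1 → ‖c • v - s • J v‖ ≤ 2 * ‖v‖ := by
    intro c s v hc hs
    calc ‖c • v - s • J v‖ ≤ |c| * ‖v‖ + |s| * ‖J v‖ := by
          simpa [norm_smul] using norm_sub_le (c • v) (s • J v)
      _ ≤ 1 * ‖v‖ + 1 * ‖v‖ := by gcongr; exact hJ v
      _ = 2 * ‖v‖ := by ring
  have hbound : ‖y 1 - y 0‖ ≤ 2 * ∫ t in (0 : ℝ)..1, ‖g t‖ := by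
    rw [← hint, ← intervalIntegral.integral_const_mul]
    refine intervalIntegral.norm_integral_le_of_norm_le zero_le_one ?_
      ((hgc.norm.const_mul 2).intervalIntegrable _ _)
    exact Filter.Eventually.of_forall fun t _ =>
      hrot _ _ _ (Real.abs_cos_le_one _) (Real.abs_sin_le_one _)
  set w := y 1 - y 0 with hw
  have hwx : w = (Real.cos (2 * a) - 1) • x 0 - Real.sin (2 * a) • J (x 0) := by
    simp only [hw, hy, hper, mul_one, mul_zero, Real.cos_zero, Real.sin_zero]
    module
  have hinv : (Real.cos (2 * a) • w - (-Real.sin (2 * a)) • J w) - w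
      = (4 * Real.sin a ^ 2) • x 0 := by
    have h1 : Real.cos (2 * a) = 1 - 2 * Real.sin a ^ 2 := by
      rw [Real.cos_two_mul, Real.cos_sq']; ring
    have h2 := Real.sin_sq_add_cos_sq (2 * a)
    have h3 : (4 * Real.sin a ^ 2) = (Real.cos (2 * a) - 1) ^ 2 + Real.sin (2 * a) ^ 2 := by
      linear_combination 2 * h1 - h2
    rw [h3, hwx]
    simp only [map_sub, map_smul, hJJ]
    module
  have h3 : ‖(4 * Real.sin a ^ 2) • x 0‖ ≤ 2 * ‖w‖ + ‖w‖ := by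
    rw [← hinv]
    refine (norm_sub_le _ _).trans ?_
    gcongr
    exact hrot _ _ _ (Real.abs_cos_le_one _) (by simpa using Real.abs_sin_le_one _)
  rw [norm_smul, Real.norm_of_nonneg (by positivity)] at h3
  linarith

lemma sq_integral_le_integral_sq {f : ℝ → ℝ} (hf : Continuous f) :
    (∫ t in (0 : ℝ)..1, f t) ^ 2 ≤ ∫ t in (0 : ℝ)..1, f t ^ 2 := by
  set m := ∫ t in (0 : ℝ)..1, f t with hm
  have h0 : 0 ≤ ∫ t in (0 : ℝ)..1, (f t - m) ^ 2 :=
    intervalIntegral.integral_nonneg zero_le_one fun t _ => sq_nonneg _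
  have h1 : ∫ t in (0 : ℝ)..1, (f t - m) ^ 2
      = (∫ t in (0 : ℝ)..1, f t ^ 2) - (2 * m) * m + m ^ 2 := by
    have : ∀ t, (f t - m) ^ 2 = f t ^ 2 - (2 * m) * f t + m ^ 2 := fun t => by ring
    simp_rw [this]
    rw [intervalIntegral.integral_add, intervalIntegral.integral_sub,
      intervalIntegral.integral_const_mul, ← hm]
    · simp
    all_goals exact Continuous.intervalIntegrable (by fun_prop) _ _
  nlinarith

lemma norm_loop_le {V : Type*} [NormedAddCommGroup V] [NormedSpace ℝ V] [CompleteSpace V]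
    (J : V →L[ℝ] V) (hJJ : ∀ v, J (J v) = -v) (hJ : ∀ v, ‖J v‖ ≤ ‖v‖) (a : ℝ)
    {x x' : ℝ → V} (hx : ∀ t, HasDerivAt x (x' t) t) (hx' : Continuous x')
    (hper : ∀ t, x (t + 1) = x t) (t : ℝ) :
    4 * Real.sin a ^ 2 * ‖x t‖ ≤ 6 * ∫ τ in (0 : ℝ)..1, ‖x' τ - (2 * a) • J (x τ)‖ := by
  have hper' : ∀ t, x' (t + 1) = x' t := fun t => by
    have h : HasDerivAt x (x' (t + 1)) t := by
      simpa [hper] using (hx (t + 1)).comp_add_const t 1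
    exact h.unique (hx t)
  have hshift := norm_loop_zero_le J hJJ hJ a (x := fun τ => x (τ + t)) (x' := fun τ => x' (τ + t))
    (fun τ => (hx (τ + t)).comp_add_const τ t) (by fun_prop)
    (by simpa [add_comm] using hper t)
  have hP : Function.Periodic (fun τ => ‖x' τ - (2 * a) • J (x τ)‖) 1 := fun τ => by
    simp only [hper, hper']
  have hI := intervalIntegral.integral_comp_add_right (a := 0) (b := 1)
    (fun τ => ‖x' τ - (2 * a) • J (x τ)‖) t
  rw [hI, zero_add, add_comm 1 t, hP.intervalIntegral_add_eq t 0] at hshift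
  simpa using hshift

/-- `L²` coercivity of `∂_t - 2 a J` on loops, up to the factor `sin⁴ a`. -/
lemma integral_norm_sq_loop_le {V : Type*} [NormedAddCommGroup V] [NormedSpace ℝ V]
    [CompleteSpace V] (J : V →L[ℝ] V) (hJJ : ∀ v, J (J v) = -v) (hJ : ∀ v, ‖J v‖ ≤ ‖v‖) (a : ℝ)
    {x x' : ℝ → V} (hx : ∀ t, HasDerivAt x (x' t) t) (hx' : Continuous x')
    (hper : ∀ t, x (t + 1) = x t) :
    16 * Real.sin a ^ 4 * ∫ t in (0 : ℝ)..1, ‖x t‖ ^ 2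
      ≤ 36 * ∫ t in (0 : ℝ)..1, ‖x' t - (2 * a) • J (x t)‖ ^ 2 := by
  have hxc : Continuous x := continuous_iff_continuousAt.2 fun t => (hx t).continuousAt
  set K := ∫ t in (0 : ℝ)..1, ‖x' t - (2 * a) • J (x t)‖ ^ 2
  have hpt : ∀ t, 16 * Real.sin a ^ 4 * ‖x t‖ ^ 2 ≤ 36 * K := fun t => by
    have h1 := pow_le_pow_left₀ (by positivity) (norm_loop_le J hJJ hJ a hx hx' hper t) 2
    have h2 := sq_integral_le_integral_sq
      (f := fun t => ‖x' t - (2 * a) • J (x t)‖) (by fun_prop)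
    nlinarith
  rw [← intervalIntegral.integral_const_mul]
  calc _ ≤ ∫ _ in (0 : ℝ)..1, 36 * K :=
        intervalIntegral.integral_mono_on zero_le_one
          (Continuous.intervalIntegrable (by fun_prop) _ _)
          (Continuous.intervalIntegrable (by fun_prop) _ _) fun t _ => hpt t
    _ = 36 * K := by simp

/-- The Hamiltonian vector field expressed through a total derivative. -/
lemma XH_eq_of_hasFDerivAt {n : ℕ} {K : P n → ℝ} {K' : P n →L[ℝ] ℝ} {z : P n}
    (h : HasFDerivAt K K' z) :
    XH K z = ((InnerProductSpace.toDual ℝ (E n)).symm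
        (K'.comp (ContinuousLinearMap.inr ℝ (E n) (E n))),
      -(InnerProductSpace.toDual ℝ (E n)).symm
        (K'.comp (ContinuousLinearMap.inl ℝ (E n) (E n)))) := by
  have hp : HasFDerivAt (fun p => K (z.1, p)) (K'.comp (ContinuousLinearMap.inr ℝ (E n) (E n)))
      z.2 := HasFDerivAt.comp (g := K) z.2 h (hasFDerivAt_prodMk_right z.1 z.2)
  have hq : HasFDerivAt (fun q => K (q, z.2)) (K'.comp (ContinuousLinearMap.inl ℝ (E n) (E n)))
      z.1 := HasFDerivAt.comp (g := K) z.1 h (hasFDerivAt_prodMk_left z.1 z.2)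
  simp only [XH, gradient, hp.fderiv, hq.fderiv]

lemma contDiff_Qa {n : ℕ} (a : ℝ) : ContDiff ℝ (⊤ : ℕ∞) (Qa (n := n) a) := by
  unfold Qa
  exact contDiff_const.mul ((contDiff_fst.norm_sq ℝ).add (contDiff_snd.norm_sq ℝ))

lemma XH_Qa {n : ℕ} (a : ℝ) (z : P n) : XH (Qa a) z = (2 * a) • rotJ n z := by
  have key : ∀ (b : ℝ) (v : E n),
      gradient (fun p : E n => a * (b + ‖p‖ ^ 2)) v = (2 * a) • v := by
    intro b v
    apply HasGradientAt.gradient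
    rw [hasGradientAt_iff_hasFDerivAt]
    refine ((((hasStrictFDerivAt_norm_sq v).hasFDerivAt).const_add b).const_mul a).congr_fderiv ?_
    ext w
    simp
    ring
  have h1 := key (‖z.1‖ ^ 2) z.2
  have h2 := key (‖z.2‖ ^ 2) z.1
  simp_rw [add_comm (‖z.2‖ ^ 2)] at h2
  simp only [XH, Qa, h1, h2, rotJ_apply, Prod.smul_mk, smul_neg]

lemma norm_XH_sub_le {n : ℕ} {K : P n → ℝ} {a C : ℝ} {z : P n} (hK : DifferentiableAt ℝ K z)
    (hC : ‖fderiv ℝ (fun w => K w - Qa a w) z‖ ≤ C) :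
    ‖XH K z - (2 * a) • rotJ n z‖ ≤ C := by
  have hQ : DifferentiableAt ℝ (Qa (n := n) a) z :=
    ((contDiff_Qa a).differentiable (by simp)).differentiableAt
  have hC0 : 0 ≤ C := (norm_nonneg _).trans hC
  have hcomp : ∀ L : E n →L[ℝ] P n, ‖L‖ ≤ 1 →
      ‖(fderiv ℝ K z).comp L - (fderiv ℝ (Qa a) z).comp L‖ ≤ C := by
    intro L hL
    rw [← ContinuousLinearMap.sub_comp, ← fderiv_fun_sub hK hQ]
    calc _ ≤ _ := ContinuousLinearMap.opNorm_comp_le _ _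
      _ ≤ C * 1 := by gcongr
      _ = C := mul_one C
  rw [← XH_Qa, XH_eq_of_hasFDerivAt hK.hasFDerivAt, XH_eq_of_hasFDerivAt hQ.hasFDerivAt,
    Prod.mk_sub_mk, neg_sub_neg, ← map_sub, ← map_sub, Prod.norm_mk,
    LinearIsometryEquiv.norm_map, LinearIsometryEquiv.norm_map]
  refine max_le (hcomp _ (ContinuousLinearMap.norm_inr_le_one _ _ _)) ?_
  rw [norm_sub_rev]
  exact hcomp _ (ContinuousLinearMap.norm_inl_le_one _ _ _)

namespace HamFamily

variable {n : ℕ} {H : ℝ → ℝ → P n → ℝ}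

lemma hasFDerivAt_slice (hH : HamFamily H) (s t : ℝ) (z : P n) :
    HasFDerivAt (H s t) ((fderiv ℝ (fun z : ℝ × ℝ × P n => H z.1 z.2.1 z.2.2) (s, t, z)).comp
      ((ContinuousLinearMap.inr ℝ ℝ (ℝ × P n)).comp (ContinuousLinearMap.inr ℝ ℝ (P n)))) z := by
  have h := (hH.smooth.differentiable (by simp) (s, t, z)).hasFDerivAt
  exact HasFDerivAt.comp (g := fun z : ℝ × ℝ × P n => H z.1 z.2.1 z.2.2) z h
    ((hasFDerivAt_prodMk_right s (t, z)).comp z (hasFDerivAt_prodMk_right t z))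

lemma hasDerivAt_param (hH : HamFamily H) (s t : ℝ) (z : P n) :
    HasDerivAt (fun s' => H s' t z)
      (fderiv ℝ (fun z : ℝ × ℝ × P n => H z.1 z.2.1 z.2.2) (s, t, z) (1, 0)) s := by
  have h := (hH.smooth.differentiable (by simp) (s, t, z)).hasFDerivAt
  exact h.comp_hasDerivAt (f := fun s' => (s', t, z)) s
    ((hasDerivAt_id s).prodMk (hasDerivAt_const s (t, z)))

lemma continuous_XH (hH : HamFamily H) (s : ℝ) {x : ℝ → P n} (hx : Continuous x) :
    Continuous fun t => XH (H s t) (x t) := by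
  have hc := hH.smooth.continuous_fderiv (by simp)
  simp_rw [fun t => XH_eq_of_hasFDerivAt (hH.hasFDerivAt_slice s t (x t))]
  have hc' : Continuous fun t =>
      fderiv ℝ (fun z : ℝ × ℝ × P n => H z.1 z.2.1 z.2.2) (s, t, x t) :=
    hc.comp (by fun_prop)
  fun_prop

lemma continuous_deriv_param (hH : HamFamily H) (s : ℝ) {x : ℝ → P n} (hx : Continuous x) :
    Continuous fun t => deriv (fun s' => H s' t (x t)) s := by
  have hc := hH.smooth.continuous_fderiv (by simp)
  simp_rw [fun t => (hH.hasDerivAt_param s t (x t)).deriv]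
  have hc' : Continuous fun t =>
      fderiv ℝ (fun z : ℝ × ℝ × P n => H z.1 z.2.1 z.2.2) (s, t, x t) :=
    hc.comp (by fun_prop)
  fun_prop

lemma deriv_mul_norm_sq_le (hH : HamFamily H) {a : ℝ → ℝ} {C s t : ℝ} {z : P n}
    (ha : DifferentiableAt ℝ a s) (ha' : 0 ≤ deriv a s)
    (hC : |deriv (fun s' => H s' t z - Qa (a s') z) s| ≤ C) :
    deriv a s * ‖z‖ ^ 2 ≤ deriv (fun s' => H s' t z) s + C := by
  have hQ : HasDerivAt (fun s' => Qa (a s') z) (deriv a s * (‖z.1‖ ^ 2 + ‖z.2‖ ^ 2)) s :=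
    ha.hasDerivAt.mul_const _
  have hd := ((hH.hasDerivAt_param s t z).differentiableAt.hasDerivAt.sub hQ).deriv
  have hd' : deriv (fun s' => H s' t z - Qa (a s') z) s
      = deriv (fun s' => H s' t z) s - deriv a s * (‖z.1‖ ^ 2 + ‖z.2‖ ^ 2) := hd
  rw [hd'] at hC
  have hz : ‖z‖ ^ 2 ≤ ‖z.1‖ ^ 2 + ‖z.2‖ ^ 2 := by
    rw [Prod.norm_def]
    rcases max_choice ‖z.1‖ ‖z.2‖ with h | h <;> rw [h] <;>
      nlinarith [sq_nonneg ‖z.1‖, sq_nonneg ‖z.2‖]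
  have := mul_le_mul_of_nonneg_left hz ha'
  linarith [neg_le_of_abs_le hC]

end HamFamily

/-- Lemma 5.2: if `H` satisfies (HH2), (HH3) and `I = [σ₀, σ₁]` is a
closed interval of length at most 3, there is `c₁ > 0`, depending only on `H` and `I`,
such that for every smooth loop `x : S¹ → T*ℝⁿ` and every `s ∈ I`,
`‖x‖²_{L²} + ‖∂_t x‖²_{L²} ≤ c₁ (1 + ∫₀¹ |∂_t x − X_{H_{s,t}}(x)|² + ∂_s H_{s,t}(x) dt)`. -/
theorem stmt4 (n : ℕ) (H : ℝ → ℝ → P n → ℝ) (hH : HamFamily H)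
    (σ₀ σ₁ : ℝ) (hle : σ₀ ≤ σ₁) (hlen : σ₁ - σ₀ ≤ 3) :
    ∃ c₁ > (0 : ℝ), ∀ x : ℝ → P n, ContDiff ℝ (⊤ : ℕ∞) x → (∀ t, x (t + 1) = x t) →
      ∀ s ∈ Set.Icc σ₀ σ₁,
        (∫ t in (0 : ℝ)..1, ‖x t‖ ^ 2 + ‖deriv x t‖ ^ 2) ≤
          c₁ * (1 + ∫ t in (0 : ℝ)..1,
            ‖deriv x t - XH (H s t) (x t)‖ ^ 2 +
              deriv (fun s' => H s' t (x t)) s) := by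
  obtain ⟨a, ha, ha0, hapos, C, hC⟩ := hH.hh3
  have hC0 : 0 ≤ C := (abs_nonneg _).trans (hC 0 0 0).1
  have hac : Continuous a := ha.continuous
  have ha'c : Continuous (deriv a) := ha.continuous_deriv (by simp)
  obtain ⟨δ, hδ, hδle⟩ : ∃ δ > 0, ∀ s ∈ Set.Icc σ₀ σ₁,
      δ ≤ 16 * Real.sin (a s) ^ 4 + deriv a s := by
    refine isCompact_Icc.exists_forall_le' (by fun_prop) fun s _ => ?_
    rcases eq_or_ne (Real.sin (a s)) 0 with h | h
    · obtain ⟨k, hk⟩ := Real.sin_eq_zero_iff.1 h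
      have := hapos s ⟨k, hk.symm⟩
      positivity
    · have := ha0 s
      positivity
  obtain ⟨A, hA⟩ := isCompact_Icc.exists_bound_of_continuousOn (s := Set.Icc σ₀ σ₁)
    hac.continuousOn
  have hA0 : 0 ≤ A := (norm_nonneg _).trans (hA σ₀ ⟨le_rfl, hle⟩)
  set M := (72 + 72 * C ^ 2 + C) / δ with hM
  have hM0 : 0 ≤ M := by positivity
  refine ⟨(1 + 8 * A ^ 2) * M + 4 + 4 * C ^ 2, by positivity, fun x hx hper s hs => ?_⟩
  have hxc : Continuous x := hx.continuous
  have hx'c : Continuous (deriv x) := hx.continuous_deriv (by simp)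
  have hXc := hH.continuous_XH s hxc
  have hDc := hH.continuous_deriv_param s hxc
  set h : ℝ → ℝ := fun t => ‖deriv x t - XH (H s t) (x t)‖ with hh
  set D : ℝ → ℝ := fun t => deriv (fun s' => H s' t (x t)) s with hD
  set g : ℝ → ℝ := fun t => ‖deriv x t - (2 * a s) • rotJ n (x t)‖ with hg
  have hhc : Continuous h := by fun_prop
  have hgc : Continuous g := by fun_prop
  have hint : ∀ {f : ℝ → ℝ}, Continuous f → IntervalIntegrable f MeasureTheory.volume 0 1 :=
    fun hf => hf.intervalIntegrable _ _
  have hg2 : ∀ t, g t ^ 2 ≤ 2 * h t ^ 2 + 2 * C ^ 2 := fun t => by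
    have h1 : g t ≤ h t + C := by
      have := norm_sub_le_norm_sub_add_norm_sub (deriv x t) (XH (H s t) (x t))
        ((2 * a s) • rotJ n (x t))
      exact this.trans (add_le_add le_rfl
        (norm_XH_sub_le (hH.hasFDerivAt_slice s t (x t)).differentiableAt (hC s t (x t)).2.1))
    have h2 := pow_le_pow_left₀ (norm_nonneg _) h1 2
    nlinarith [sq_nonneg (h t - C)]
  have hx'2 : ∀ t, ‖deriv x t‖ ^ 2 ≤ 4 * h t ^ 2 + 4 * C ^ 2 + 8 * A ^ 2 * ‖x t‖ ^ 2 := fun t => by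
    have h1 : ‖deriv x t‖ ≤ g t + 2 * A * ‖x t‖ := by
      have h3 := norm_le_norm_sub_add (deriv x t) ((2 * a s) • rotJ n (x t))
      have h4 : ‖(2 * a s) • rotJ n (x t)‖ ≤ 2 * A * ‖x t‖ := by
        rw [norm_smul, norm_mul, Real.norm_two]
        gcongr
        · exact hA s hs
        · exact norm_rotJ_le _
      linarith
    have h2 := pow_le_pow_left₀ (norm_nonneg _) h1 2
    nlinarith [sq_nonneg (g t - 2 * A * ‖x t‖), hg2 t]
  have hGle : ∫ t in (0 : ℝ)..1, g t ^ 2 ≤ 2 * (∫ t in (0 : ℝ)..1, h t ^ 2) + 2 * C ^ 2 := by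
    have := intervalIntegral.integral_mono_on zero_le_one (hint (by fun_prop))
      (hint (by fun_prop)) fun t _ => hg2 t
    rw [intervalIntegral.integral_add (hint (by fun_prop)) (hint (by fun_prop)),
      intervalIntegral.integral_const_mul] at this
    simpa using this
  have hcoer : 16 * Real.sin (a s) ^ 4 * ∫ t in (0 : ℝ)..1, ‖x t‖ ^ 2
      ≤ 36 * ∫ t in (0 : ℝ)..1, g t ^ 2 :=
    integral_norm_sq_loop_le (rotJ n) rotJ_rotJ norm_rotJ_le (a s)
      (fun t => (hx.differentiable (by simp) t).hasDerivAt) hx'c hper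
  have hmono : deriv a s * ∫ t in (0 : ℝ)..1, ‖x t‖ ^ 2 ≤ (∫ t in (0 : ℝ)..1, D t) + C := by
    have := intervalIntegral.integral_mono_on zero_le_one
      (hint (f := fun t => deriv a s * ‖x t‖ ^ 2) (by fun_prop))
      (hint (f := fun t => D t + C) (by fun_prop)) fun t _ =>
      hH.deriv_mul_norm_sq_le (ha.differentiable (by simp) s) (ha0 s) (hC s t (x t)).2.2
    rw [intervalIntegral.integral_add (hint (by fun_prop)) (hint (by fun_prop)),
      intervalIntegral.integral_const_mul] at this
    simpa using this
  have hX'le : ∫ t in (0 : ℝ)..1, ‖deriv x t‖ ^ 2 ≤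
      4 * (∫ t in (0 : ℝ)..1, h t ^ 2) + 4 * C ^ 2
        + 8 * A ^ 2 * ∫ t in (0 : ℝ)..1, ‖x t‖ ^ 2 := by
    have := intervalIntegral.integral_mono_on zero_le_one (hint (by fun_prop))
      (hint (by fun_prop)) fun t _ => hx'2 t
    rw [intervalIntegral.integral_add (hint (by fun_prop)) (hint (by fun_prop)),
      intervalIntegral.integral_add (hint (by fun_prop)) (hint (by fun_prop)),
      intervalIntegral.integral_const_mul, intervalIntegral.integral_const_mul] at this
    simpa using this
  have hX0 : 0 ≤ ∫ t in (0 : ℝ)..1, ‖x t‖ ^ 2 :=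
    intervalIntegral.integral_nonneg zero_le_one fun t _ => by positivity
  have hh0 : 0 ≤ ∫ t in (0 : ℝ)..1, h t ^ 2 :=
    intervalIntegral.integral_nonneg zero_le_one fun t _ => by positivity
  have hD0 : 0 ≤ ∫ t in (0 : ℝ)..1, D t :=
    intervalIntegral.integral_nonneg zero_le_one fun t _ => hH.hh2 s t (x t)
  rw [intervalIntegral.integral_add (hint (by fun_prop)) (hint (by fun_prop)),
    intervalIntegral.integral_add (f := fun t => h t ^ 2) (g := D) (hint (by fun_prop))
      (hint (by fun_prop))]
  generalize (∫ t in (0 : ℝ)..1, ‖x t‖ ^ 2) = X at *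
  generalize (∫ t in (0 : ℝ)..1, ‖deriv x t‖ ^ 2) = X' at *
  generalize (∫ t in (0 : ℝ)..1, g t ^ 2) = G at *
  generalize (∫ t in (0 : ℝ)..1, h t ^ 2) = N at *
  generalize (∫ t in (0 : ℝ)..1, D t) = B at *
  have hXle : X ≤ M * (1 + (N + B)) := by
    rw [hM, div_mul_eq_mul_div, le_div_iff₀ hδ]
    have h1 := mul_le_mul_of_nonneg_right (hδle s hs) hX0
    have h2 : 0 ≤ (72 * C ^ 2 + C) * (N + B) := by positivity
    nlinarith
  have h1 := mul_le_mul_of_nonneg_left hXle (by positivity : 0 ≤ 1 + 8 * A ^ 2)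
  have h2 : 0 ≤ C ^ 2 * (N + B) := by positivity
  nlinarith

end
end

section
/- Let V ⊂ ℝ^n be a bounded domain, let h : V → ℝ be smooth, and let Z = Σ_j Z_j ∂_{q_j} be a compactly supported smooth vector field on ℝ^n such that dh(Z) ≥ 0 everywhere on V and sup_{q∈ℝ^n} |∂_{q_i} Z_j(q)| ≤ 1/(2n) for all i,j. Define H_Z(q,p) := p·Z(q), the vector field Z̄ := Σ_i p_i ∂_{p_i} + X_{H_Z} on T*ℝ^n (explicitly Z̄(q,p) = (Z(q), p − (DZ(q))^T p)), and for ε > 0 set H_ε(q,p) := |p|²/2 + ε h(q). Then for every ε > 0 and every (q,p) with q ∈ V: Σ_i p_i dp_i(Z̄)(q,p) ≥ |p|²/2 and dH_ε(Z̄)(q,p) ≥ |p|²/2. -/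
/-!
Statement 8 (computations in the proof of Lemma 6.5): lower bounds for the Liouville
vector field `Z̄ = Σ p_i ∂_{p_i} + X_{H_Z}` against `H_ε(q,p) = |p|²/2 + ε h(q)`.
-/

open scoped RealInnerProductSpace

noncomputable section

/-- The vector field `Z̄ = Σ_i p_i ∂_{p_i} + X_{H_Z}` on `T*ℝⁿ`, where
`H_Z(q,p) = p·Z(q)`; explicitly `Z̄(q,p) = (Z(q), p − (DZ(q))ᵀ p)`, with
`((DZ(q))ᵀ p)` realized as the gradient in `q` of `q ↦ ⟪p, Z(q)⟫`. -/
def Zbar {n : ℕ} (Z : E n → E n) (z : P n) : P n :=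
  (Z z.1, z.2 - gradient (fun q => ⟪z.2, Z q⟫) z.1)

/-- A matrix with entries of absolute value at most `1 / (2n)` defines a quadratic form bounded by
half of the squared Euclidean norm. -/
theorem sum_sum_mul_le_half_norm_sq {n : ℕ} (a : Fin n → Fin n → ℝ)
    (ha : ∀ i j, |a i j| ≤ 1 / (2 * (n : ℝ))) (p : E n) :
    ∑ j, ∑ i, p j * (p i * a i j) ≤ ‖p‖ ^ 2 / 2 := by
  have hterm : ∀ i j, p j * (p i * a i j) ≤ |p j| * |p i| * (1 / (2 * (n : ℝ))) := fun i j =>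
    calc p j * (p i * a i j) ≤ |p j * (p i * a i j)| := le_abs_self _
      _ = |p j| * |p i| * |a i j| := by rw [abs_mul, abs_mul, mul_assoc]
      _ ≤ _ := mul_le_mul_of_nonneg_left (ha i j) (by positivity)
  have hcs : (∑ i, |p i|) ^ 2 ≤ (n : ℝ) * ‖p‖ ^ 2 := by
    simpa [EuclideanSpace.real_norm_sq_eq] using
      sq_sum_le_card_mul_sum_sq (s := Finset.univ) (f := fun i => |p i|)
  calc ∑ j, ∑ i, p j * (p i * a i j)
      ≤ ∑ j, ∑ i, |p j| * |p i| * (1 / (2 * (n : ℝ))) :=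
        Finset.sum_le_sum fun j _ => Finset.sum_le_sum fun i _ => hterm i j
    _ = (∑ i, |p i|) ^ 2 * (1 / (2 * (n : ℝ))) := by
        rw [sq, Finset.sum_mul_sum, Finset.sum_mul]
        simp only [Finset.sum_mul]
    _ ≤ (n : ℝ) * ‖p‖ ^ 2 * (1 / (2 * (n : ℝ))) :=
        mul_le_mul_of_nonneg_right hcs (by positivity)
    _ ≤ ‖p‖ ^ 2 / 2 := by
        rcases Nat.eq_zero_or_pos n with rfl | hn
        · simp only [Nat.cast_zero, zero_mul]
          positivity
        · have : (n : ℝ) ≠ 0 := by positivity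
          exact le_of_eq (by field_simp)

/-- The derivative of `x ↦ ⟪p, Z x⟫` in the direction `p`, in coordinates. -/
theorem inner_gradient_inner_eq_sum {n : ℕ} {Z : E n → E n} {q : E n}
    (hZ : DifferentiableAt ℝ Z q) (p : E n) :
    ⟪p, gradient (fun x => ⟪p, Z x⟫) q⟫ =
      ∑ j, ∑ i, p j * (p i * fderiv ℝ (fun x => Z x j) q (EuclideanSpace.single i 1)) := by
  have hcoord : ∀ j, DifferentiableAt ℝ (fun x => Z x j) q :=
    fun j => differentiableAt_euclidean.1 hZ j
  have hexp : (fun x => ⟪p, Z x⟫) = fun x => ∑ j, p j * Z x j := by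
    funext x
    simp [PiLp.inner_apply, mul_comm]
  have hp : p = ∑ i, p i • EuclideanSpace.single i (1 : ℝ) := by
    ext k
    simp [Finset.sum_apply, Pi.single_apply]
  have happly : ∀ L : E n →L[ℝ] ℝ, L p = ∑ i, p i * L (EuclideanSpace.single i 1) := fun L => by
    simpa using congrArg L hp
  rw [real_inner_comm, gradient, InnerProductSpace.toDual_symm_apply, hexp,
    fderiv_fun_sum fun j _ => (hcoord j).const_mul (p j)]
  simp only [sum_apply]
  refine Finset.sum_congr rfl fun j _ => ?_
  rw [fderiv_const_mul (hcoord j), ← Finset.mul_sum, ← happly]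
  rfl

/-- The differential of `(q, p) ↦ ‖p‖² / 2 + ε h(q)`. -/
theorem fderiv_half_norm_sq_add_const_mul {n : ℕ} {h : E n → ℝ} {q : E n}
    (hh : DifferentiableAt ℝ h q) (ε : ℝ) (p : E n) (v : P n) :
    fderiv ℝ (fun z : P n => ‖z.2‖ ^ 2 / 2 + ε * h z.1) (q, p) v =
      ⟪p, v.2⟫ + ε * fderiv ℝ h q v.1 := by
  have hsnd : HasFDerivAt (fun z : P n => z.2) (ContinuousLinearMap.snd ℝ (E n) (E n)) (q, p) :=
    hasFDerivAt_snd
  have hfst : HasFDerivAt (fun z : P n => h z.1)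
      ((fderiv ℝ h q).comp (ContinuousLinearMap.fst ℝ (E n) (E n))) (q, p) :=
    HasFDerivAt.comp (q, p) (f := Prod.fst) hh.hasFDerivAt hasFDerivAt_fst
  have key := (hsnd.norm_sq.mul_const (1 / 2 : ℝ)).add (hfst.const_mul ε)
  have heq : (fun z : P n => ‖z.2‖ ^ 2 / 2 + ε * h z.1) =
      (fun z : P n => ‖z.2‖ ^ 2 * (1 / 2 : ℝ)) + fun z => ε * h z.1 := by
    funext z
    simp [div_eq_mul_inv]
  rw [heq, key.fderiv]
  simp

/-- let `V ⊂ ℝⁿ` be a bounded domain, `h` smooth on `V`, and `Z` a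
compactly supported smooth vector field with `dh(Z) ≥ 0` on `V` and
`|∂_{q_i} Z_j| ≤ 1/(2n)` everywhere. Then for `H_ε(q,p) = |p|²/2 + ε h(q)` and every
`q ∈ V`, `p ∈ ℝⁿ`: `Σ_i p_i dp_i(Z̄)(q,p) ≥ |p|²/2` and `dH_ε(Z̄)(q,p) ≥ |p|²/2`. -/
theorem stmt8 (n : ℕ) (V : Set (E n)) (hVopen : IsOpen V) (hVconn : IsConnected V)
    (hVbdd : Bornology.IsBounded V)
    (h : E n → ℝ) (hh : ContDiffOn ℝ (⊤ : ℕ∞) h V)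
    (Z : E n → E n) (hZsmooth : ContDiff ℝ (⊤ : ℕ∞) Z) (hZsupp : HasCompactSupport Z)
    (hdhZ : ∀ q ∈ V, 0 ≤ fderiv ℝ h q (Z q))
    (hDZ : ∀ (q : E n) (i j : Fin n),
      |fderiv ℝ (fun q' => Z q' j) q (EuclideanSpace.single i 1)| ≤ 1 / (2 * (n : ℝ)))
    (ε : ℝ) (hε : 0 < ε) :
    ∀ q ∈ V, ∀ p : E n,
      ‖p‖ ^ 2 / 2 ≤ ⟪p, (Zbar Z (q, p)).2⟫ ∧
      ‖p‖ ^ 2 / 2 ≤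
        fderiv ℝ (fun z : P n => ‖z.2‖ ^ 2 / 2 + ε * h z.1) (q, p) (Zbar Z (q, p)) := by
  intro q hq p
  have hZ : DifferentiableAt ℝ Z q := hZsmooth.differentiable (by simp) q
  have hhq : DifferentiableAt ℝ h q :=
    (hh.contDiffAt (hVopen.mem_nhds hq)).differentiableAt (by simp)
  have hfst : ‖p‖ ^ 2 / 2 ≤ ⟪p, (Zbar Z (q, p)).2⟫ := by
    have hbound := sum_sum_mul_le_half_norm_sq _ (hDZ q) p
    rw [← inner_gradient_inner_eq_sum hZ p] at hbound
    simp only [Zbar, inner_sub_right, real_inner_self_eq_norm_sq]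
    linarith
  refine ⟨hfst, ?_⟩
  rw [fderiv_half_norm_sq_add_const_mul hhq]
  exact hfst.trans (le_add_of_nonneg_right (mul_nonneg hε.le (hdhZ q hq)))

end
end

section
/- Let V ⊂ ℝ^n be a bounded domain with smooth boundary. Let h : V → ℝ_{>0} be a positive smooth function with h(q) = dist(q, ∂V)^{−2} for all q sufficiently close to ∂V, and let Z be a compactly supported smooth vector field on ℝ^n which points strictly outwards on ∂V (Z(q)·ν(q) > 0 for every q ∈ ∂V, ν the outward unit normal), satisfies dh(Z) ≥ 0 on V, and sup_q |∂_{q_i} Z_j(q)| ≤ 1/(2n) for all i,j. Set H_Z(q,p) := p·Z(q), Z̄ := Σ_i p_i ∂_{p_i} + X_{H_Z}, H_ε(q,p) := |p|²/2 + ε h(q) on V × ℝ^n, and U_ε^− := {(q,p) : q ∈ V, H_ε(q,p) < 1/2}. Then: (i) for all sufficiently small ε > 0, dH_ε(Z̄) > 0 at every point of {H_ε = 1/2}; (ii) Z̄ generates a globally defined flow (φ_t^{Z̄})_{t∈ℝ} on T*ℝ^n, and for each sufficiently small ε > 0 there exists T_ε > 0 with φ_{T_ε}^{Z̄}(U_ε^−)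 ⊇ D*V; moreover the T_ε can be chosen so that T_ε → 0 as ε → 0. -/
/-!
Statement 9 (Lemma 6.5): `U_ε⁻ = {H_ε < 1/2}` is of restricted contact type for small
`ε`, and the Liouville flow of `Z̄` pushes `U_ε⁻` over `D*V` in time `T_ε → 0`.

A bounded domain with smooth boundary is presented by a global defining function
`f`: `f` is smooth, `V = {f < 0}`, `∂V = {f = 0}`, and `∇f ≠ 0` on `∂V`; the outward
normal direction at `x ∈ ∂V` is `∇f(x)`.
-/

open scoped RealInnerProductSpace
open Filter

noncomputable section

/-- `H_ε(q,p) = |p|²/2 + ε h(q)`. -/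
def Heps {n : ℕ} (h : E n → ℝ) (ε : ℝ) (z : P n) : ℝ :=
  ‖z.2‖ ^ 2 / 2 + ε * h z.1

/-- The open disc cotangent bundle `D*V = {(q,p) : q ∈ V, |p| < 1}`. -/
def DiscBundle {n : ℕ} (V : Set (E n)) : Set (P n) :=
  {z : P n | z.1 ∈ V ∧ ‖z.2‖ < 1}

/-- The sublevel domain `U_ε⁻ = {(q,p) : q ∈ V, H_ε(q,p) < 1/2}`. -/
def Ueps {n : ℕ} (V : Set (E n)) (h : E n → ℝ) (ε : ℝ) : Set (P n) :=
  {z : P n | z.1 ∈ V ∧ Heps h ε z < 1 / 2}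

theorem exists_global_integralCurve {F : Type*} [NormedAddCommGroup F] [NormedSpace ℝ F]
    [FiniteDimensional ℝ F] {v : F → F} (hv : ContDiff ℝ 1 v) {C : ℝ}
    (hC : ∀ x, ‖v x‖ ≤ C * (1 + ‖x‖)) (x : F) :
    ∃ γ : ℝ → F, γ 0 = x ∧ ∀ t, HasDerivAt γ (v (γ t)) t := by
  have : CompleteSpace F := FiniteDimensional.complete ℝ F
  have hC0 : 0 ≤ C := by
    have := (norm_nonneg _).trans (hC 0)
    simpa using this
  obtain ⟨ε, hε, hεC⟩ : ∃ ε : ℝ, 0 < ε ∧ 2 * C * ε ≤ 1 :=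
    ⟨1 / (2 * (C + 1)), by positivity, by
      rw [mul_one_div, div_le_one (by positivity)]; linarith⟩
  have hloc : ∀ y : F, ∃ γ : ℝ → F, γ 0 = y ∧
      ∀ t ∈ Set.Ioo (-ε) ε, HasDerivAt γ (v (γ t)) t := by
    intro y
    obtain ⟨K, hlip⟩ := hv.contDiffOn.exists_lipschitzOnWith one_ne_zero
      (convex_closedBall y (1 + ‖y‖)) (isCompact_closedBall y (1 + ‖y‖))
    have hb : ∀ z ∈ Metric.closedBall y ((1 + ‖y‖).toNNReal : ℝ),
        ‖v z‖ ≤ ((2 * C * (1 + ‖y‖)).toNNReal : ℝ) := by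
      intro z hz
      rw [Real.coe_toNNReal _ (by positivity)] at hz ⊢
      have h1 : ‖z‖ ≤ ‖y‖ + (1 + ‖y‖) := norm_le_of_mem_closedBall hz
      calc ‖v z‖ ≤ C * (1 + ‖z‖) := hC z
        _ ≤ C * (1 + (‖y‖ + (1 + ‖y‖))) := by gcongr
        _ = 2 * C * (1 + ‖y‖) := by ring
    have hpl : IsPicardLindelof (fun _ => v) (tmin := -ε) (tmax := ε)
        ⟨0, by constructor <;> linarith⟩ y (1 + ‖y‖).toNNReal 0
        (2 * C * (1 + ‖y‖)).toNNReal K := by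
      refine IsPicardLindelof.of_time_independent hb ?_ ?_
      · rwa [Real.coe_toNNReal _ (by positivity)]
      · rw [Real.coe_toNNReal _ (by positivity), Real.coe_toNNReal _ (by positivity)]
        have := mul_le_mul_of_nonneg_right hεC (show 0 ≤ 1 + ‖y‖ by positivity)
        simp
        linarith
    obtain ⟨γ, h0, hγ⟩ := hpl.exists_eq_forall_mem_Icc_hasDerivWithinAt₀
    exact ⟨γ, h0, fun t ht =>
      (hγ t (Set.Ioo_subset_Icc_self ht)).hasDerivAt (Icc_mem_nhds ht.1 ht.2)⟩
  obtain ⟨γ, h0, hγ⟩ := exists_isMIntegralCurve_of_isMIntegralCurveOn (I := modelWithCornersSelf ℝ F)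
    (v := v) (contMDiff_vectorSpace_iff_contDiff.2 hv) hε
    (fun y => (hloc y).imp fun γ h =>
      ⟨h.1, fun t ht => (h.2 t ht).hasFDerivAt.hasMFDerivAt.hasMFDerivWithinAt⟩) x
  exact ⟨γ, h0, fun t => hasDerivAt_iff_hasFDerivAt.2 (hγ t).hasFDerivAt⟩

theorem integralCurve_unique {F : Type*} [NormedAddCommGroup F] [NormedSpace ℝ F]
    [CompleteSpace F] {v : F → F} (hv : ContDiff ℝ 1 v) {γ γ' : ℝ → F} {t₀ : ℝ}
    (hγ : ∀ t, HasDerivAt γ (v (γ t)) t) (hγ' : ∀ t, HasDerivAt γ' (v (γ' t)) t)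
    (h : γ t₀ = γ' t₀) : γ = γ' :=
  isMIntegralCurve_Ioo_eq_of_contMDiff_boundaryless (I := modelWithCornersSelf ℝ F)
    (v := v) (contMDiff_vectorSpace_iff_contDiff.2 hv)
    (fun t => (hγ t).hasFDerivAt.hasMFDerivAt) (fun t => (hγ' t).hasFDerivAt.hasMFDerivAt) h

theorem inner_gradient_inner {n : ℕ} {Z : E n → E n} (hZ : Differentiable ℝ Z) (p q v : E n) :
    ⟪gradient (fun q' => ⟪p, Z q'⟫) q, v⟫ = ⟪p, fderiv ℝ Z q v⟫ := by
  rw [gradient, InnerProductSpace.toDual_symm_apply,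
    fderiv_inner_apply ℝ (differentiableAt_const p) (hZ q)]
  simp

theorem norm_fderiv_le_half {n : ℕ} {Z : E n → E n} (hZ : Differentiable ℝ Z)
    (hDZ : ∀ (q : E n) (i j : Fin n),
      |fderiv ℝ (fun q' => Z q' j) q (EuclideanSpace.single i 1)| ≤ 1 / (2 * (n : ℝ)))
    (q v : E n) : ‖fderiv ℝ Z q v‖ ≤ 1 / 2 * ‖v‖ := by
  have hcoord : ∀ j, fderiv ℝ Z q v j =
      ∑ i, v i * fderiv ℝ (fun q' => Z q' j) q (EuclideanSpace.single i 1) := by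
    intro j
    have h1 : fderiv ℝ (fun q' => Z q' j) q =
        (EuclideanSpace.proj j : E n →L[ℝ] ℝ).comp (fderiv ℝ Z q) :=
      ((EuclideanSpace.proj j : E n →L[ℝ] ℝ).hasFDerivAt.comp q (hZ q).hasFDerivAt).fderiv
    have h2 : v = ∑ i, v i • EuclideanSpace.single i (1 : ℝ) := by
      simpa using ((EuclideanSpace.basisFun (Fin n) ℝ).sum_repr v).symm
    have h3 : fderiv ℝ Z q v j = fderiv ℝ (fun q' => Z q' j) q v := by rw [h1]; rfl
    rw [h3]
    conv_lhs => rw [h2]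
    simp
  have hsq : ∀ j, ‖fderiv ℝ Z q v j‖ ^ 2 ≤ (1 / (2 * (n : ℝ))) ^ 2 * (n * ‖v‖ ^ 2) := by
    intro j
    have h1 : ‖fderiv ℝ Z q v j‖ ≤ 1 / (2 * (n : ℝ)) * ∑ i, |v i| := by
      rw [hcoord, Finset.mul_sum]
      refine (norm_sum_le _ _).trans (Finset.sum_le_sum fun i _ => ?_)
      rw [norm_mul, mul_comm]
      exact mul_le_mul_of_nonneg_right (hDZ q i j) (norm_nonneg _)
    have h2 : (∑ i, |v i|) ^ 2 ≤ n * ‖v‖ ^ 2 := by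
      have := sq_sum_le_card_mul_sum_sq (s := Finset.univ) (f := fun i => |v i|)
      simpa [EuclideanSpace.norm_sq_eq] using this
    calc ‖fderiv ℝ Z q v j‖ ^ 2 ≤ (1 / (2 * (n : ℝ)) * ∑ i, |v i|) ^ 2 := by gcongr
      _ = (1 / (2 * (n : ℝ))) ^ 2 * (∑ i, |v i|) ^ 2 := by ring
      _ ≤ _ := by gcongr
  refine le_of_sq_le_sq ?_ (by positivity)
  rw [EuclideanSpace.norm_sq_eq]
  refine (Finset.sum_le_sum fun j _ => hsq j).trans ?_
  rcases Nat.eq_zero_or_pos n with rfl | hn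
  · simp
  · have : (0 : ℝ) < n := by exact_mod_cast hn
    apply le_of_eq
    simp
    field_simp

theorem norm_gradient_inner_le {n : ℕ} {Z : E n → E n} (hZ : Differentiable ℝ Z)
    (hDZ : ∀ q v, ‖fderiv ℝ Z q v‖ ≤ 1 / 2 * ‖v‖) (p q : E n) :
    ‖gradient (fun q' => ⟪p, Z q'⟫) q‖ ≤ 1 / 2 * ‖p‖ := by
  set g := gradient (fun q' => ⟪p, Z q'⟫) q with hg
  have h1 : ‖g‖ * ‖g‖ ≤ (1 / 2 * ‖p‖) * ‖g‖ := by
    rw [← real_inner_self_eq_norm_mul_norm, hg, inner_gradient_inner hZ, ← hg]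
    calc ⟪p, fderiv ℝ Z q g⟫ ≤ ‖p‖ * ‖fderiv ℝ Z q g‖ := real_inner_le_norm _ _
      _ ≤ ‖p‖ * (1 / 2 * ‖g‖) := by gcongr; exact hDZ q g
      _ = _ := by ring
  rcases (norm_nonneg g).eq_or_lt with h0 | h0
  · rw [← h0]; positivity
  · exact le_of_mul_le_mul_right h1 h0

theorem half_sq_le_inner_Zbar {n : ℕ} {Z : E n → E n} (hZ : Differentiable ℝ Z)
    (hDZ : ∀ q v, ‖fderiv ℝ Z q v‖ ≤ 1 / 2 * ‖v‖) (z : P n) :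
    1 / 2 * ‖z.2‖ ^ 2 ≤ ⟪z.2, (Zbar Z z).2⟫ := by
  have h1 := real_inner_le_norm z.2 (gradient (fun q' => ⟪z.2, Z q'⟫) z.1)
  have h2 := mul_le_mul_of_nonneg_left (norm_gradient_inner_le hZ hDZ z.2 z.1) (norm_nonneg z.2)
  simp only [Zbar, inner_sub_right, real_inner_self_eq_norm_sq]
  linarith

theorem contDiff_Zbar {n : ℕ} {Z : E n → E n} (hZ : ContDiff ℝ (⊤ : ℕ∞) Z) :
    ContDiff ℝ 1 (Zbar Z) := by
  have hd : Differentiable ℝ Z := hZ.differentiable (by simp)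
  refine (hZ.of_le (by exact_mod_cast le_top)).comp contDiff_fst |>.prodMk
    (contDiff_snd.sub (contDiff_euclidean.2 fun i => ?_))
  have h1 : (fun z : P n => gradient (fun q => ⟪z.2, Z q⟫) z.1 i) =
      fun z => ⟪z.2, fderiv ℝ Z z.1 (EuclideanSpace.single i 1)⟫ := by
    funext z
    rw [← inner_gradient_inner hd, EuclideanSpace.inner_single_right]
    simp
  rw [h1]
  have h2 : ContDiff ℝ 1 (fderiv ℝ Z) := hZ.fderiv_right (m := 1) (by norm_cast)
  exact contDiff_snd.inner ℝ ((h2.comp contDiff_fst).clm_apply contDiff_const)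

theorem exists_flow_Zbar {n : ℕ} {Z : E n → E n} (hZ : ContDiff ℝ (⊤ : ℕ∞) Z)
    (hZs : HasCompactSupport Z) (hDZ : ∀ q v, ‖fderiv ℝ Z q v‖ ≤ 1 / 2 * ‖v‖) :
    ∃ φ : ℝ → P n → P n, (∀ z, φ 0 z = z) ∧
      ∀ t z, HasDerivAt (fun t' => φ t' z) (Zbar Z (φ t z)) t := by
  obtain ⟨M, hM⟩ := hZs.exists_bound_of_continuous hZ.continuous
  have hM0 : 0 ≤ M := (norm_nonneg _).trans (hM 0)
  have hgrowth : ∀ z : P n, ‖Zbar Z z‖ ≤ (M + 3 / 2) * (1 + ‖z‖) := by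
    intro z
    have h1 := norm_gradient_inner_le (hZ.differentiable (by simp)) hDZ z.2 z.1
    have h2 : ‖z.2‖ ≤ ‖z‖ := norm_snd_le z
    have h3 := mul_nonneg hM0 (norm_nonneg z)
    refine max_le ?_ ?_
    · have := hM z.1
      simp only [Zbar]
      nlinarith [norm_nonneg z]
    · refine (norm_sub_le _ _).trans ?_
      nlinarith [norm_nonneg z]
  choose γ h0 hγ using exists_global_integralCurve (contDiff_Zbar hZ) hgrowth
  exact ⟨fun t z => γ z t, h0, fun t z => hγ z t⟩

theorem ball_infDist_frontier_subset {F : Type*} [NormedAddCommGroup F] [NormedSpace ℝ F]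
    {V : Set F} (hV : IsOpen V) {q : F} (hq : q ∈ V) :
    Metric.ball q (Metric.infDist q (frontier V)) ⊆ V := by
  rcases (Metric.infDist_nonneg (x := q) (s := frontier V)).eq_or_lt with h0 | h0
  · simp [← h0]
  refine (convex_ball q _).isPreconnected.subset_of_closure_inter_subset hV
    ⟨q, Metric.mem_ball_self h0, hq⟩ fun x hx => ?_
  by_contra hxV
  have hxfr : x ∈ frontier V := by rw [hV.frontier_eq]; exact ⟨hx.1, hxV⟩
  have h1 := Metric.infDist_le_dist_of_mem (x := q) hxfr
  have h2 := Metric.mem_ball'.1 hx.2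
  linarith

theorem fderiv_nonpos_of_neg_on_ball {F : Type*} [NormedAddCommGroup F] [InnerProductSpace ℝ F]
    {f : F → ℝ} (hf : Differentiable ℝ f) {q y v : F} (hqy : q ≠ y)
    (hball : ∀ x ∈ Metric.ball q ‖q - y‖, f x < 0) (hy : f y = 0) (hv : 0 ≤ ⟪v, q - y⟫) :
    fderiv ℝ f y v ≤ 0 := by
  set w := q - y with hw
  have hw0 : 0 < ‖w‖ := norm_pos_iff.2 (sub_ne_zero.2 hqy)
  have hle : ∀ x ∈ Metric.closedBall q ‖w‖, f x ≤ 0 := by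
    intro x hx
    rw [← closure_ball q hw0.ne'] at hx
    exact closure_minimal (fun x hx => (hball x hx).le)
      (isClosed_le hf.continuous continuous_const) hx
  have hymem : y ∈ Metric.closedBall q ‖w‖ := by
    rw [Metric.mem_closedBall', dist_eq_norm]
  have hmax : IsLocalMaxOn f (Metric.closedBall q ‖w‖) y := by
    refine Filter.eventually_of_mem self_mem_nhdsWithin fun x hx => ?_
    rw [hy]; exact hle x hx
  have hstrict : ∀ u : F, 0 < ⟪u, w⟫ → fderiv ℝ f y u ≤ 0 := by
    intro u hu
    set t : ℝ := ⟪u, w⟫ / (‖u‖ ^ 2 + 1) with ht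
    have ht0 : 0 < t := by positivity
    have htu : t * ‖u‖ ^ 2 ≤ 2 * ⟪u, w⟫ := by
      have : t * (‖u‖ ^ 2 + 1) = ⟪u, w⟫ := by rw [ht]; field_simp
      nlinarith
    have hmem : y + t • u ∈ Metric.closedBall q ‖w‖ := by
      rw [Metric.mem_closedBall', dist_eq_norm,
        show q - (y + t • u) = w - t • u by rw [hw]; abel]
      refine le_of_sq_le_sq ?_ (norm_nonneg _)
      rw [norm_sub_sq_real, norm_smul, real_inner_smul_right, real_inner_comm, mul_pow,
        Real.norm_of_nonneg ht0.le]
      nlinarith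
    have hcone := mem_posTangentConeAt_of_segment_subset
      ((convex_closedBall q ‖w‖).segment_subset hymem hmem)
    have := hmax.hasFDerivWithinAt_nonpos (hf y).hasFDerivAt.hasFDerivWithinAt hcone
    rw [map_smul, smul_eq_mul] at this
    exact nonpos_of_mul_nonpos_right this ht0
  have hlim : Tendsto (fun s : ℝ => fderiv ℝ f y v + s * fderiv ℝ f y w)
      (nhdsWithin 0 (Set.Ioi 0)) (nhds (fderiv ℝ f y v)) := by
    have : Continuous fun s : ℝ => fderiv ℝ f y v + s * fderiv ℝ f y w := by fun_prop
    simpa using (this.tendsto 0).mono_left nhdsWithin_le_nhds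
  refine le_of_tendsto hlim (eventually_of_mem self_mem_nhdsWithin fun s hs => ?_)
  have hs0 : (0 : ℝ) < s := hs
  have := hstrict (v + s • w) (by
    rw [inner_add_left, real_inner_smul_left, real_inner_self_eq_norm_sq]
    positivity)
  simpa using this

theorem fderiv_eq_of_eq_inv_sq_infDist {F : Type*} [NormedAddCommGroup F]
    [InnerProductSpace ℝ F] {S : Set F} {h : F → ℝ} {q y : F} (hy : y ∈ S) (hqy : q ≠ y)
    (hdist : Metric.infDist q S = dist q y) (hh : DifferentiableAt ℝ h q)
    (heq : ∀ᶠ x in nhds q, 0 < Metric.infDist x S ∧ h x = 1 / Metric.infDist x S ^ 2) (v : F) :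
    fderiv ℝ h q v = -(2 * ⟪q - y, v⟫) / ‖q - y‖ ^ 4 := by
  have hw0 : 0 < ‖q - y‖ := norm_pos_iff.2 (sub_ne_zero.2 hqy)
  have hsq : HasFDerivAt (fun x : F => ‖x - y‖ ^ 2) (2 • innerSL ℝ (q - y)) q := by
    simpa using ((hasFDerivAt_id q).sub_const y).norm_sq
  have hk := (hasDerivAt_inv (by positivity : ‖q - y‖ ^ 2 ≠ 0)).comp_hasFDerivAt q hsq
  have hmin : IsLocalMin (fun x => h x - (‖x - y‖ ^ 2)⁻¹) q := by
    filter_upwards [heq] with x hx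
    have h1 : h q = (‖q - y‖ ^ 2)⁻¹ := by
      rw [heq.self_of_nhds.2, hdist, dist_eq_norm, one_div]
    have h2 : Metric.infDist x S ≤ ‖x - y‖ := by
      rw [← dist_eq_norm]; exact Metric.infDist_le_dist_of_mem hy
    have h3 : (‖x - y‖ ^ 2)⁻¹ ≤ h x := by
      rw [hx.2, one_div]
      have := hx.1
      gcongr
    rw [h1]
    linarith
  have hz := hmin.hasFDerivAt_eq_zero (hh.hasFDerivAt.sub hk)
  rw [sub_eq_zero.1 hz]
  simp [inner_sub_left]
  field_simp

theorem exists_bound_of_le_infDist {n : ℕ} {V : Set (E n)} (hV : IsOpen V)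
    (hVbdd : Bornology.IsBounded V) {h : E n → ℝ} (hh : ContinuousOn h V) {δ : ℝ} (hδ : 0 < δ)
    (hhdist : ∀ q ∈ V, Metric.infDist q (frontier V) < δ →
      h q = 1 / Metric.infDist q (frontier V) ^ 2) :
    ∃ C, 0 ≤ C ∧ ∀ q ∈ V, ∀ s > 0, s ≤ Metric.infDist q (frontier V) → h q ≤ C + 1 / s ^ 2 := by
  have hK : IsCompact (closure V ∩ {q | δ ≤ Metric.infDist q (frontier V)}) :=
    hVbdd.isCompact_closure.inter_right
      (isClosed_le continuous_const (Metric.continuous_infDist_pt _))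
  have hKV : closure V ∩ {q | δ ≤ Metric.infDist q (frontier V)} ⊆ V := by
    rintro q ⟨hq, hqδ⟩
    by_contra hqV
    have : q ∈ frontier V := by rw [hV.frontier_eq]; exact ⟨hq, hqV⟩
    rw [Set.mem_ofPred, Metric.infDist_zero_of_mem this] at hqδ
    linarith
  obtain ⟨C, hC⟩ := hK.exists_bound_of_continuousOn (hh.mono hKV)
  refine ⟨max C 0, le_max_right _ _, fun q hq s hs hsq => ?_⟩
  by_cases hqδ : Metric.infDist q (frontier V) < δ
  · rw [hhdist q hq hqδ]
    have : 1 / Metric.infDist q (frontier V) ^ 2 ≤ 1 / s ^ 2 := by gcongr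
    linarith [le_max_right C 0]
  · have h1 := hC q ⟨subset_closure hq, not_lt.1 hqδ⟩
    have h2 : 0 < 1 / s ^ 2 := by positivity
    linarith [le_max_left C 0, Real.le_norm_self (h q)]

theorem exists_collar_fderiv_pos {n : ℕ} {V : Set (E n)} (hVbdd : Bornology.IsBounded V)
    {f : E n → ℝ} (hf : ContDiff ℝ 1 f) (hVf : V = {x | f x < 0})
    (hfr : frontier V = {x | f x = 0}) {h : E n → ℝ} (hh : DifferentiableOn ℝ h V)
    (hhpos : ∀ q ∈ V, 0 < h q) {δ : ℝ} (hδ : 0 < δ)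
    (hhdist : ∀ q ∈ V, Metric.infDist q (frontier V) < δ →
      h q = 1 / Metric.infDist q (frontier V) ^ 2)
    {Z : E n → E n} (hZ : Continuous Z) (hZout : ∀ q ∈ frontier V, 0 < fderiv ℝ f q (Z q)) :
    ∃ s > 0, ∀ q ∈ V, Metric.infDist q (frontier V) < s → 0 < fderiv ℝ h q (Z q) := by
  have hfd : Differentiable ℝ f := hf.differentiable one_ne_zero
  have hV : IsOpen V := hVf ▸ isOpen_lt hf.continuous continuous_const
  have hne : (frontier V).Nonempty ∨ V = ∅ := by
    by_contra! hcon
    obtain ⟨hfr0, hVne⟩ := hcon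
    obtain ⟨q, hq⟩ := hVne
    have h1 := hhdist q hq (by simpa [hfr0] using hδ)
    have h2 := hhpos q hq
    simp [hfr0] at h1
    linarith
  rcases hne with hne | hVe
  swap
  · exact ⟨1, one_pos, fun q hq => by simp [hVe] at hq⟩
  have hcl : IsCompact (closure V ×ˢ frontier V) :=
    hVbdd.isCompact_closure.prod
      (hVbdd.isCompact_closure.of_isClosed_subset isClosed_frontier frontier_subset_closure)
  have hcont : Continuous fun x : E n × E n => max (dist x.1 x.2) (fderiv ℝ f x.2 (Z x.1)) := by
    have := hf.continuous_fderiv one_ne_zero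
    fun_prop
  obtain ⟨m, hm0, hm⟩ := hcl.exists_forall_le' (a := 0) hcont.continuousOn (by
    rintro ⟨x, y⟩ ⟨-, hy⟩
    rcases eq_or_ne x y with rfl | hxy
    · exact lt_max_of_lt_right (hZout x hy)
    · exact lt_max_of_lt_left (dist_pos.2 hxy))
  refine ⟨min m δ, lt_min hm0 hδ, fun q hq hqs => ?_⟩
  obtain ⟨y, hy, hdist⟩ := isClosed_frontier.exists_infDist_eq_dist hne q
  have hqy : q ≠ y := by
    rintro rfl
    rw [hV.frontier_eq] at hy
    exact hy.2 hq
  have hDf : 0 < fderiv ℝ f y (Z q) := by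
    have h1 := hm (q, y) ⟨subset_closure hq, hy⟩
    rcases le_max_iff.1 h1 with h2 | h2
    · have := hqs.trans_le (min_le_left _ _)
      simp only at h2
      linarith
    · exact hm0.trans_le h2
  have hneg : ⟪Z q, q - y⟫ < 0 := by
    by_contra! hcon
    refine absurd (fderiv_nonpos_of_neg_on_ball hfd hqy (fun x hx => ?_) ?_ hcon) (not_le.2 hDf)
    · rw [← dist_eq_norm, ← hdist] at hx
      have := ball_infDist_frontier_subset hV hq hx
      rwa [hVf] at this
    · rwa [hfr] at hy
  rw [fderiv_eq_of_eq_inv_sq_infDist hy hqy hdist (hh.differentiableAt (hV.mem_nhds hq))]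
  · have hw0 : 0 < ‖q - y‖ := norm_pos_iff.2 (sub_ne_zero.2 hqy)
    rw [real_inner_comm]
    have : 0 < -(2 * ⟪Z q, q - y⟫) := by linarith
    positivity
  · filter_upwards [hV.mem_nhds hq, (Metric.continuous_infDist_pt (frontier V)).tendsto q
      |>.eventually_lt_const (hqs.trans_le (min_le_right _ _))] with x hx hxδ
    refine ⟨?_, hhdist x hx hxδ⟩
    refine (isClosed_frontier.notMem_iff_infDist_pos hne).1 fun hxfr => ?_
    rw [hV.frontier_eq] at hxfr
    exact hxfr.2 hx

theorem exists_linear_escape {n : ℕ} {V : Set (E n)} (hVbdd : Bornology.IsBounded V)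
    {f : E n → ℝ} (hf : ContDiff ℝ 1 f) (hVf : V = {x | f x < 0})
    (hfr : frontier V = {x | f x = 0}) (hne : (frontier V).Nonempty)
    {Z : E n → E n} (hZ : Continuous Z) (hZout : ∀ q ∈ frontier V, 0 < fderiv ℝ f q (Z q)) :
    ∃ c > 0, ∀ γ : ℝ → E n, (∀ t, HasDerivAt γ (-Z (γ t)) t) → γ 0 ∈ V →
      ∀ t ∈ Set.Ioc (0 : ℝ) 1, γ t ∈ V ∧ c * t ≤ Metric.infDist (γ t) (frontier V) := by
  have hfd : Differentiable ℝ f := hf.differentiable one_ne_zero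
  have hcl : ∀ x, f x ≤ 0 → x ∈ closure V := by
    intro x hx
    rw [closure_eq_self_union_frontier, hfr]
    rcases hx.lt_or_eq with hx | hx
    · exact Or.inl (by rwa [hVf])
    · exact Or.inr hx
  have hcont : Continuous fun x => max (-f x) (fderiv ℝ f x (Z x)) := by
    have := hf.continuous_fderiv one_ne_zero
    have := hf.continuous
    fun_prop
  obtain ⟨m, hm0, hm⟩ := hVbdd.isCompact_closure.exists_forall_le' (a := 0) hcont.continuousOn (by
    intro x hx
    rw [closure_eq_self_union_frontier] at hx
    rcases hx with hx | hx
    · rw [hVf, Set.mem_ofPred] at hx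
      exact lt_max_of_lt_left (by linarith)
    · exact lt_max_of_lt_right (hZout x hx))
  obtain ⟨R, hR⟩ := hVbdd.closure.subset_closedBall (0 : E n)
  obtain ⟨K, hK⟩ := hf.contDiffOn.exists_lipschitzOnWith one_ne_zero
    (convex_closedBall (0 : E n) R) (isCompact_closedBall _ _)
  refine ⟨m / 2 / (K + 1), by positivity, fun γ hγ h0 t ht => ?_⟩
  have hder : ∀ s, HasDerivAt (fun s => f (γ s)) (-fderiv ℝ f (γ s) (Z (γ s))) s := by
    intro s
    rw [← map_neg]
    exact (hfd (γ s)).hasFDerivAt.comp_hasDerivAt s (hγ s)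
  have hbar : f (γ t) ≤ -(m / 2) * t := by
    refine image_le_of_deriv_right_lt_deriv_boundary (a := 0) (b := 1) (f := fun s => f (γ s))
      (B := fun s => -(m / 2) * s) (B' := fun _ => -(m / 2))
      (fun s _ => (hder s).continuousAt.continuousWithinAt)
      (fun s _ => (hder s).hasDerivWithinAt) ?_
      (fun s => by simpa using (hasDerivAt_id s).const_mul (-(m / 2))) (fun s hs heq => ?_)
      ⟨ht.1.le, ht.2⟩
    · rw [hVf] at h0
      simpa using le_of_lt h0
    · have hs1 : m / 2 * s < m := by nlinarith [hs.1, hs.2]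
      have hs0 : 0 ≤ m / 2 * s := mul_nonneg (by positivity) hs.1
      have h1 := hm (γ s) (hcl _ (by linarith))
      rcases le_max_iff.1 h1 with h2 | h2 <;> linarith
  have hfneg : f (γ t) < 0 := by
    have : 0 < m / 2 * t := mul_pos (by positivity) ht.1
    linarith
  refine ⟨by rwa [hVf], ?_⟩
  obtain ⟨y, hy, hdist⟩ := isClosed_frontier.exists_infDist_eq_dist hne (γ t)
  have h1 := hK.dist_le_mul _ (hR (hcl _ hfneg.le)) _ (hR (frontier_subset_closure hy))
  have hy0 : f y = 0 := by rwa [hfr] at hy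
  rw [hy0, Real.dist_eq, sub_zero, abs_of_neg hfneg] at h1
  rw [hdist, div_mul_eq_mul_div, div_le_iff₀ (by positivity)]
  nlinarith [dist_nonneg (x := γ t) (y := y)]

theorem norm_sq_le_exp_neg {n : ℕ} {Z : E n → E n} (hZ : Differentiable ℝ Z)
    (hDZ : ∀ q v, ‖fderiv ℝ Z q v‖ ≤ 1 / 2 * ‖v‖) {γ : ℝ → P n}
    (hγ : ∀ t, HasDerivAt γ (-Zbar Z (γ t)) t) {t : ℝ} (ht : 0 ≤ t) :
    ‖(γ t).2‖ ^ 2 ≤ Real.exp (-t) * ‖(γ 0).2‖ ^ 2 := by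
  have hder : ∀ s, HasDerivAt (fun s => Real.exp s * ‖(γ s).2‖ ^ 2)
      (Real.exp s * ‖(γ s).2‖ ^ 2 + Real.exp s * (2 * ⟪(γ s).2, (-Zbar Z (γ s)).2⟫)) s :=
    fun s => (Real.hasDerivAt_exp s).mul (HasDerivAt.norm_sq
      ((ContinuousLinearMap.snd ℝ (E n) (E n)).hasFDerivAt.comp_hasDerivAt s (hγ s)))
  have hanti : Antitone fun s => Real.exp s * ‖(γ s).2‖ ^ 2 := by
    refine antitone_of_hasDerivAt_nonpos hder fun s => ?_
    have h1 := half_sq_le_inner_Zbar hZ hDZ (γ s)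
    rw [← mul_add, Prod.snd_neg, inner_neg_right]
    exact mul_nonpos_of_nonneg_of_nonpos (Real.exp_pos s).le (by linarith)
  have := hanti ht
  simp only [Real.exp_zero, one_mul] at this
  calc ‖(γ t).2‖ ^ 2 = Real.exp (-t) * (Real.exp t * ‖(γ t).2‖ ^ 2) := by
        rw [← mul_assoc, ← Real.exp_add]; simp
    _ ≤ _ := by gcongr

theorem fderiv_Heps {n : ℕ} {h : E n → ℝ} {z : P n} (hh : DifferentiableAt ℝ h z.1) (ε : ℝ)
    (w : P n) : fderiv ℝ (Heps h ε) z w = ⟪z.2, w.2⟫ + ε * fderiv ℝ h z.1 w.1 := by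
  have h1 : HasFDerivAt (Heps h ε) _ z :=
    ((hasFDerivAt_snd (𝕜 := ℝ) (p := z)).norm_sq.mul_const (1 / 2 : ℝ)).add
      ((hh.hasFDerivAt.comp z hasFDerivAt_fst).const_mul ε) |>.congr_of_eventuallyEq
      (.of_forall fun x => by simp [Heps]; ring)
  rw [h1.fderiv]
  simp

/-- Lemma 6.5. -/
theorem stmt9 (n : ℕ) (V : Set (E n)) (hVconn : IsConnected V)
    (hVbdd : Bornology.IsBounded V)
    -- smooth boundary, via a global defining function
    (f : E n → ℝ) (hf : ContDiff ℝ (⊤ : ℕ∞) f)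
    (hVf : V = {x | f x < 0}) (hfr : frontier V = {x | f x = 0})
    (hreg : ∀ x ∈ frontier V, gradient f x ≠ 0)
    -- the function h
    (h : E n → ℝ) (hh : ContDiffOn ℝ (⊤ : ℕ∞) h V) (hhpos : ∀ q ∈ V, 0 < h q)
    (hhdist : ∃ δ > (0 : ℝ), ∀ q ∈ V, Metric.infDist q (frontier V) < δ →
      h q = 1 / Metric.infDist q (frontier V) ^ 2)
    -- the vector field Z
    (Z : E n → E n) (hZsmooth : ContDiff ℝ (⊤ : ℕ∞) Z) (hZsupp : HasCompactSupport Z)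
    (hZout : ∀ q ∈ frontier V, 0 < ⟪Z q, gradient f q⟫)
    (hdhZ : ∀ q ∈ V, 0 ≤ fderiv ℝ h q (Z q))
    (hDZ : ∀ (q : E n) (i j : Fin n),
      |fderiv ℝ (fun q' => Z q' j) q (EuclideanSpace.single i 1)| ≤ 1 / (2 * (n : ℝ))) :
    -- (i): for small ε, dH_ε(Z̄) > 0 on the level set {H_ε = 1/2}
    (∃ ε₀ > (0 : ℝ), ∀ ε ∈ Set.Ioo (0 : ℝ) ε₀, ∀ z : P n, z.1 ∈ V →
      Heps h ε z = 1 / 2 →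
      0 < fderiv ℝ (Heps h ε) z (Zbar Z z)) ∧
    -- (ii): Z̄ generates a global flow φ, and φ_{T_ε}(U_ε⁻) ⊇ D*V with T_ε → 0
    (∃ φ : ℝ → P n → P n,
      (∀ z, φ 0 z = z) ∧
      (∀ t z, HasDerivAt (fun t' => φ t' z) (Zbar Z (φ t z)) t) ∧
      ∃ ε₀ > (0 : ℝ), ∃ T : ℝ → ℝ,
        (∀ ε ∈ Set.Ioo (0 : ℝ) ε₀, 0 < T ε ∧
          DiscBundle V ⊆ φ (T ε) '' Ueps V h ε) ∧
        Tendsto T (nhdsWithin 0 (Set.Ioi 0)) (nhds 0)) := by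
  obtain ⟨δ, hδ, hhdist⟩ := hhdist
  have hf1 : ContDiff ℝ 1 f := hf.of_le (by exact_mod_cast le_top)
  have hV : IsOpen V := hVf ▸ isOpen_lt hf.continuous continuous_const
  have hZd : Differentiable ℝ Z := hZsmooth.differentiable (by simp)
  have hhd : DifferentiableOn ℝ h V := hh.differentiableOn (by simp)
  have hDZ' := norm_fderiv_le_half hZd hDZ
  have hout : ∀ q ∈ frontier V, 0 < fderiv ℝ f q (Z q) := by
    intro q hq
    have := hZout q hq
    rwa [real_inner_comm, gradient, InnerProductSpace.toDual_symm_apply] at this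
  have hne : (frontier V).Nonempty := by
    by_contra! hcon
    obtain ⟨q, hq⟩ := hVconn.nonempty
    have h1 := hhdist q hq (by simpa [hcon] using hδ)
    have h2 := hhpos q hq
    simp [hcon] at h1
    linarith
  obtain ⟨C, hC0, hC⟩ := exists_bound_of_le_infDist hV hVbdd hh.continuousOn hδ hhdist
  constructor
  · obtain ⟨s, hs, hcollar⟩ := exists_collar_fderiv_pos hVbdd hf1 hVf hfr hhd hhpos hδ hhdist
      hZsmooth.continuous hout
    refine ⟨1 / (2 * (C + 1 / s ^ 2)), by positivity, fun ε hε z hz hlevel => ?_⟩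
    rw [fderiv_Heps (hhd.differentiableAt (hV.mem_nhds hz))]
    have h1 := half_sq_le_inner_Zbar hZd hDZ' z
    have h2 : 0 ≤ ε * fderiv ℝ h z.1 (Zbar Z z).1 := mul_nonneg hε.1.le (hdhZ z.1 hz)
    rcases eq_or_ne z.2 0 with hp | hp
    · have hlt : Metric.infDist z.1 (frontier V) < s := by
        by_contra! hcon
        have h3 := mul_le_mul_of_nonneg_left (hC z.1 hz s hs hcon) hε.1.le
        have h4 := (lt_div_iff₀ (by positivity)).1 hε.2
        simp only [Heps, hp, norm_zero] at hlevel
        linarith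
      have h3 : 0 < ε * fderiv ℝ h z.1 (Zbar Z z).1 := mul_pos hε.1 (hcollar z.1 hz hlt)
      have h4 := sq_nonneg ‖z.2‖
      linarith
    · have h3 : 0 < ‖z.2‖ ^ 2 := by have := norm_pos_iff.2 hp; positivity
      linarith
  · obtain ⟨φ, hφ0, hφ⟩ := exists_flow_Zbar hZsmooth hZsupp hDZ'
    obtain ⟨c, hc, hesc⟩ := exists_linear_escape hVbdd hf1 hVf hfr hne hZsmooth.continuous hout
    set T₀ : ℝ := 1 / (4 * (C + 1 / c ^ 2) + 1) with hT₀
    have hA : 0 < C + 1 / c ^ 2 := by positivity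
    have hT₀pos : 0 < T₀ := by positivity
    refine ⟨φ, hφ0, hφ, T₀ ^ 4, by positivity, fun ε => √(√ε), fun ε hε => ?_, ?_⟩
    · have hTpos : 0 < √(√ε) := Real.sqrt_pos.2 (Real.sqrt_pos.2 hε.1)
      set T := √(√ε) with hT
      refine ⟨hTpos, fun z hz => ⟨φ (-T) z, ?_, ?_⟩⟩
      · have hεT : ε = T ^ 4 := by
          rw [hT, show (√(√ε)) ^ 4 = ((√(√ε)) ^ 2) ^ 2 by ring, Real.sq_sqrt (Real.sqrt_nonneg _),
            Real.sq_sqrt hε.1.le]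
        have hTT₀ : T < T₀ := lt_of_pow_lt_pow_left₀ 4 hT₀pos.le (hεT ▸ hε.2)
        have hT1 : T * (4 * (C + 1 / c ^ 2) + 1) < 1 := by
          rwa [hT₀, lt_div_iff₀ (by positivity)] at hTT₀
        have hTle : T ≤ 1 := by nlinarith
        have hback : ∀ t, HasDerivAt (fun t => φ (-t) z) (-Zbar Z (φ (-t) z)) t := by
          intro t
          have := (hφ (-t) z).scomp t (hasDerivAt_neg t)
          rwa [neg_one_smul] at this
        have hbackq : ∀ t, HasDerivAt (fun t => (φ (-t) z).1) (-Z (φ (-t) z).1) t := fun t =>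
          (ContinuousLinearMap.fst ℝ (E n) (E n)).hasFDerivAt.comp_hasDerivAt t (hback t)
        obtain ⟨hmem, hdist⟩ := hesc _ hbackq (by simpa [hφ0] using hz.1) T ⟨hTpos, hTle⟩
        have hp := norm_sq_le_exp_neg hZd hDZ' hback hTpos.le
        rw [neg_zero, hφ0] at hp
        have hh := hC _ hmem (c * T) (by positivity) hdist
        refine ⟨hmem, ?_⟩
        have hp1 : ‖z.2‖ ^ 2 ≤ 1 := pow_le_one₀ (norm_nonneg _) hz.2.le
        have hexp : Real.exp (-T) ≤ 1 - T / 2 := by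
          rw [Real.exp_neg]
          refine inv_le_of_inv_le₀ (by linarith) ?_
          refine le_trans ?_ (Real.add_one_le_exp T)
          rw [inv_le_iff_one_le_mul₀ (by linarith)]
          nlinarith
        have hp2 : ‖(φ (-T) z).2‖ ^ 2 ≤ 1 - T / 2 :=
          (hp.trans (mul_le_of_le_one_right (Real.exp_pos _).le hp1)).trans hexp
        have hpot : ε * h (φ (-T) z).1 ≤ T ^ 2 * (C + 1 / c ^ 2) := by
          calc ε * h (φ (-T) z).1 ≤ ε * (C + 1 / (c * T) ^ 2) := by
                have := hε.1
                gcongr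
            _ = T ^ 2 * (T ^ 2 * C + 1 / c ^ 2) := by rw [hεT]; field_simp
            _ ≤ T ^ 2 * (1 * C + 1 / c ^ 2) := by
                gcongr
                exact pow_le_one₀ hTpos.le hTle
            _ = _ := by ring
        have hsmall : T ^ 2 * (C + 1 / c ^ 2) < T / 4 := by nlinarith
        simp only [Heps]
        linarith
      · have hshift : ∀ t, HasDerivAt (fun t => φ (t - T) z) (Zbar Z (φ (t - T) z)) t :=
          fun t => (hφ (t - T) z).comp_sub_const t T
        have := integralCurve_unique (contDiff_Zbar hZsmooth) (t₀ := 0)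
          (fun t => hφ t (φ (-T) z)) hshift (by simp [hφ0])
        simpa [hφ0] using congrFun this T
    · have : Continuous fun ε : ℝ => √(√ε) := by fun_prop
      simpa using (this.tendsto 0).mono_left nhdsWithin_le_nhds

end
end

section
/- Let V ⊂ ℝ^n be a bounded domain with smooth boundary, and let h : V → ℝ_{>0} be a positive smooth function with h(q) = dist(q, ∂V)^{−2} for all q sufficiently close to ∂V. Let (ε_k)_k be a sequence of positive numbers with ε_k → 0, and for each k let τ_k > 0 and let q_k : ℝ/τ_kℤ → V be a smooth loop satisfying q̈_k(t) + ε_k ∇h(q_k(t)) = 0 and |q̇_k(t)|²/2 + ε_k h(q_k(t)) = 1/2 for all t. Then liminf_{k→∞} τ_k > 0. -/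
/-!
Statement 10 (part of Lemma 6.6): for approximating Hamiltonian loops in a bounded
domain with smooth boundary, the periods stay bounded away from zero.
-/

open Filter

noncomputable section

open Set Metric

lemma norm_sub_le_of_norm_deriv_le_one {F : Type*} [NormedAddCommGroup F] [NormedSpace ℝ F]
    {u : ℝ → F} (hu : Differentiable ℝ u) (hv : ∀ t, ‖deriv u t‖ ≤ 1) {t T : ℝ}
    (ht : t ∈ Icc 0 T) : ‖u t - u 0‖ ≤ T := by
  have := Convex.norm_image_sub_le_of_norm_deriv_le (s := univ) (f := u) (C := 1)
    (fun x _ => hu x) (fun x _ => hv x) convex_univ (mem_univ 0) (mem_univ t)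
  rw [sub_zero, one_mul, Real.norm_of_nonneg ht.1] at this
  exact this.trans ht.2

/-- Pairing the acceleration of a closed curve with `u - u 0` and integrating over a period
bounds the kinetic energy by the total acceleration. -/
lemma integral_norm_deriv_sq_le {F : Type*} [NormedAddCommGroup F] [InnerProductSpace ℝ F]
    {u : ℝ → F} (hu : ContDiff ℝ 2 u) {T : ℝ} (hT : 0 < T) (h0 : u T = u 0)
    (hv : ∀ t, ‖deriv u t‖ ≤ 1) :
    ∫ t in (0 : ℝ)..T, ‖deriv u t‖ ^ 2 ≤ T * ∫ t in (0 : ℝ)..T, ‖deriv (deriv u) t‖ := by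
  have hu1 : ContDiff ℝ 1 (deriv u) := hu.deriv' (n := 1)
  have hc1 : Continuous (deriv u) := hu1.continuous
  have hc2 : Continuous (deriv (deriv u)) := hu1.continuous_deriv le_rfl
  have hc0 : Continuous u := hu.continuous
  have hd : ∀ t, HasDerivAt u (deriv u t) t := fun t =>
    (hu.differentiable (by norm_num) t).hasDerivAt
  have hd' : ∀ t, HasDerivAt (deriv u) (deriv (deriv u) t) t := fun t =>
    (hu1.differentiable (by norm_num) t).hasDerivAt
  have key : ∀ t, HasDerivAt (fun t => inner ℝ (u t - u 0) (deriv u t))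
      (inner ℝ (u t - u 0) (deriv (deriv u) t) + inner ℝ (deriv u t) (deriv u t)) t :=
    fun t => ((hd t).sub_const (u 0)).inner ℝ (hd' t)
  have hcA : Continuous fun t => inner ℝ (u t - u 0) (deriv (deriv u) t) := by fun_prop
  have hcB : Continuous fun t => inner ℝ (deriv u t) (deriv u t) := by fun_prop
  have hint := intervalIntegral.integral_eq_sub_of_hasDerivAt (a := 0) (b := T)
    (fun t _ => key t) ((hcA.add hcB).intervalIntegrable _ _)
  rw [intervalIntegral.integral_add (hcA.intervalIntegrable _ _) (hcB.intervalIntegrable _ _),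
    h0] at hint
  simp only [sub_self, inner_zero_left, real_inner_self_eq_norm_sq] at hint
  rw [← intervalIntegral.integral_const_mul]
  have hle : ∫ t in (0 : ℝ)..T, -inner ℝ (u t - u 0) (deriv (deriv u) t) ≤
      ∫ t in (0 : ℝ)..T, T * ‖deriv (deriv u) t‖ := by
    refine intervalIntegral.integral_mono_on hT.le (hcA.neg.intervalIntegrable _ _)
      (Continuous.intervalIntegrable (by fun_prop) _ _) fun t ht => ?_
    have hdist := norm_sub_le_of_norm_deriv_le_one (fun x => (hd x).differentiableAt) hv ht
    calc _ ≤ ‖u t - u 0‖ * ‖deriv (deriv u) t‖ :=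
          (neg_le_abs _).trans (abs_real_inner_le_norm _ _)
      _ ≤ _ := by gcongr
  rw [intervalIntegral.integral_neg] at hle
  linarith

/-- If the acceleration of a closed curve pushes `f` down at a definite rate, then the total
acceleration is bounded by the kinetic energy. -/
lemma integral_norm_deriv_deriv_le {F : Type*} [NormedAddCommGroup F] [NormedSpace ℝ F]
    {u : ℝ → F} (hu : ContDiff ℝ 2 u) {T : ℝ} (hT : 0 < T) (h0 : u T = u 0)
    (h1 : deriv u T = deriv u 0) {f : F → ℝ} (hf : ContDiff ℝ 2 f) {c C : ℝ}
    (hC : ∀ t ∈ Icc 0 T, ‖fderiv ℝ (fderiv ℝ f) (u t)‖ ≤ C)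
    (hc : ∀ t ∈ Icc 0 T, fderiv ℝ f (u t) (deriv (deriv u) t) ≤ -(c * ‖deriv (deriv u) t‖)) :
    c * ∫ t in (0 : ℝ)..T, ‖deriv (deriv u) t‖ ≤ C * ∫ t in (0 : ℝ)..T, ‖deriv u t‖ ^ 2 := by
  have hu1 : ContDiff ℝ 1 (deriv u) := hu.deriv' (n := 1)
  have hf1 : ContDiff ℝ 1 (fderiv ℝ f) := hf.fderiv_right (by norm_num)
  have hc1 : Continuous (deriv u) := hu1.continuous
  have hc2 : Continuous (deriv (deriv u)) := hu1.continuous_deriv le_rfl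
  have hc0 : Continuous u := hu.continuous
  have hcf1 : Continuous (fderiv ℝ f) := hf1.continuous
  have hcf2 : Continuous (fderiv ℝ (fderiv ℝ f)) := hf1.continuous_fderiv (by norm_num)
  have hd : ∀ t, HasDerivAt u (deriv u t) t := fun t =>
    (hu.differentiable (by norm_num) t).hasDerivAt
  have hd' : ∀ t, HasDerivAt (deriv u) (deriv (deriv u) t) t := fun t =>
    (hu1.differentiable (by norm_num) t).hasDerivAt
  have key : ∀ t, HasDerivAt (fun t => fderiv ℝ f (u t) (deriv u t))
      (fderiv ℝ (fderiv ℝ f) (u t) (deriv u t) (deriv u t) +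
        fderiv ℝ f (u t) (deriv (deriv u) t)) t := fun t =>
    (((hf1.differentiable (by norm_num) (u t)).hasFDerivAt.comp_hasDerivAt t (hd t)).clm_apply
      (hd' t))
  have hcA : Continuous fun t => fderiv ℝ (fderiv ℝ f) (u t) (deriv u t) (deriv u t) := by
    fun_prop
  have hcB : Continuous fun t => fderiv ℝ f (u t) (deriv (deriv u) t) := by fun_prop
  have hint := intervalIntegral.integral_eq_sub_of_hasDerivAt (a := 0) (b := T)
    (fun t _ => key t) ((hcA.add hcB).intervalIntegrable _ _)
  rw [h0, h1, sub_self] at hint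
  have hle : ∫ t in (0 : ℝ)..T, (fderiv ℝ (fderiv ℝ f) (u t) (deriv u t) (deriv u t) +
        fderiv ℝ f (u t) (deriv (deriv u) t)) ≤
      ∫ t in (0 : ℝ)..T, (C * ‖deriv u t‖ ^ 2 - c * ‖deriv (deriv u) t‖) := by
    refine intervalIntegral.integral_mono_on hT.le ((hcA.add hcB).intervalIntegrable _ _)
      (Continuous.intervalIntegrable (by fun_prop) _ _) fun t ht => ?_
    have hA : fderiv ℝ (fderiv ℝ f) (u t) (deriv u t) (deriv u t) ≤ C * ‖deriv u t‖ ^ 2 := by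
      refine (le_abs_self _).trans
        (((fderiv ℝ (fderiv ℝ f) (u t)).le_opNorm₂ (deriv u t) (deriv u t)).trans ?_)
      rw [mul_assoc, ← sq]
      exact mul_le_mul_of_nonneg_right (hC t ht) (by positivity)
    linarith [hc t ht]
  rw [hint, intervalIntegral.integral_sub (Continuous.intervalIntegrable (by fun_prop) _ _)
    (Continuous.intervalIntegrable (by fun_prop) _ _), intervalIntegral.integral_const_mul,
    intervalIntegral.integral_const_mul] at hle
  linarith

/-- At a maximum point `p` of `f` on a closed ball, lying at distance at most the radius from the
center, the derivative of `f` attains its norm in the outward radial direction. -/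
lemma radius_mul_norm_fderiv_le {F : Type*} [NormedAddCommGroup F] [NormedSpace ℝ F]
    {f : F → ℝ} {p x : F} {r : ℝ} (hr : 0 < r) (hp : p ∈ closedBall x r)
    (hf : DifferentiableAt ℝ f p) (hmax : IsMaxOn f (closedBall x r) p) :
    r * ‖fderiv ℝ f p‖ ≤ fderiv ℝ f p (p - x) := by
  have first_order : ∀ y ∈ closedBall x r, fderiv ℝ f p (y - p) ≤ 0 := fun y hy =>
    hmax.localize.hasFDerivWithinAt_nonpos hf.hasFDerivAt.hasFDerivWithinAt
      (sub_mem_posTangentConeAt_of_segment_subset ((convex_closedBall x r).segment_subset hp hy))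
  have hdir : ∀ w : F, ‖w‖ ≤ 1 → r * fderiv ℝ f p w ≤ fderiv ℝ f p (p - x) := fun w hw => by
    have hy : x + r • w ∈ closedBall x r := by
      rw [mem_closedBall, dist_eq_norm, add_sub_cancel_left, norm_smul, Real.norm_of_nonneg hr.le]
      nlinarith
    have := first_order _ hy
    rw [show x + r • w - p = r • w - (p - x) by abel, map_sub, map_smul, smul_eq_mul] at this
    linarith
  have h0 : 0 ≤ fderiv ℝ f p (p - x) := by simpa using hdir 0 (by simp)
  have : ‖fderiv ℝ f p‖ ≤ fderiv ℝ f p (p - x) / r := by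
    refine ContinuousLinearMap.opNorm_le_of_unit_norm (by positivity) fun w hw => ?_
    rw [Real.norm_eq_abs, abs_le', le_div_iff₀' hr, le_div_iff₀' hr, ← map_neg]
    exact ⟨hdir w hw.le, hdir (-w) (by rw [norm_neg]; exact hw.le)⟩
  rwa [le_div_iff₀' hr] at this

/-- If `h` dominates `‖· - p‖⁻²` near `x` with equality at `x`, its gradient at `x` is that of
`‖· - p‖⁻²`. -/
lemma gradient_eq_of_inverse_sq_touching {F : Type*} [NormedAddCommGroup F]
    [InnerProductSpace ℝ F] [CompleteSpace F] {h : F → ℝ} {p x : F}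
    (hxp : x ≠ p) (hd : DifferentiableAt ℝ h x) (hx : h x = 1 / dist x p ^ 2)
    (hle : ∀ᶠ y in nhds x, 1 / dist y p ^ 2 ≤ h y) :
    gradient h x = (2 / dist x p ^ 4) • (p - x) := by
  have hpos : 0 < dist x p := dist_pos.2 hxp
  have hmin : IsLocalMin (fun y => h y * ‖y - p‖ ^ 2) x := by
    filter_upwards [hle, eventually_ne_nhds hxp] with y hy hyp
    have hyp' : 0 < dist y p := dist_pos.2 hyp
    rw [← dist_eq_norm, ← dist_eq_norm, hx, div_mul_cancel₀ _ (by positivity)]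
    rwa [div_le_iff₀ (by positivity)] at hy
  have hder : HasFDerivAt (fun y => h y * ‖y - p‖ ^ 2)
      (h x • (2 • (innerSL ℝ (x - p)).comp (ContinuousLinearMap.id ℝ F)) +
        ‖x - p‖ ^ 2 • fderiv ℝ h x) x :=
    hd.hasFDerivAt.mul (((hasFDerivAt_id x).sub_const p).norm_sq)
  have hzero := hmin.hasFDerivAt_eq_zero hder
  refine ext_inner_right ℝ fun w => ?_
  have hw := congrArg (fun L : F →L[ℝ] ℝ => L w) hzero
  simp only [_root_.add_apply, _root_.smul_apply, smul_eq_mul,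
    ContinuousLinearMap.comp_apply, ContinuousLinearMap.id_apply, innerSL_apply_apply,
    _root_.zero_apply, nsmul_eq_mul, ← dist_eq_norm, hx] at hw
  rw [inner_gradient_left, inner_smul_left, ← neg_sub x p, inner_neg_left]
  simp only [conj_trivial]
  push_cast at hw
  field_simp at hw ⊢
  linarith

/-- A ball around a point of `{f < 0}` that avoids the zeros of `f` stays in `{f < 0}`. -/
lemma neg_on_ball_of_ne_zero {F : Type*} [NormedAddCommGroup F] [NormedSpace ℝ F] {f : F → ℝ}
    (hf : Continuous f) {x : F} {r : ℝ} (hx : f x < 0) (hne : ∀ y ∈ ball x r, f y ≠ 0) :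
    ∀ y ∈ ball x r, f y < 0 := by
  intro y hy
  by_contra! hy0
  obtain ⟨z, hz, hz0⟩ := (convex_ball x r).isPreconnected.intermediate_value
    (mem_ball_self (pos_of_mem_ball hy)) hy hf.continuousOn ⟨hx.le, hy0⟩
  exact hne z hz hz0

/-- Near the boundary of `{f < 0}`, a function equal to the inverse square of the distance to the
boundary has nonzero gradient, making a definite angle with the level sets of `f`. -/
lemma exists_gradient_transverse_near_frontier {F : Type*} [NormedAddCommGroup F]
    [InnerProductSpace ℝ F] [ProperSpace F] {V : Set F}
    (hVbdd : Bornology.IsBounded V) {f : F → ℝ} (hf : ContDiff ℝ 1 f) (hVf : V = {x | f x < 0})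
    (hfr : frontier V = {x | f x = 0}) (hne : (frontier V).Nonempty)
    (hreg : ∀ x ∈ frontier V, fderiv ℝ f x ≠ 0) {h : F → ℝ} (hh : DifferentiableOn ℝ h V)
    {δ : ℝ} (hδ : 0 < δ)
    (hhdist : ∀ x ∈ V, infDist x (frontier V) < δ → h x = 1 / infDist x (frontier V) ^ 2) :
    ∃ ρ > (0 : ℝ), ∃ c > (0 : ℝ), ∀ x ∈ V, infDist x (frontier V) < ρ →
      gradient h x ≠ 0 ∧ c * ‖gradient h x‖ ≤ fderiv ℝ f x (gradient h x) := by
  have hVo : IsOpen V := hVf ▸ isOpen_lt hf.continuous continuous_const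
  have hcl : IsCompact (closure V) := hVbdd.isCompact_closure
  have hfrc : IsCompact (frontier V) :=
    hcl.of_isClosed_subset isClosed_frontier frontier_subset_closure
  have hcf : Continuous (fderiv ℝ f) := hf.continuous_fderiv (by norm_num)
  obtain ⟨p₀, hp₀, hmin⟩ := hfrc.exists_isMinOn hne hcf.norm.continuousOn
  set m := ‖fderiv ℝ f p₀‖
  have hmpos : 0 < m := norm_pos_iff.2 (hreg p₀ hp₀)
  obtain ⟨η, hη, hunif⟩ := Metric.uniformContinuousOn_iff.1
    (hcl.uniformContinuousOn_of_continuous hcf.continuousOn) (m / 2) (by positivity)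
  refine ⟨min η δ, lt_min hη hδ, m / 2, by positivity, fun x hx hxd => ?_⟩
  obtain ⟨p, hp, hxp⟩ := hfrc.exists_infDist_eq_dist hne x
  have hxnot : ∀ y ∈ V, y ∉ frontier V := fun y hy hy' => by
    rw [hfr] at hy'
    rw [hVf] at hy
    exact hy.ne hy'
  have hxne : x ≠ p := fun hxp => hxnot x hx (hxp ▸ hp)
  have hpos : 0 < dist x p := dist_pos.2 hxne
  have hgrad : gradient h x = (2 / dist x p ^ 4) • (p - x) := by
    refine gradient_eq_of_inverse_sq_touching hxne (hh.differentiableAt (hVo.mem_nhds hx))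
      (by rw [hhdist x hx (hxd.trans_le (min_le_right _ _)), hxp]) ?_
    filter_upwards [hVo.mem_nhds hx, (continuous_infDist_pt (frontier V)).continuousAt.eventually_lt
      continuousAt_const (hxd.trans_le (min_le_right _ _))] with y hy hyd
    have hypos : 0 < infDist y (frontier V) :=
      (isClosed_frontier.notMem_iff_infDist_pos hne).1 (hxnot y hy)
    rw [hhdist y hy hyd]
    have := infDist_le_dist_of_mem (x := y) hp
    gcongr
  have hball : ∀ y ∈ closedBall x (dist x p), f y ≤ 0 := by
    have hneg := neg_on_ball_of_ne_zero (r := dist x p) hf.continuous (x := x)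
      (by rw [hVf] at hx; exact hx) fun y hy hy0 => by
        have hyf : y ∈ frontier V := by rw [hfr]; exact hy0
        have := infDist_le_dist_of_mem (x := x) hyf
        rw [mem_ball, dist_comm] at hy
        linarith
    rw [← closure_ball x hpos.ne']
    exact closure_minimal (fun y hy => (hneg y hy).le) (isClosed_le hf.continuous continuous_const)
  have hp0 : f p = 0 := by rw [hfr] at hp; exact hp
  have hradial := radius_mul_norm_fderiv_le (f := f) (p := p) hpos
    (by rw [mem_closedBall, dist_comm]) (hf.differentiable (by norm_num) p)
    (fun y hy => by rw [mem_ofPred_eq, hp0]; exact hball y hy)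
  have hclose := hunif x (subset_closure hx) p (frontier_subset_closure hp)
    (hxp ▸ hxd.trans_le (min_le_left _ _))
  have hmp : m ≤ ‖fderiv ℝ f p‖ := hmin hp
  have hdiff : fderiv ℝ f p (p - x) - fderiv ℝ f x (p - x) ≤ m / 2 * dist x p := by
    rw [dist_comm, dist_eq_norm] at hclose
    rw [dist_comm x p, dist_eq_norm, ← _root_.sub_apply]
    refine (le_abs_self _).trans
      (((fderiv ℝ f p - fderiv ℝ f x).le_opNorm (p - x)).trans ?_)
    gcongr
  refine ⟨?_, ?_⟩
  · rw [hgrad]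
    exact smul_ne_zero (by positivity) (sub_ne_zero.2 hxne.symm)
  · rw [hgrad, norm_smul, map_smul, smul_eq_mul, Real.norm_of_nonneg (by positivity),
      ← dist_eq_norm, dist_comm p x, mul_left_comm]
    refine mul_le_mul_of_nonneg_left ?_ (by positivity)
    nlinarith

/-- let `V ⊂ ℝⁿ` be a bounded domain with smooth boundary and
`h : V → ℝ_{>0}` positive smooth with `h(q) = dist(q,∂V)⁻²` near `∂V`. Let `ε_k → 0`,
`ε_k > 0`, and let `q_k : ℝ/τ_kℤ → V` be smooth loops with
`q̈_k + ε_k ∇h(q_k) = 0` and `|q̇_k|²/2 + ε_k h(q_k) = 1/2`. Then `liminf τ_k > 0`,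
i.e. there is `c > 0` with `τ_k ≥ c` for all large `k`. -/
theorem stmt10 (n : ℕ) (V : Set (E n)) (hVconn : IsConnected V)
    (hVbdd : Bornology.IsBounded V)
    -- smooth boundary via a global defining function
    (f : E n → ℝ) (hf : ContDiff ℝ (⊤ : ℕ∞) f)
    (hVf : V = {x | f x < 0}) (hfr : frontier V = {x | f x = 0})
    (hreg : ∀ x ∈ frontier V, gradient f x ≠ 0)
    -- the function h
    (h : E n → ℝ) (hh : ContDiffOn ℝ (⊤ : ℕ∞) h V) (hhpos : ∀ q ∈ V, 0 < h q)
    (hhdist : ∃ δ > (0 : ℝ), ∀ q ∈ V, Metric.infDist q (frontier V) < δ →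
      h q = 1 / Metric.infDist q (frontier V) ^ 2)
    -- the sequences
    (ε : ℕ → ℝ) (hε : ∀ k, 0 < ε k) (hε0 : Tendsto ε atTop (nhds 0))
    (τ : ℕ → ℝ) (hτ : ∀ k, 0 < τ k)
    (q : ℕ → ℝ → E n)
    (hqsmooth : ∀ k, ContDiff ℝ (⊤ : ℕ∞) (q k))
    (hqper : ∀ k t, q k (t + τ k) = q k t)
    (hqin : ∀ k t, q k t ∈ V)
    (hqeqn : ∀ k t, deriv (deriv (q k)) t + ε k • gradient h (q k t) = 0)
    (hqen : ∀ k t, ‖deriv (q k) t‖ ^ 2 / 2 + ε k * h (q k t) = 1 / 2) :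
    ∃ c > (0 : ℝ), ∀ᶠ k in atTop, c ≤ τ k := by
  have hVne := hVconn.nonempty
  have hVo : IsOpen V := hVf ▸ isOpen_lt hf.continuous continuous_const
  obtain ⟨δ, hδ, hhδ⟩ := hhdist
  have hne : (frontier V).Nonempty := by
    by_contra! hempty
    obtain ⟨x, hx⟩ := hVne
    have hx0 := hhδ x hx (by simpa [hempty] using hδ)
    have := hhpos x hx
    simp [hx0, hempty] at this
  have hreg' : ∀ x ∈ frontier V, fderiv ℝ f x ≠ 0 := fun x hx h0 =>
    hreg x hx (by simp [gradient, h0])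
  obtain ⟨ρ, hρ, c, hc, hnear⟩ := exists_gradient_transverse_near_frontier hVbdd
    (hf.of_le (by exact_mod_cast le_top)) hVf hfr hne hreg'
    (hh.differentiableOn (by simp)) hδ hhδ
  have hf2 : ContDiff ℝ 2 f := contDiff_infty.1 hf 2
  have hcl : IsCompact (closure V) := hVbdd.isCompact_closure
  obtain ⟨C, hC⟩ := hcl.exists_bound_of_continuousOn
    ((hf2.fderiv_right (m := 1) (by norm_num)).continuous_fderiv (by norm_num)).continuousOn
  obtain ⟨x₀, hx₀⟩ := hVne
  have hC0 : 0 ≤ C := (norm_nonneg _).trans (hC x₀ (subset_closure hx₀))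
  set K : Set (E n) := closure V ∩ {x | ρ / 4 ≤ infDist x (frontier V)}
  have hKc : IsCompact K :=
    hcl.inter_right (isClosed_le continuous_const (continuous_infDist_pt _))
  have hKV : K ⊆ V := fun x hx => by
    by_contra hxV
    have hxf : x ∈ frontier V := by
      rw [hVo.frontier_eq]
      exact ⟨hx.1, hxV⟩
    have := hx.2
    rw [mem_ofPred_eq, infDist_zero_of_mem hxf] at this
    linarith
  obtain ⟨M₀, hM₀⟩ := hKc.exists_bound_of_continuousOn (hh.continuousOn.mono hKV)
  obtain ⟨M₁, hM₁⟩ := hKc.exists_bound_of_continuousOn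
    ((hh.continuousOn_fderiv_of_isOpen hVo (by simp)).mono hKV)
  refine ⟨min (min 1 (ρ / 4)) (c / (C + 1)), by positivity, ?_⟩
  have hlim₀ : Tendsto (fun k => ε k * M₀) atTop (nhds 0) := by
    simpa using hε0.mul_const M₀
  have hlim₁ : Tendsto (fun k => ε k * M₁) atTop (nhds 0) := by
    simpa using hε0.mul_const M₁
  filter_upwards [hlim₀.eventually_lt_const (show (0 : ℝ) < 1 / 4 by norm_num),
    hlim₁.eventually_lt_const (show (0 : ℝ) < 1 / 4 by norm_num)] with k hk₀ hk₁
  by_contra! hlt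
  have hτ1 : τ k < 1 := hlt.trans_le ((min_le_left _ _).trans (min_le_left _ _))
  have hτρ : τ k < ρ / 4 := hlt.trans_le ((min_le_left _ _).trans (min_le_right _ _))
  have hτc : τ k < c / (C + 1) := hlt.trans_le (min_le_right _ _)
  have hτk := hτ k
  have hεk := hε k
  have hu : ContDiff ℝ 2 (q k) := contDiff_infty.1 (hqsmooth k) 2
  have hu1 : ContDiff ℝ 1 (deriv (q k)) := hu.deriv' (n := 1)
  have hc1 : Continuous (deriv (q k)) := hu1.continuous
  have hc2 : Continuous (deriv (deriv (q k))) := hu1.continuous_deriv le_rfl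
  have hclosed : q k (τ k) = q k 0 := by simpa using hqper k 0
  have hclosed' : deriv (q k) (τ k) = deriv (q k) 0 := by
    have := deriv_comp_add_const (q k) (τ k) 0
    rw [funext (hqper k), zero_add] at this
    exact this.symm
  have hv : ∀ t, ‖deriv (q k) t‖ ≤ 1 := fun t => by
    have := hqen k t
    have := mul_pos hεk (hhpos _ (hqin k t))
    nlinarith [norm_nonneg (deriv (q k) t)]
  have hacc : ∀ t, deriv (deriv (q k)) t = -(ε k • gradient h (q k t)) := fun t =>
    eq_neg_of_add_eq_zero_left (hqeqn k t)
  have henergy := integral_norm_deriv_sq_le hu hτk hclosed hv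
  have hdist : ∀ t ∈ Icc 0 (τ k), dist (q k t) (q k 0) ≤ τ k := fun t ht => by
    rw [dist_eq_norm]
    exact norm_sub_le_of_norm_deriv_le_one (hu.differentiable (by norm_num)) hv ht
  by_cases hstart : infDist (q k 0) (frontier V) < ρ / 2
  · have hin : ∀ t ∈ Icc 0 (τ k), infDist (q k t) (frontier V) < ρ := fun t ht => by
      have := infDist_le_infDist_add_dist (s := frontier V) (x := q k t) (y := q k 0)
      linarith [hdist t ht]
    have hpush := integral_norm_deriv_deriv_le hu hτk hclosed hclosed' hf2
      (fun t _ => hC _ (subset_closure (hqin k t))) (c := c) fun t ht => by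
        rw [hacc, norm_neg, norm_smul, Real.norm_of_nonneg hεk.le, map_neg, map_smul, smul_eq_mul]
        have := mul_le_mul_of_nonneg_left (hnear _ (hqin k t) (hin t ht)).2 hεk.le
        linarith
    have hpos : 0 < ∫ t in (0 : ℝ)..τ k, ‖deriv (deriv (q k)) t‖ := by
      refine intervalIntegral.intervalIntegral_pos_of_pos_on (hc2.norm.intervalIntegrable _ _)
        (fun t ht => ?_) hτk
      rw [hacc, norm_neg, norm_pos_iff]
      exact smul_ne_zero hεk.ne' (hnear _ (hqin k t) (hin t (Ioo_subset_Icc_self ht))).1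
    rw [lt_div_iff₀ (by positivity)] at hτc
    have := hpush.trans (mul_le_mul_of_nonneg_left henergy hC0)
    rw [← mul_assoc] at this
    have := le_of_mul_le_mul_right this hpos
    linarith
  · have hin : ∀ t ∈ Icc 0 (τ k), q k t ∈ K := fun t ht => by
      refine ⟨subset_closure (hqin k t), ?_⟩
      have := infDist_le_infDist_add_dist (s := frontier V) (x := q k 0) (y := q k t)
      rw [dist_comm] at this
      rw [mem_ofPred_eq]
      linarith [hdist t ht]
    have hacc_le : ∫ t in (0 : ℝ)..τ k, ‖deriv (deriv (q k)) t‖ ≤ ∫ _ in (0 : ℝ)..τ k, 1 / 4 := by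
      refine intervalIntegral.integral_mono_on hτk.le (hc2.norm.intervalIntegrable _ _)
        (continuous_const.intervalIntegrable _ _) fun t ht => ?_
      have hg : ‖gradient h (q k t)‖ ≤ M₁ := by
        simpa [gradient] using hM₁ _ (hin t ht)
      rw [hacc, norm_neg, norm_smul, Real.norm_of_nonneg hεk.le]
      exact (mul_le_mul_of_nonneg_left hg hεk.le).trans hk₁.le
    have hvel_ge : ∫ _ in (0 : ℝ)..τ k, 1 / 2 ≤ ∫ t in (0 : ℝ)..τ k, ‖deriv (q k) t‖ ^ 2 := by
      refine intervalIntegral.integral_mono_on hτk.le (continuous_const.intervalIntegrable _ _)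
        (Continuous.intervalIntegrable (by fun_prop) _ _) fun t ht => ?_
      have hle : h (q k t) ≤ M₀ := (le_abs_self _).trans (hM₀ _ (hin t ht))
      linarith [hqen k t, mul_le_mul_of_nonneg_left hle hεk.le]
    simp only [intervalIntegral.integral_const, sub_zero, smul_eq_mul] at hacc_le hvel_ge
    nlinarith

end
end
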